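/- arXiv:1806.04333 — 2 statements merged into one kernel-verified Lean document; each statement's English description precedes it below -/
import Mathlib

section
/- Let m, n ∈ ℕ, p ∈ (0,2], and let X = (ℝ^m, ‖·‖_X) be an m-dimensional quasi-normed space which admits an isometric embedding into L_p (i.e. there is a measure space (Ω,μ) and a linear map T : ℝ^m → L_p(μ) with ‖Tx‖_{L_p} = ‖x‖_X for all x). Then for every pair of unit vectors θ = (θ_1,…,θ_n) and φ = (φ_1,…,φ_n) in ℝ^n, if (θ_1²,…,θ_n²) is majorized by (φ_1²,…,φ_n²), then |B_p^n(X) ∩ H_θ| ≤ |B_p^n(X) ∩ H_φ|, where |·| denotes (m(n−1))-dimensional Lebesgue measure on the respective subspaces. -/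
open MeasureTheory Real Filter
open scoped ENNReal

noncomputable section

/-- `N` is a quasi-norm on `ℝ^m`. -/
def IsQuasiNorm (m : ℕ) (N : (Fin m → ℝ) → ℝ) : Prop :=
  (∀ x, 0 ≤ N x) ∧ (∀ x, N x = 0 ↔ x = 0) ∧
    (∀ (a : ℝ) (x : Fin m → ℝ), N (a • x) = |a| * N x) ∧
    ∃ C : ℝ, 1 ≤ C ∧ ∀ x y, N (x + y) ≤ C * (N x + N y)

/-- `X = (ℝ^m, N)` admits an isometric embedding into some `L_p(μ)` space:
there are a measure space `(Ω, μ)` and a linear map `T : ℝ^m → L_p(μ)` with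
`‖T x‖_{L_p(μ)} = N x` for every `x`. -/
def EmbedsIntoLp (m : ℕ) (p : ℝ) (N : (Fin m → ℝ) → ℝ) : Prop :=
  ∃ (Ω : Type) (_ : MeasurableSpace Ω) (μ : Measure Ω) (T : (Fin m → ℝ) →ₗ[ℝ] (Ω → ℝ)),
    (∀ x, Integrable (fun ω => |T x ω| ^ p) μ) ∧
    ∀ x, (∫ ω, |T x ω| ^ p ∂μ) ^ (1 / p) = N x

/-- `α` is majorized by `β`: for every `k`, the sum of the `k` largest entries of `α` is at
most that of `β` (expressed via finite subsets: the sum of the `k` largest entries is the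
maximum of `∑ i ∈ A, · i` over sets `A` of cardinality `k`), and the total sums agree. -/
def IsMajorizedBy {n : ℕ} (α β : Fin n → ℝ) : Prop :=
  (∀ A : Finset (Fin n), ∃ B : Finset (Fin n), B.card = A.card ∧ ∑ i ∈ A, α i ≤ ∑ i ∈ B, β i) ∧
    ∑ i, α i = ∑ i, β i

/-- The unit ball `B_p^n(X)` of `ℓ_p^n(X)` for `X = (ℝ^m, N)` and `0 < p < ∞`. -/
def lpBall (m n : ℕ) (p : ℝ) (N : (Fin m → ℝ) → ℝ) : Set (Fin n × Fin m → ℝ) :=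
  {x | ∑ i : Fin n, N (fun j => x (i, j)) ^ p ≤ 1}

/-- The block hyperplane `H_θ = {(x_1,…,x_n) ∈ (ℝ^m)^n : ∑ θ_i x_i = 0}`. -/
def blockHyp (m n : ℕ) (θ : Fin n → ℝ) : Set (Fin n × Fin m → ℝ) :=
  {x | ∀ j : Fin m, ∑ i : Fin n, θ i * x (i, j) = 0}

/-- `ι` is a linear isometric parametrization (w.r.t. the Euclidean structures) of the
subspace `H` of `ℝ^{mn} = (ℝ^m)^n` by `ℝ^d`; for `A ⊆ H`, `volume (⇑ι ⁻¹' A)` is then the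
`d`-dimensional Lebesgue measure of `A` inside `H`. -/
def IsEuclParam (m n d : ℕ) (ι : (Fin d → ℝ) →ₗ[ℝ] (Fin n × Fin m → ℝ))
    (H : Set (Fin n × Fin m → ℝ)) : Prop :=
  (∀ y, ∑ c, ι y c ^ 2 = ∑ i, y i ^ 2) ∧ Set.range ⇑ι = H

theorem sum_mul_nonneg_of_monotone_of_suffix_sum_nonneg :
    ∀ {n : ℕ} (g d : Fin n → ℝ), Monotone g → (∀ i, 0 ≤ g i) →
      (∀ k, 0 ≤ ∑ j ∈ Finset.Ici k, d j) → 0 ≤ ∑ j, g j * d j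
  | 0, _, _, _, _, _ => by simp
  | n + 1, g, d, hg, hg0, hd => by
    have ih := sum_mul_nonneg_of_monotone_of_suffix_sum_nonneg
      (fun j : Fin n => g j.succ - g 0) (fun j => d j.succ)
      (fun i j hij => by
        have := hg (Fin.succ_le_succ_iff.2 hij)
        simpa using this)
      (fun i => sub_nonneg.2 (hg (Fin.zero_le _)))
      (fun k => by
        have h := hd k.succ
        have e : Finset.Ici k.succ = (Finset.Ici k).map (Fin.succEmb n) := by
          ext j
          refine Fin.cases ?_ (fun j => ?_) j
          · simp
          · simp
        rw [e, Finset.sum_map] at h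
        exact h)
    have h0 : 0 ≤ ∑ j, d j := by
      have h := hd 0
      rwa [show Finset.Ici (0 : Fin (n + 1)) = Finset.univ by ext; simp] at h
    rw [Fin.sum_univ_succ] at h0 ⊢
    have e : ∑ j : Fin n, (g j.succ - g 0) * d j.succ
        = ∑ j : Fin n, g j.succ * d j.succ - g 0 * ∑ j : Fin n, d j.succ := by
      rw [Finset.mul_sum, ← Finset.sum_sub_distrib]
      exact Finset.sum_congr rfl fun j _ => by ring
    rw [e] at ih
    nlinarith [mul_nonneg (hg0 0) h0]

theorem sum_le_sum_of_card_eq_of_forall_le {ι : Type*} [DecidableEq ι] (β : ι → ℝ) (S B : Finset ι)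
    (hcard : B.card = S.card) (c : ℝ) (hS : ∀ i ∈ S, c ≤ β i) (hB : ∀ i, i ∉ S → β i ≤ c) :
    ∑ i ∈ B, β i ≤ ∑ i ∈ S, β i := by
  rw [← Finset.sum_sdiff_le_sum_sdiff]
  have h1 : (B \ S).card = (S \ B).card := by
    have h2 := Finset.card_sdiff_add_card_inter B S
    have h3 := Finset.card_sdiff_add_card_inter S B
    rw [Finset.inter_comm] at h3
    omega
  calc ∑ i ∈ B \ S, β i ≤ (B \ S).card • c :=
        Finset.sum_le_card_nsmul _ _ _ fun i hi => hB i (Finset.mem_sdiff.1 hi).2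
    _ = (S \ B).card • c := by rw [h1]
    _ ≤ ∑ i ∈ S \ B, β i :=
        Finset.card_nsmul_le_sum _ _ _ fun i hi => hS i (Finset.mem_sdiff.1 hi).1

/-- Some rearrangement of a majorizing vector pairs at least as well with a given vector. -/
theorem IsMajorizedBy.exists_perm_sum_mul_le {n : ℕ} {α β : Fin n → ℝ} (h : IsMajorizedBy α β)
    (c : Fin n → ℝ) : ∃ σ : Equiv.Perm (Fin n), ∑ i, c i * α i ≤ ∑ i, c i * β (σ i) := by
  rcases n with _ | n
  · exact ⟨1, by simp⟩
  set τ := Tuple.sort c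
  set γ := Tuple.sort β
  have hτ : Monotone (c ∘ τ) := Tuple.monotone_sort c
  have hγ : Monotone (β ∘ γ) := Tuple.monotone_sort β
  refine ⟨τ.symm.trans γ, ?_⟩
  have key := sum_mul_nonneg_of_monotone_of_suffix_sum_nonneg
    (fun j => c (τ j) - c (τ 0)) (fun j => β (γ j) - α (τ j))
    (fun i j hij => sub_le_sub_right (hτ hij) _)
    (fun i => sub_nonneg.2 (hτ (Fin.zero_le _)))
    (fun k => by
      obtain ⟨B, hB, hle⟩ := h.1 ((Finset.Ici k).map τ.toEmbedding)
      rw [Finset.card_map] at hB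
      have h2 := sum_le_sum_of_card_eq_of_forall_le β ((Finset.Ici k).map γ.toEmbedding) B
        (by rw [Finset.card_map, hB]) (β (γ k))
        (by
          intro i hi
          obtain ⟨j, hj, rfl⟩ := Finset.mem_map.1 hi
          exact hγ (Finset.mem_Ici.1 hj))
        (by
          intro i hi
          obtain ⟨j, rfl⟩ := γ.surjective i
          refine hγ (le_of_not_ge fun hkj => hi ?_)
          exact Finset.mem_map.2 ⟨j, Finset.mem_Ici.2 hkj, rfl⟩)
      rw [Finset.sum_map] at hle h2
      rw [Finset.sum_sub_distrib]
      exact sub_nonneg.2 (hle.trans h2))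
  have hα : ∑ j, α (τ j) = ∑ j, α j := Equiv.sum_comp τ α
  have hβ : ∑ j, β (γ j) = ∑ j, β j := Equiv.sum_comp γ β
  have e1 : ∑ i, c i * α i = ∑ j, c (τ j) * α (τ j) :=
    (Equiv.sum_comp τ fun i => c i * α i).symm
  have e2 : ∑ i, c i * β ((τ.symm.trans γ) i) = ∑ j, c (τ j) * β (γ j) := by
    rw [← Equiv.sum_comp τ]
    simp
  have e3 : ∑ j, (c (τ j) - c (τ 0)) * (β (γ j) - α (τ j))
      = ∑ j, c (τ j) * β (γ j) - ∑ j, c (τ j) * α (τ j)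
        - c (τ 0) * (∑ j, β (γ j) - ∑ j, α (τ j)) := by
    rw [← Finset.sum_sub_distrib, ← Finset.sum_sub_distrib, Finset.mul_sum,
      ← Finset.sum_sub_distrib]
    exact Finset.sum_congr rfl fun j _ => by ring
  rw [e3, hα, hβ, h.2, sub_self, mul_zero] at key
  rw [e1, e2]
  linarith

/-- A majorized vector is a convex combination of rearrangements of the majorizing one. -/
theorem IsMajorizedBy.exists_convex_combination {n : ℕ} {α β : Fin n → ℝ}
    (h : IsMajorizedBy α β) :
    ∃ w : Equiv.Perm (Fin n) → ℝ, (∀ σ, 0 ≤ w σ) ∧ ∑ σ, w σ = 1 ∧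
      ∀ i, α i = ∑ σ, w σ * β (σ i) := by
  have hmem : α ∈ convexHull ℝ (Set.range fun σ : Equiv.Perm (Fin n) => β ∘ σ) := by
    by_contra hα
    obtain ⟨f, u, hf, hu⟩ := geometric_hahn_banach_closed_point (convex_convexHull ℝ _)
      ((Set.finite_range fun σ : Equiv.Perm (Fin n) => β ∘ σ).isClosed_convexHull ℝ) hα
    have hfx : ∀ x, f x = ∑ i, f (Pi.single i 1) * x i := fun x => by
      conv_lhs => rw [← Finset.univ_sum_single x, map_sum]
      refine Finset.sum_congr rfl fun i _ => ?_
      rw [mul_comm, ← smul_eq_mul, ← map_smul, ← Pi.single_smul, smul_eq_mul, mul_one]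
    obtain ⟨σ, hσ⟩ := h.exists_perm_sum_mul_le fun i => f (Pi.single i 1)
    have := hf (β ∘ σ) (subset_convexHull ℝ _ ⟨σ, rfl⟩)
    rw [hfx] at this hu
    simp only [Function.comp_apply] at this
    linarith
  rw [convexHull_range_eq_exists_affineCombination] at hmem
  obtain ⟨s, w, hw0, hw1, hw⟩ := hmem
  rw [Finset.affineCombination_eq_linear_combination _ _ _ hw1] at hw
  classical
  refine ⟨fun σ => if σ ∈ s then w σ else 0, fun σ => ?_, ?_, fun i => ?_⟩
  · beta_reduce; split_ifs with hσ
    exacts [hw0 σ hσ, le_rfl]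
  · simpa using hw1
  · rw [← hw]
    simp [Finset.sum_apply]

/-- The smallest class of functions on `ℝ^m` that contains the centred Gaussians and is closed
under nonnegative combinations and pointwise limits of uniformly bounded sequences. -/
inductive IsGaussMix {m : ℕ} : ((Fin m → ℝ) → ℝ) → Prop
  | gauss (A : Matrix (Fin m) (Fin m) ℝ) (hA : A.PosSemidef) :
      IsGaussMix fun x => exp (-(x ⬝ᵥ A.mulVec x))
  | add (f g : (Fin m → ℝ) → ℝ) (hf : IsGaussMix f) (hg : IsGaussMix g) :
      IsGaussMix fun x => f x + g x
  | smul (c : ℝ) (hc : 0 ≤ c) (f : (Fin m → ℝ) → ℝ) (hf : IsGaussMix f) :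
      IsGaussMix fun x => c * f x
  | lim (F : ℕ → (Fin m → ℝ) → ℝ) (f : (Fin m → ℝ) → ℝ) (C : ℝ) (hF : ∀ k, IsGaussMix (F k))
      (hC : ∀ k x, F k x ≤ C) (hlim : ∀ x, Tendsto (fun k => F k x) atTop (nhds (f x))) :
      IsGaussMix f

namespace IsGaussMix

variable {m : ℕ} {f g : (Fin m → ℝ) → ℝ}

theorem nonneg (hf : IsGaussMix f) (x : Fin m → ℝ) : 0 ≤ f x := by
  induction hf with
  | gauss A hA => positivity
  | add f g _ _ ihf ihg => exact add_nonneg ihf ihg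
  | smul c hc f _ ih => exact mul_nonneg hc ih
  | lim F f C _ _ hlim ih => exact ge_of_tendsto' (hlim x) ih

theorem exists_le (hf : IsGaussMix f) : ∃ C : ℝ, ∀ x, f x ≤ C := by
  induction hf with
  | gauss A hA =>
    refine ⟨1, fun x => exp_le_one_iff.2 (neg_nonpos.2 ?_)⟩
    simpa using hA.dotProduct_mulVec_nonneg x
  | add f g _ _ ihf ihg =>
    obtain ⟨C, hC⟩ := ihf
    obtain ⟨D, hD⟩ := ihg
    exact ⟨C + D, fun x => add_le_add (hC x) (hD x)⟩
  | smul c hc f _ ih =>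
    obtain ⟨C, hC⟩ := ih
    exact ⟨c * C, fun x => mul_le_mul_of_nonneg_left (hC x) hc⟩
  | lim F f C _ hC hlim _ => exact ⟨C, fun x => le_of_tendsto' (hlim x) fun k => hC k x⟩

theorem measurable (hf : IsGaussMix f) : Measurable f := by
  induction hf with
  | gauss A hA =>
    refine Continuous.measurable ?_
    exact continuous_exp.comp
      (continuous_id.dotProduct (continuous_const.matrix_mulVec continuous_id)).neg
  | add f g _ _ ihf ihg => exact ihf.add ihg
  | smul c hc f _ ih => exact ih.const_mul c
  | lim F f C _ _ hlim ih => exact measurable_of_tendsto_metrizable ih (tendsto_pi_nhds.2 hlim)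

theorem mul (hf : IsGaussMix f) (hg : IsGaussMix g) : IsGaussMix fun x => f x * g x := by
  induction hf with
  | gauss A hA =>
    induction hg with
    | gauss B hB =>
      have := gauss (A + B) (hA.add hB)
      simpa [Matrix.add_mulVec, ← exp_add, add_comm] using this
    | add f g _ _ ihf ihg => simpa only [mul_add] using ihf.add _ _ ihg
    | smul c hc f _ ih => simpa only [mul_left_comm] using ih.smul c hc
    | lim F f C hF hC hlim ih =>
      refine lim _ _ (1 * C) ih (fun k x => ?_) fun x => (hlim x).const_mul _
      refine mul_le_mul (exp_le_one_iff.2 (neg_nonpos.2 ?_)) (hC k x) ((hF k).nonneg x) zero_le_one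
      simpa using hA.dotProduct_mulVec_nonneg x
  | add f g _ _ ihf ihg => simpa only [add_mul] using ihf.add _ _ ihg
  | smul c hc f _ ih => simpa only [mul_assoc] using ih.smul c hc
  | lim F f C hF hC hlim ih =>
    obtain ⟨D, hD⟩ := hg.exists_le
    refine lim _ _ (C * D) ih (fun k x => ?_) fun x => (hlim x).mul_const _
    exact mul_le_mul (hC k x) (hD x) (hg.nonneg x) (((hF k).nonneg x).trans (hC k x))

theorem one : IsGaussMix fun _ : Fin m → ℝ => 1 := by
  simpa using gauss (0 : Matrix (Fin m) (Fin m) ℝ) Matrix.PosSemidef.zero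

theorem const {c : ℝ} (hc : 0 ≤ c) : IsGaussMix fun _ : Fin m → ℝ => c := by
  simpa using (one (m := m)).smul c hc

theorem pow (hf : IsGaussMix f) (k : ℕ) : IsGaussMix fun x => f x ^ k := by
  induction k with
  | zero => simpa using one
  | succ k ih => simpa only [pow_succ] using ih.mul hf

theorem sum {ι : Type*} (s : Finset ι) (F : ι → (Fin m → ℝ) → ℝ)
    (hF : ∀ i ∈ s, IsGaussMix (F i)) : IsGaussMix fun x => ∑ i ∈ s, F i x := by
  classical
  induction s using Finset.induction_on with
  | empty => simpa using const (m := m) le_rfl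
  | insert i s hi ih =>
    simp only [Finset.sum_insert hi]
    exact (hF i (by simp)).add _ _ (ih fun j hj => hF j (by simp [hj]))

theorem exp_comp (hf : IsGaussMix f) : IsGaussMix fun x => Real.exp (f x) := by
  obtain ⟨C, hC⟩ := hf.exists_le
  refine lim (fun K x => ∑ k ∈ Finset.range K, (k.factorial : ℝ)⁻¹ * f x ^ k) _ (Real.exp C)
    (fun K => sum _ _ fun k _ => (hf.pow k).smul _ (by positivity)) (fun K x => ?_) fun x => ?_
  · refine le_trans ?_ (exp_le_exp.2 (hC x))
    refine le_trans (le_of_eq ?_) (sum_le_exp_of_nonneg (hf.nonneg x) K)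
    exact Finset.sum_congr rfl fun k _ => by ring
  · rw [exp_eq_exp_ℝ]
    have := (NormedSpace.expSeries_div_hasSum_exp (𝔸 := ℝ) (f x)).tendsto_sum_nat
    refine this.congr fun K => Finset.sum_congr rfl fun k _ => by ring

end IsGaussMix

/-- Nonnegative functions whose negative multiples have Gaussian mixtures as exponentials. -/
def IsMixExponent {m : ℕ} (h : (Fin m → ℝ) → ℝ) : Prop :=
  (∀ x, 0 ≤ h x) ∧ ∀ c : ℝ, 0 ≤ c → IsGaussMix fun x => exp (-(c * h x))

namespace IsMixExponent

variable {m : ℕ} {f g : (Fin m → ℝ) → ℝ}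

theorem add (hf : IsMixExponent f) (hg : IsMixExponent g) :
    IsMixExponent fun x => f x + g x := by
  refine ⟨fun x => add_nonneg (hf.1 x) (hg.1 x), fun c hc => ?_⟩
  simpa only [← exp_add, mul_add, neg_add] using (hf.2 c hc).mul (hg.2 c hc)

theorem zero : IsMixExponent fun _ : Fin m → ℝ => 0 :=
  ⟨fun _ => le_rfl, fun c _ => by simpa using IsGaussMix.one⟩

theorem smul (hf : IsMixExponent f) {a : ℝ} (ha : 0 ≤ a) : IsMixExponent fun x => a * f x :=
  ⟨fun x => mul_nonneg ha (hf.1 x), fun c hc => by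
    simpa only [mul_assoc] using hf.2 (c * a) (mul_nonneg hc ha)⟩

theorem sum {ι : Type*} (s : Finset ι) (F : ι → (Fin m → ℝ) → ℝ)
    (hF : ∀ i ∈ s, IsMixExponent (F i)) : IsMixExponent fun x => ∑ i ∈ s, F i x := by
  classical
  induction s using Finset.induction_on with
  | empty => simpa using zero (m := m)
  | insert i s hi ih =>
    simp only [Finset.sum_insert hi]
    exact (hF i (by simp)).add (ih fun j hj => hF j (by simp [hj]))

theorem lim {F : ℕ → (Fin m → ℝ) → ℝ} (hF : ∀ k, IsMixExponent (F k))
    (hlim : ∀ x, Tendsto (fun k => F k x) atTop (nhds (f x))) : IsMixExponent f := by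
  refine ⟨fun x => ge_of_tendsto' (hlim x) fun k => (hF k).1 x, fun c hc => ?_⟩
  refine IsGaussMix.lim _ _ 1 (fun k => (hF k).2 c hc) (fun k x => ?_) fun x => ?_
  · exact exp_le_one_iff.2 (neg_nonpos.2 (mul_nonneg hc ((hF k).1 x)))
  · exact (continuous_exp.tendsto _).comp ((hlim x).const_mul c).neg

theorem quadratic {A : Matrix (Fin m) (Fin m) ℝ} (hA : A.PosSemidef) :
    IsMixExponent fun x => x ⬝ᵥ A.mulVec x := by
  refine ⟨fun x => by simpa using hA.dotProduct_mulVec_nonneg x, fun c hc => ?_⟩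
  simpa [Matrix.smul_mulVec] using IsGaussMix.gauss (c • A) (hA.smul hc)

theorem one_sub_exp_quadratic {A : Matrix (Fin m) (Fin m) ℝ} (hA : A.PosSemidef) :
    IsMixExponent fun x => 1 - exp (-(x ⬝ᵥ A.mulVec x)) := by
  refine ⟨fun x => sub_nonneg.2 (exp_le_one_iff.2 (neg_nonpos.2 ?_)), fun c hc => ?_⟩
  · simpa using hA.dotProduct_mulVec_nonneg x
  · have := (((IsGaussMix.gauss A hA).smul c hc).exp_comp).smul (exp (-c)) (exp_pos _).le
    refine (congrArg IsGaussMix (funext fun x => ?_)).mp this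
    rw [← exp_add]
    congr 1
    ring

theorem integral_simpleFunc {Ω E : Type*} [MeasurableSpace Ω] {μ : Measure Ω}
    (F : SimpleFunc Ω E) (g : E → (Fin m → ℝ) → ℝ) (hg : ∀ ω, IsMixExponent (g (F ω)))
    (hint : ∀ x, Integrable (fun ω => g (F ω) x) μ) :
    IsMixExponent fun x => ∫ ω, g (F ω) x ∂μ := by
  have e : ∀ x, ∫ ω, g (F ω) x ∂μ = ∑ y ∈ F.range, μ.real (F ⁻¹' {y}) * g y x := by
    intro x
    have e1 : ∀ ω, g (F ω) x
        = ∑ y ∈ F.range, (F ⁻¹' {y}).indicator (fun _ => g y x) ω := by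
      intro ω
      rw [Finset.sum_eq_single (F ω)]
      · simp
      · intro b _ hb
        exact Set.indicator_of_notMem (fun h => hb (by simpa using h.symm)) _
      · intro h
        exact absurd (F.mem_range_self ω) h
    simp_rw [e1]
    rw [integral_finsetSum]
    · refine Finset.sum_congr rfl fun y _ => ?_
      rw [integral_indicator_const _ (F.measurableSet_fiber y), smul_eq_mul]
    · intro y _
      refine ((hint x).indicator (F.measurableSet_fiber y)).congr (ae_of_all _ fun ω => ?_)
      by_cases h : ω ∈ F ⁻¹' {y}
      · rw [Set.indicator_of_mem h, Set.indicator_of_mem h]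
        rw [show F ω = y from h]
      · rw [Set.indicator_of_notMem h, Set.indicator_of_notMem h]
  simp_rw [e]
  refine sum _ _ fun y hy => ?_
  obtain ⟨ω, rfl⟩ := SimpleFunc.mem_range.1 hy
  exact (hg ω).smul measureReal_nonneg

theorem integral {Ω E : Type*} [MeasurableSpace Ω] {μ : Measure Ω} [NormedAddCommGroup E]
    [MeasurableSpace E] [BorelSpace E] [SecondCountableTopology E] {M : Ω → E}
    (hM : AEMeasurable M μ) {S : Set E} (h0 : 0 ∈ S) (hMS : ∀ᵐ ω ∂μ, M ω ∈ S)
    {g : E → (Fin m → ℝ) → ℝ} (hg : ∀ a ∈ S, IsMixExponent (g a))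
    (hgc : ∀ x, Continuous fun a => g a x) (bound : (Fin m → ℝ) → Ω → ℝ)
    (hbound : ∀ x, Integrable (bound x) μ)
    (hle : ∀ x, ∀ᵐ ω ∂μ, ∀ a ∈ S, ‖a‖ ≤ 2 * ‖M ω‖ → g a x ≤ bound x ω) :
    IsMixExponent fun x => ∫ ω, g (M ω) x ∂μ := by
  set F := SimpleFunc.approxOn (hM.mk M) hM.measurable_mk S 0 h0
  have hFS : ∀ k ω, F k ω ∈ S := fun k ω => SimpleFunc.approxOn_mem hM.measurable_mk h0 k ω
  have hb : ∀ x k, ∀ᵐ ω ∂μ, ‖g (F k ω) x‖ ≤ bound x ω := by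
    intro x k
    filter_upwards [hle x, hM.ae_eq_mk] with ω hω hω'
    rw [norm_of_nonneg ((hg _ (hFS k ω)).1 x)]
    refine hω _ (hFS k ω) ?_
    rw [hω', two_mul]
    exact SimpleFunc.norm_approxOn_zero_le hM.measurable_mk h0 ω k
  have hmeas : ∀ x k, AEStronglyMeasurable (fun ω => g (F k ω) x) μ := fun x k =>
    ((F k).map fun a => g a x).aestronglyMeasurable
  refine lim (F := fun k x => ∫ ω, g (F k ω) x ∂μ) (fun k => ?_) fun x => ?_
  · exact integral_simpleFunc (F k) g (fun ω => hg _ (hFS k ω)) fun x =>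
      (hbound x).mono' (hmeas x k) (hb x k)
  · refine tendsto_integral_of_dominated_convergence (bound x) (hmeas x) (hbound x) (hb x) ?_
    filter_upwards [hMS, hM.ae_eq_mk] with ω hω hω'
    refine ((hgc x).tendsto _).comp ?_
    have := SimpleFunc.tendsto_approxOn hM.measurable_mk h0 (x := ω)
      (subset_closure (by rw [← hω']; exact hω))
    rwa [← hω'] at this

end IsMixExponent

theorem integrableOn_one_sub_exp_neg_rpow {r t : ℝ} (hr : r < -1) (ht : 0 ≤ t) :
    IntegrableOn (fun u : ℝ => 1 - exp (-(u ^ r * t))) (Set.Ioi 0) := by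
  have hmeas : Measurable fun u : ℝ => 1 - exp (-(u ^ r * t)) := by fun_prop
  rw [← Set.Ioc_union_Ioi_eq_Ioi zero_le_one, integrableOn_union]
  constructor
  · refine (integrableOn_const (C := (1 : ℝ)) (by simp)).mono' hmeas.aestronglyMeasurable ?_
    filter_upwards [ae_restrict_mem measurableSet_Ioc] with u hu
    have h1 : 0 ≤ u ^ r * t := mul_nonneg (rpow_nonneg hu.1.le _) ht
    rw [norm_of_nonneg (sub_nonneg.2 (exp_le_one_iff.2 (neg_nonpos.2 h1)))]
    linarith [exp_pos (-(u ^ r * t))]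
  · refine ((integrableOn_Ioi_rpow_of_lt hr zero_lt_one).mul_const t).mono'
      hmeas.aestronglyMeasurable ?_
    filter_upwards [ae_restrict_mem measurableSet_Ioi] with u hu
    have h1 : 0 ≤ u ^ r * t := mul_nonneg (rpow_nonneg (zero_le_one.trans hu.le) _) ht
    rw [norm_of_nonneg (sub_nonneg.2 (exp_le_one_iff.2 (neg_nonpos.2 h1)))]
    linarith [add_one_le_exp (-(u ^ r * t))]

theorem integral_one_sub_exp_neg_rpow_pos {r : ℝ} (hr : r < -1) :
    0 < ∫ u in Set.Ioi (0 : ℝ), (1 - exp (-(u ^ r))) := by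
  have hint := integrableOn_one_sub_exp_neg_rpow hr zero_le_one
  simp only [mul_one] at hint
  have hpos : ∀ u ∈ Set.Ioi (0 : ℝ), 0 < 1 - exp (-(u ^ r)) := fun u hu =>
    sub_pos.2 (exp_lt_one_iff.2 (neg_neg_of_pos (rpow_pos_of_pos hu _)))
  rw [setIntegral_pos_iff_support_of_nonneg_ae _ hint]
  · refine lt_of_lt_of_le ?_ (measure_mono (s := Set.Ioi (0 : ℝ)) fun u hu =>
      ⟨(hpos u hu).ne', hu⟩)
    simp
  · filter_upwards [ae_restrict_mem measurableSet_Ioi] with u hu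
    exact (hpos u hu).le

theorem integral_one_sub_exp_neg_rpow_mul {α t : ℝ} (hα : 0 < α) (ht : 0 ≤ t) :
    ∫ u in Set.Ioi (0 : ℝ), (1 - exp (-(u ^ (-α⁻¹) * t)))
      = t ^ α * ∫ u in Set.Ioi (0 : ℝ), (1 - exp (-(u ^ (-α⁻¹)))) := by
  rcases ht.eq_or_lt with rfl | ht
  · simp [zero_rpow hα.ne']
  have h := integral_comp_mul_left_Ioi (fun u : ℝ => 1 - exp (-(u ^ (-α⁻¹)))) 0
    (rpow_pos_of_pos ht (-α))
  rw [mul_zero, rpow_neg ht.le, inv_inv, smul_eq_mul, ← rpow_neg ht.le] at h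
  rw [← h]
  refine setIntegral_congr_fun measurableSet_Ioi fun u hu => ?_
  have hu : 0 < u := hu
  rw [mul_rpow (rpow_nonneg ht.le _) hu.le, ← rpow_mul ht.le, neg_mul_neg, mul_inv_cancel₀ hα.ne',
    rpow_one, mul_comm t]

theorem IsMixExponent.quadratic_rpow {m : ℕ} {A : Matrix (Fin m) (Fin m) ℝ} (hA : A.PosSemidef)
    {α : ℝ} (hα : 0 < α) (hα1 : α ≤ 1) : IsMixExponent fun x => (x ⬝ᵥ A.mulVec x) ^ α := by
  rcases hα1.eq_or_lt with rfl | hα1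
  · simpa using IsMixExponent.quadratic hA
  have hq : ∀ x, 0 ≤ x ⬝ᵥ A.mulVec x := fun x => by simpa using hA.dotProduct_mulVec_nonneg x
  have hr : -α⁻¹ < -1 := neg_lt_neg ((one_lt_inv₀ hα).2 hα1)
  have key : IsMixExponent fun x =>
      ∫ u in Set.Ioi (0 : ℝ), (1 - exp (-(u ^ (-α⁻¹) * (x ⬝ᵥ A.mulVec x)))) := by
    refine IsMixExponent.integral (μ := volume.restrict (Set.Ioi (0 : ℝ)))
      (M := fun u : ℝ => u ^ (-α⁻¹)) (S := Set.Ici 0)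
      (g := fun s x => 1 - exp (-(s * (x ⬝ᵥ A.mulVec x))))
      (by fun_prop) (by simp) ?_ (fun s hs => ?_) (fun x => by fun_prop)
      (fun x u => 1 - exp (-(u ^ (-α⁻¹) * (2 * (x ⬝ᵥ A.mulVec x)))))
      (fun x => integrableOn_one_sub_exp_neg_rpow hr (mul_nonneg zero_le_two (hq x)))
      (fun x => ?_)
    · filter_upwards [ae_restrict_mem measurableSet_Ioi] with u hu
      exact rpow_nonneg (le_of_lt hu) _
    · simpa [Matrix.smul_mulVec] using IsMixExponent.one_sub_exp_quadratic
        (hA.smul (Set.mem_Ici.1 hs))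
    · filter_upwards [ae_restrict_mem measurableSet_Ioi] with u hu a ha hle
      rw [norm_of_nonneg ha, norm_of_nonneg (rpow_nonneg (le_of_lt hu) _)] at hle
      gcongr 1 - exp (-?_)
      nlinarith [hq x]
  simp_rw [integral_one_sub_exp_neg_rpow_mul hα (hq _)] at key
  have hc := integral_one_sub_exp_neg_rpow_pos hr
  refine (congrArg IsMixExponent (funext fun x => ?_)).mp (key.smul (inv_nonneg.2 hc.le))
  rw [mul_comm, mul_assoc, mul_inv_cancel₀ hc.ne', mul_one]

theorem sq_dotProduct_eq {m : ℕ} (v x : Fin m → ℝ) :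
    x ⬝ᵥ (Matrix.of fun i j => v i * v j).mulVec x = (∑ i, x i * v i) ^ 2 := by
  simp only [dotProduct, Matrix.mulVec, Matrix.of_apply, sq, Finset.sum_mul, Finset.mul_sum]
  refine Finset.sum_congr rfl fun i _ => Finset.sum_congr rfl fun j _ => by ring

theorem EmbedsIntoLp.isMixExponent {m : ℕ} {p : ℝ} (hp0 : 0 < p) (hp2 : p ≤ 2)
    {N : (Fin m → ℝ) → ℝ} (h : EmbedsIntoLp m p N) : IsMixExponent fun x => N x ^ p := by
  obtain ⟨Ω, _, μ, T, hint, hN⟩ := h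
  have hNp : ∀ x, N x ^ p = ∫ ω, |T x ω| ^ p ∂μ := fun x => by
    rw [← hN, ← rpow_mul (integral_nonneg fun ω => rpow_nonneg (abs_nonneg _) _),
      one_div_mul_cancel hp0.ne', rpow_one]
  set e : Fin m → Fin m → ℝ := fun i => Pi.single i 1
  have hT : ∀ x ω, T x ω = ∑ i, x i * T (e i) ω := fun x ω => by
    conv_lhs => rw [pi_eq_sum_univ' x]
    simp only [map_sum, map_smul, Finset.sum_apply, Pi.smul_apply, smul_eq_mul]
    refine Finset.sum_congr rfl fun i _ => ?_
    congr 3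
  have hsq : ∀ x, AEMeasurable (fun ω => T x ω ^ 2) μ := fun x => by
    have := (hint x).aestronglyMeasurable.aemeasurable.pow_const (2 / p)
    refine this.congr (ae_of_all _ fun ω => ?_)
    beta_reduce
    rw [← rpow_mul (abs_nonneg _), mul_div_cancel₀ _ hp0.ne', rpow_two, sq_abs]
  set M : Ω → Fin m → Fin m → ℝ := fun ω i j => T (e i) ω * T (e j) ω
  have hM : AEMeasurable M μ := by
    refine aemeasurable_pi_iff.2 fun i => aemeasurable_pi_iff.2 fun j => ?_
    have := ((hsq (e i + e j)).sub (hsq (e i - e j))).div_const 4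
    refine this.congr (ae_of_all _ fun ω => ?_)
    simp only [M, map_add, map_sub, Pi.add_apply, Pi.sub_apply]
    ring
  set q : (Fin m → Fin m → ℝ) → (Fin m → ℝ) → ℝ := fun a x => x ⬝ᵥ (Matrix.of a).mulVec x
  have hqM : ∀ x ω, q (M ω) x ^ (p / 2) = |T x ω| ^ p := fun x ω => by
    have e1 : q (M ω) x = T x ω ^ 2 := by
      rw [hT x ω]
      exact sq_dotProduct_eq _ _
    rw [e1, ← sq_abs, ← rpow_two, ← rpow_mul (abs_nonneg _), mul_div_cancel₀ _ two_ne_zero]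
  set R : Ω → ℝ := fun ω => ∑ i, |T (e i) ω| ^ p
  have hR0 : ∀ ω, 0 ≤ R ω := fun ω => Finset.sum_nonneg fun i _ => rpow_nonneg (abs_nonneg _) _
  have hMR : ∀ ω, ‖M ω‖ ^ (p / 2) ≤ R ω := fun ω => by
    have hTi : ∀ i, |T (e i) ω| ≤ R ω ^ p⁻¹ := fun i =>
      (le_rpow_inv_iff_of_pos (abs_nonneg _) (hR0 ω) hp0).2
        (Finset.single_le_sum (f := fun i => |T (e i) ω| ^ p)
          (fun j _ => rpow_nonneg (abs_nonneg _) _) (Finset.mem_univ i))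
    have h2 : ‖M ω‖ ≤ (R ω ^ p⁻¹) ^ 2 := by
      have h0 : 0 ≤ (R ω ^ p⁻¹) ^ 2 := sq_nonneg _
      refine (pi_norm_le_iff_of_nonneg h0).2 fun i => (pi_norm_le_iff_of_nonneg h0).2 fun j => ?_
      rw [norm_mul, sq]
      exact mul_le_mul (hTi i) (hTi j) (abs_nonneg _) (rpow_nonneg (hR0 ω) _)
    refine (rpow_le_rpow (norm_nonneg _) h2 (by positivity)).trans (le_of_eq ?_)
    rw [← rpow_two, ← rpow_mul (hR0 ω), ← rpow_mul (hR0 ω),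
      show p⁻¹ * 2 * (p / 2) = 1 by field_simp, rpow_one]
  have hq_le : ∀ a x, q a x ≤ ‖a‖ * (∑ i, |x i|) ^ 2 := fun a x => by
    simp only [q, dotProduct, Matrix.mulVec, Matrix.of_apply, sq, Finset.sum_mul, Finset.mul_sum]
    refine Finset.sum_le_sum fun i _ => Finset.sum_le_sum fun j _ => ?_
    have h1 : |a i j| ≤ ‖a‖ := (norm_le_pi_norm (a i) j).trans (norm_le_pi_norm a i)
    calc x i * (a i j * x j) ≤ |x i * (a i j * x j)| := le_abs_self _
      _ = |a i j| * (|x i| * |x j|) := by rw [abs_mul, abs_mul]; ring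
      _ ≤ ‖a‖ * (|x i| * |x j|) := by gcongr
      _ = _ := by ring
  have key := IsMixExponent.integral (m := m) hM
    (S := {a | (Matrix.of a).PosSemidef}) Matrix.PosSemidef.zero
    (ae_of_all _ fun ω => by
      refine Matrix.PosSemidef.of_dotProduct_mulVec_nonneg ?_ fun x => ?_
      · ext i j
        simp [M, mul_comm]
      · rw [star_trivial, sq_dotProduct_eq]
        positivity)
    (g := fun a x => q a x ^ (p / 2))
    (fun a ha => IsMixExponent.quadratic_rpow ha (by positivity) (by linarith))
    (fun x => by
      refine Continuous.rpow_const ?_ fun _ => Or.inr (by positivity)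
      exact continuous_const.dotProduct (continuous_id.matrix_mulVec continuous_const))
    (fun x ω => (2 * (∑ i, |x i|) ^ 2) ^ (p / 2) * R ω)
    (fun x => (integrable_finsetSum _ fun i _ => hint (e i)).const_mul _)
    (fun x => ae_of_all _ fun ω a ha hle => by
      have hq0 : 0 ≤ q a x := by
        simpa using Matrix.PosSemidef.dotProduct_mulVec_nonneg ha x
      calc q a x ^ (p / 2) ≤ ((2 * (∑ i, |x i|) ^ 2) * ‖M ω‖) ^ (p / 2) := by
            refine rpow_le_rpow hq0 ((hq_le a x).trans ?_) (by positivity)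
            nlinarith [sq_nonneg (∑ i, |x i|)]
        _ = (2 * (∑ i, |x i|) ^ 2) ^ (p / 2) * ‖M ω‖ ^ (p / 2) :=
            mul_rpow (by positivity) (norm_nonneg _)
        _ ≤ _ := by gcongr; exact hMR ω)
  simp_rw [hqM] at key
  simpa only [hNp] using key

/-- An inequality between integrals of products of Gaussians in the blocks of `(ℝ^m)^n` extends to
products of Gaussian mixtures. -/
theorem IsGaussMix.integral_prod_le {m n : ℕ} {ν ν' : Measure (Fin n × Fin m → ℝ)}
    [IsFiniteMeasure ν] [IsFiniteMeasure ν']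
    (hgauss : ∀ A : Fin n → Matrix (Fin m) (Fin m) ℝ, (∀ i, (A i).PosSemidef) →
      ∫ x, ∏ i, exp (-((fun j => x (i, j)) ⬝ᵥ (A i).mulVec fun j => x (i, j))) ∂ν ≤
        ∫ x, ∏ i, exp (-((fun j => x (i, j)) ⬝ᵥ (A i).mulVec fun j => x (i, j))) ∂ν')
    (f : Fin n → (Fin m → ℝ) → ℝ) (hf : ∀ i, IsGaussMix (f i)) :
    ∫ x, ∏ i, f i (fun j => x (i, j)) ∂ν ≤ ∫ x, ∏ i, f i (fun j => x (i, j)) ∂ν' := by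
  suffices H : ∀ s : Finset (Fin n), ∀ f : Fin n → (Fin m → ℝ) → ℝ, (∀ i, IsGaussMix (f i)) →
      (∀ i, i ∉ s → ∃ A : Matrix (Fin m) (Fin m) ℝ, A.PosSemidef ∧
        f i = fun x => exp (-(x ⬝ᵥ A.mulVec x))) →
      ∫ x, ∏ i, f i (fun j => x (i, j)) ∂ν ≤ ∫ x, ∏ i, f i (fun j => x (i, j)) ∂ν' from
    H Finset.univ f hf fun i hi => absurd (Finset.mem_univ i) hi
  clear f hf
  intro s
  induction s using Finset.induction_on with
  | empty =>
    intro f _ hs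
    choose A hA hfA using fun i => hs i (Finset.notMem_empty i)
    simpa only [hfA] using hgauss A hA
  | insert a s _ ih =>
    intro f hf hs
    set R : (Fin n × Fin m → ℝ) → ℝ := fun x => ∏ i ∈ Finset.univ.erase a, f i fun j => x (i, j)
    have hslot : ∀ i : Fin n, Measurable fun (x : Fin n × Fin m → ℝ) (j : Fin m) => x (i, j) :=
      fun i => measurable_pi_lambda _ fun j => measurable_pi_apply _
    have hRmeas : Measurable R :=
      Finset.measurable_prod _ fun i _ => (hf i).measurable.comp (hslot i)
    have hR0 : ∀ x, 0 ≤ R x := fun x => Finset.prod_nonneg fun i _ => (hf i).nonneg _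
    choose D hD using fun i => (hf i).exists_le
    have hRle : ∀ x, R x ≤ ∏ i ∈ Finset.univ.erase a, D i := fun x =>
      Finset.prod_le_prod (fun i _ => (hf i).nonneg _) fun i _ => hD i _
    set D' := ∏ i ∈ Finset.univ.erase a, D i
    have hmeas : ∀ g : (Fin m → ℝ) → ℝ, IsGaussMix g →
        Measurable fun x : Fin n × Fin m → ℝ => g (fun j => x (a, j)) * R x := fun g hg =>
      (hg.measurable.comp (hslot a)).mul hRmeas
    have hbd : ∀ (g : (Fin m → ℝ) → ℝ) (C : ℝ), IsGaussMix g → (∀ x, g x ≤ C) →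
        ∀ x : Fin n × Fin m → ℝ, ‖g (fun j => x (a, j)) * R x‖ ≤ C * D' := fun g C hg hC x => by
      rw [norm_of_nonneg (mul_nonneg (hg.nonneg _) (hR0 x))]
      exact mul_le_mul (hC _) (hRle x) (hR0 x) ((hg.nonneg _).trans (hC fun j => x (a, j)))
    have hint : ∀ (ρ : Measure (Fin n × Fin m → ℝ)) [IsFiniteMeasure ρ] (g : (Fin m → ℝ) → ℝ),
        IsGaussMix g → Integrable (fun x => g (fun j => x (a, j)) * R x) ρ := fun ρ _ g hg => by
      obtain ⟨C, hC⟩ := hg.exists_le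
      exact Integrable.of_bound (hmeas g hg).aestronglyMeasurable _ (ae_of_all _ (hbd g C hg hC))
    have hsplit : ∀ (g : (Fin m → ℝ) → ℝ) (x : Fin n × Fin m → ℝ),
        ∏ i, Function.update f a g i (fun j => x (i, j)) = g (fun j => x (a, j)) * R x := by
      intro g x
      rw [← Finset.mul_prod_erase _ _ (Finset.mem_univ a), Function.update_self]
      congr 1
      refine Finset.prod_congr rfl fun i hi => ?_
      rw [Function.update_of_ne (Finset.ne_of_mem_erase hi)]
    have key : ∀ g : (Fin m → ℝ) → ℝ, IsGaussMix g →
        ∫ x, g (fun j => x (a, j)) * R x ∂ν ≤ ∫ x, g (fun j => x (a, j)) * R x ∂ν' := by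
      intro g hg
      induction hg with
      | gauss A hA =>
        have := ih (Function.update f a fun x => exp (-(x ⬝ᵥ A.mulVec x)))
          (fun i => by
            by_cases h : i = a
            · subst h; simpa using IsGaussMix.gauss A hA
            · simpa [h] using hf i)
          (fun i hi => by
            by_cases h : i = a
            · subst h; exact ⟨A, hA, by simp⟩
            · simpa [h] using hs i (by simp [h, hi]))
        simpa only [hsplit] using this
      | add g h hg hh ihg ihh =>
        simp only [add_mul]
        rw [integral_add (hint ν g hg) (hint ν h hh), integral_add (hint ν' g hg) (hint ν' h hh)]
        exact add_le_add ihg ihh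
      | smul c hc g _ ihg =>
        simp only [mul_assoc, integral_const_mul]
        exact mul_le_mul_of_nonneg_left ihg hc
      | lim F g C hF hC hlim ihF =>
        have ht : ∀ (ρ : Measure (Fin n × Fin m → ℝ)) [IsFiniteMeasure ρ],
            Tendsto (fun k => ∫ x, F k (fun j => x (a, j)) * R x ∂ρ) atTop
              (nhds (∫ x, g (fun j => x (a, j)) * R x ∂ρ)) := fun ρ _ =>
          tendsto_integral_of_dominated_convergence (fun _ => C * D')
            (fun k => (hmeas _ (hF k)).aestronglyMeasurable) (integrable_const _)
            (fun k => ae_of_all _ (hbd _ C (hF k) (hC k)))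
            (ae_of_all _ fun x => (hlim _).mul_const _)
        exact le_of_tendsto_of_tendsto' (ht ν) (ht ν') ihF
    have := key (f a) (hf a)
    simp only [← hsplit, Function.update_eq_self] at this
    exact this

theorem measurePreserving_of_sum_sq_eq {κ κ' : Type*} [Fintype κ] [Fintype κ']
    (hcard : Fintype.card κ = Fintype.card κ') (L : (κ → ℝ) →ₗ[ℝ] (κ' → ℝ))
    (hL : ∀ x, ∑ c, L x c ^ 2 = ∑ i, x i ^ 2) : MeasurePreserving L := by
  let f : EuclideanSpace ℝ κ →ₗᵢ[ℝ] EuclideanSpace ℝ κ' :=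
    { toLinearMap := (WithLp.linearEquiv 2 ℝ (κ' → ℝ)).symm.toLinearMap ∘ₗ L ∘ₗ
        (WithLp.linearEquiv 2 ℝ (κ → ℝ)).toLinearMap
      norm_map' := fun x => by
        simp [EuclideanSpace.norm_eq, hL] }
  have h := (f.toLinearIsometryEquiv (by simpa using hcard)).measurePreserving
  exact (PiLp.volume_preserving_ofLp κ').comp (h.comp (PiLp.volume_preserving_toLp κ))

theorem det_mul_lintegral_comp_mulVec {m : ℕ} {L : Matrix (Fin m) (Fin m) ℝ} (hL : L.det ≠ 0)
    {G : (Fin m → ℝ) → ℝ≥0∞} (hG : Measurable G) :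
    ENNReal.ofReal |L.det| * ∫⁻ y, G (L.mulVec y) = ∫⁻ y, G y := by
  have h := Real.map_matrix_volume_pi_eq_smul_volume_pi hL
  have h2 : ∫⁻ y, G (L.mulVec y) = ENNReal.ofReal |L.det⁻¹| * ∫⁻ y, G y := by
    have hm : Measurable (Matrix.toLin' L) :=
      (LinearMap.continuous_of_finiteDimensional _).measurable
    rw [← smul_eq_mul, ← lintegral_smul_measure, ← h, lintegral_map hG hm]
    rfl
  rw [h2, ← mul_assoc, ← ENNReal.ofReal_mul (abs_nonneg _), ← abs_mul, mul_inv_cancel₀ hL, abs_one,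
    ENNReal.ofReal_one, one_mul]

/-- The Gaussian integral `∫ exp (-⟨S y, y⟩) dy`. -/
def gaussLintegral {m : ℕ} (S : Matrix (Fin m) (Fin m) ℝ) : ℝ≥0∞ :=
  ∫⁻ y : Fin m → ℝ, ENNReal.ofReal (exp (-(y ⬝ᵥ S.mulVec y)))

theorem measurable_ofReal_exp_neg_quadratic {m : ℕ} (S : Matrix (Fin m) (Fin m) ℝ) :
    Measurable fun y : Fin m → ℝ => ENNReal.ofReal (exp (-(y ⬝ᵥ S.mulVec y))) := by
  refine (Continuous.measurable ?_).ennreal_ofReal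
  exact continuous_exp.comp
    (continuous_id.dotProduct (continuous_const.matrix_mulVec continuous_id)).neg

open scoped MatrixOrder Matrix.Norms.L2Operator in
theorem Matrix.PosSemidef.exists_eq_transpose_mul_self {m : ℕ} {S : Matrix (Fin m) (Fin m) ℝ}
    (hS : S.PosSemidef) : ∃ L : Matrix (Fin m) (Fin m) ℝ, S = L.transpose * L := by
  obtain ⟨L, rfl⟩ := CStarAlgebra.nonneg_iff_eq_star_mul_self.mp hS.nonneg
  exact ⟨L, by rw [Matrix.star_eq_conjTranspose, Matrix.conjTranspose_eq_transpose_of_trivial]⟩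

theorem det_mul_gaussLintegral_sq {m : ℕ} {S : Matrix (Fin m) (Fin m) ℝ} (hS : S.PosDef) :
    ENNReal.ofReal S.det * gaussLintegral S ^ 2 =
      gaussLintegral (1 : Matrix (Fin m) (Fin m) ℝ) ^ 2 := by
  obtain ⟨L, rfl⟩ := hS.posSemidef.exists_eq_transpose_mul_self
  have hdet : (L.transpose * L).det = |L.det| ^ 2 := by
    rw [Matrix.det_mul, Matrix.det_transpose, sq_abs, sq]
  have hL : L.det ≠ 0 := fun h => by
    have := hS.det_pos
    simp [hdet, h] at this
  have h := det_mul_lintegral_comp_mulVec hL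
    (measurable_ofReal_exp_neg_quadratic (1 : Matrix (Fin m) (Fin m) ℝ))
  rw [hdet, ENNReal.ofReal_pow (abs_nonneg _), ← mul_pow]
  congr 1
  refine Eq.trans ?_ h
  congr 1
  refine lintegral_congr fun y => ?_
  rw [Matrix.one_mulVec, ← Matrix.mulVec_mulVec, Matrix.dotProduct_mulVec,
    Matrix.vecMul_transpose]

theorem integrable_exp_neg_mul_sum_sq (κ : Type*) [Fintype κ] {b : ℝ} (hb : 0 < b) :
    Integrable fun y : κ → ℝ => exp (-(b * ∑ i, y i ^ 2)) := by
  have := Integrable.fintype_prod (μ := fun _ : κ => (volume : Measure ℝ))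
    (f := fun _ x => exp (-b * x ^ 2)) fun _ => integrable_exp_neg_mul_sq hb
  refine this.congr (ae_of_all _ fun y => ?_)
  simp only [← exp_sum, Finset.mul_sum, ← Finset.sum_neg_distrib, neg_mul]

theorem gaussLintegral_one_ne_top {m : ℕ} : gaussLintegral (1 : Matrix (Fin m) (Fin m) ℝ) ≠ ⊤ := by
  have := (integrable_exp_neg_mul_sum_sq (Fin m) zero_lt_one).lintegral_lt_top
  refine ne_of_lt (lt_of_eq_of_lt ?_ this)
  simp [gaussLintegral, dotProduct, sq]

theorem gaussLintegral_ne_zero {m : ℕ} (S : Matrix (Fin m) (Fin m) ℝ) : gaussLintegral S ≠ 0 := by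
  rw [gaussLintegral, Ne, lintegral_eq_zero_iff (measurable_ofReal_exp_neg_quadratic S)]
  intro h
  obtain ⟨y, hy⟩ := h.exists
  exact absurd hy (by simp [exp_pos])

theorem posDef_sum_sq_smul {m n : ℕ} {R : Fin n → Matrix (Fin m) (Fin m) ℝ}
    (hR : ∀ i, (R i).PosDef) {θ : Fin n → ℝ} (hθ : ∑ i, θ i ^ 2 = 1) :
    (∑ i, θ i ^ 2 • R i).PosDef := by
  refine Matrix.PosDef.of_dotProduct_mulVec_pos ?_ fun x hx => ?_
  · exact (Matrix.posSemidef_sum _ fun i _ =>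
      (hR i).posSemidef.smul (sq_nonneg (θ i))).isHermitian
  · have hpos : ∀ i, 0 < star x ⬝ᵥ (R i).mulVec x := fun i => (hR i).dotProduct_mulVec_pos hx
    obtain ⟨i, hi⟩ : ∃ i, θ i ≠ 0 := by
      by_contra! h
      simp [h] at hθ
    rw [Matrix.sum_mulVec, dotProduct_sum]
    simp only [Matrix.smul_mulVec, dotProduct_smul, smul_eq_mul]
    exact Finset.sum_pos' (fun j _ => mul_nonneg (sq_nonneg _) (hpos j).le)
      ⟨i, Finset.mem_univ i, mul_pos (by positivity) (hpos i)⟩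

/-- The Gaussian density on `(ℝ^m)^n` given by a quadratic form in each block. -/
def blockGauss {m n : ℕ} (B : Fin n → Matrix (Fin m) (Fin m) ℝ) (x : Fin n × Fin m → ℝ) : ℝ :=
  ∏ i, exp (-((fun j => x (i, j)) ⬝ᵥ (B i).mulVec fun j => x (i, j)))

theorem continuous_blockGauss {m n : ℕ} (B : Fin n → Matrix (Fin m) (Fin m) ℝ) :
    Continuous (blockGauss B) := by
  refine continuous_finsetProd _ fun i _ => continuous_exp.comp (Continuous.neg ?_)
  have h : Continuous fun (x : Fin n × Fin m → ℝ) (j : Fin m) => x (i, j) := by fun_prop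
  exact h.dotProduct (continuous_const.matrix_mulVec h)

theorem IsEuclParam.measurePreserving_add {m n : ℕ} {θ : Fin n → ℝ} (hθ : ∑ i, θ i ^ 2 = 1)
    {ι : (Fin (m * (n - 1)) → ℝ) →ₗ[ℝ] (Fin n × Fin m → ℝ)}
    (hι : IsEuclParam m n (m * (n - 1)) ι (blockHyp m n θ)) :
    MeasurePreserving fun (z : (Fin (m * (n - 1)) → ℝ) × (Fin m → ℝ)) (c : Fin n × Fin m) =>
      ι z.1 c + θ c.1 * z.2 c.2 := by
  rcases n with _ | n
  · simp at hθ
  let L : (Fin (m * (n + 1 - 1)) ⊕ Fin m → ℝ) →ₗ[ℝ] (Fin (n + 1) × Fin m → ℝ) :=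
    { toFun := fun z c => ι (fun k => z (Sum.inl k)) c + θ c.1 * z (Sum.inr c.2)
      map_add' := fun z w => by
        ext c
        have := congrFun (ι.map_add (fun k => z (Sum.inl k)) fun k => w (Sum.inl k)) c
        simp only [Pi.add_apply] at this ⊢
        rw [show (fun k => z (Sum.inl k) + w (Sum.inl k))
          = (fun k => z (Sum.inl k)) + fun k => w (Sum.inl k) from rfl, this]
        ring
      map_smul' := fun a z => by
        ext c
        have := congrFun (ι.map_smul a fun k => z (Sum.inl k)) c
        simp only [Pi.smul_apply, smul_eq_mul, RingHom.id_apply] at this ⊢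
        rw [show (fun k => a * z (Sum.inl k)) = a • (fun k => z (Sum.inl k)) from rfl, this]
        ring }
  have hL := measurePreserving_of_sum_sq_eq (L := L) (by simp [add_comm]; ring) fun z => by
    have horth : ∀ j, ∑ i, θ i * ι (fun k => z (Sum.inl k)) (i, j) = 0 := by
      have : ι (fun k => z (Sum.inl k)) ∈ blockHyp m (n + 1) θ := hι.2 ▸ Set.mem_range_self _
      exact this
    have e : ∀ c, L z c ^ 2 = ι (fun k => z (Sum.inl k)) c ^ 2
        + (2 * z (Sum.inr c.2) * (θ c.1 * ι (fun k => z (Sum.inl k)) c)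
          + θ c.1 ^ 2 * z (Sum.inr c.2) ^ 2) := fun c => by
      simp only [L, LinearMap.coe_mk, AddHom.coe_mk]
      ring
    simp_rw [e]
    rw [Finset.sum_add_distrib, hι.1, Fintype.sum_sum_type]
    congr 1
    rw [Fintype.sum_prod_type_right]
    refine Finset.sum_congr rfl fun j _ => ?_
    dsimp only
    rw [Finset.sum_add_distrib, ← Finset.mul_sum, horth, ← Finset.sum_mul, hθ]
    ring
  exact hL.comp (volume_measurePreserving_sumPiEquivProdPi_symm fun _ => ℝ)

theorem blockGauss_pos {m n : ℕ} (B : Fin n → Matrix (Fin m) (Fin m) ℝ) (x : Fin n × Fin m → ℝ) :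
    0 < blockGauss B x :=
  Finset.prod_pos fun _ _ => exp_pos _

/-- Completing the square along the directions conjugate to a block hyperplane. -/
theorem blockGauss_add_conjugate {m n : ℕ} {B : Fin n → Matrix (Fin m) (Fin m) ℝ}
    (hB : ∀ i, (B i).PosDef) {θ : Fin n → ℝ} {x : Fin n × Fin m → ℝ} (hx : x ∈ blockHyp m n θ)
    (z : Fin m → ℝ) :
    blockGauss B (fun c => x c + θ c.1 * ((B c.1)⁻¹.mulVec z) c.2) =
      blockGauss B x * exp (-(z ⬝ᵥ (∑ i, θ i ^ 2 • (B i)⁻¹).mulVec z)) := by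
  have hBR : ∀ i, (B i).mulVec ((B i)⁻¹.mulVec z) = z := fun i => by
    rw [Matrix.mulVec_mulVec, Matrix.mul_nonsing_inv _ (hB i).det_pos.ne'.isUnit,
      Matrix.one_mulVec]
  have hsymm : ∀ i (u v : Fin m → ℝ), u ⬝ᵥ (B i).mulVec v = v ⬝ᵥ (B i).mulVec u := fun i u v => by
    have ht : (B i).transpose = B i := by
      rw [← Matrix.conjTranspose_eq_transpose_of_trivial]
      exact (hB i).isHermitian
    conv_lhs => rw [Matrix.dotProduct_mulVec, ← Matrix.mulVec_transpose, ht, dotProduct_comm]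
  have hcross : ∑ i, θ i * ((fun j => x (i, j)) ⬝ᵥ z) = 0 := by
    simp only [dotProduct, Finset.mul_sum]
    rw [Finset.sum_comm]
    refine Finset.sum_eq_zero fun j _ => ?_
    have := hx j
    simp only [← mul_assoc, ← Finset.sum_mul, this, zero_mul]
  have hblock : ∀ i, (fun j => x (i, j) + θ i * ((B i)⁻¹.mulVec z) j) ⬝ᵥ
      (B i).mulVec (fun j => x (i, j) + θ i * ((B i)⁻¹.mulVec z) j) =
      (fun j => x (i, j)) ⬝ᵥ (B i).mulVec (fun j => x (i, j)) +
        (2 * (θ i * ((fun j => x (i, j)) ⬝ᵥ z)) + θ i ^ 2 * (z ⬝ᵥ (B i)⁻¹.mulVec z)) := fun i => by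
    rw [show (fun j => x (i, j) + θ i * ((B i)⁻¹.mulVec z) j)
      = (fun j => x (i, j)) + θ i • (B i)⁻¹.mulVec z from rfl]
    rw [Matrix.mulVec_add, Matrix.mulVec_smul, add_dotProduct, dotProduct_add, dotProduct_add,
      smul_dotProduct, smul_dotProduct, hsymm i ((B i)⁻¹.mulVec z) fun j => x (i, j)]
    simp only [dotProduct_smul, hBR, smul_eq_mul]
    rw [dotProduct_comm ((B i)⁻¹.mulVec z) z]
    ring
  simp only [blockGauss, ← exp_sum, ← exp_add, hblock]
  congr 1
  rw [Matrix.sum_mulVec, dotProduct_sum]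
  simp only [Matrix.smul_mulVec, dotProduct_smul, smul_eq_mul, Finset.sum_neg_distrib,
    Finset.sum_add_distrib, ← Finset.mul_sum, hcross]
  ring

/-- The integral of a block Gaussian over a block hyperplane, as a Gaussian integral depending on
the squares of the coefficients. -/
theorem IsEuclParam.lintegral_blockGauss {m n : ℕ} {B : Fin n → Matrix (Fin m) (Fin m) ℝ}
    (hB : ∀ i, (B i).PosDef) {θ : Fin n → ℝ} (hθ : ∑ i, θ i ^ 2 = 1)
    {ι : (Fin (m * (n - 1)) → ℝ) →ₗ[ℝ] (Fin n × Fin m → ℝ)}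
    (hι : IsEuclParam m n (m * (n - 1)) ι (blockHyp m n θ)) :
    gaussLintegral (1 : Matrix (Fin m) (Fin m) ℝ) ^ 2 *
        ∫⁻ h, ENNReal.ofReal (blockGauss B (ι h)) =
      (∫⁻ x, ENNReal.ofReal (blockGauss B x)) * gaussLintegral (∑ i, θ i ^ 2 • (B i)⁻¹) := by
  set S := ∑ i, θ i ^ 2 • (B i)⁻¹ with hSdef
  have hS : S.PosDef := posDef_sum_sq_smul (fun i => (hB i).inv) hθ
  have hG : Measurable fun x => ENNReal.ofReal (blockGauss B x) :=
    (continuous_blockGauss B).measurable.ennreal_ofReal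
  have hΦ := hι.measurePreserving_add hθ
  have hslice : ∀ z : Fin m → ℝ,
      ∫⁻ h, ENNReal.ofReal (blockGauss B fun c => ι h c + θ c.1 * (S.mulVec z) c.2) =
        (∫⁻ h, ENNReal.ofReal (blockGauss B (ι h))) *
          ENNReal.ofReal (exp (-(z ⬝ᵥ S.mulVec z))) := by
    intro z
    obtain ⟨k, hk⟩ : (fun c : Fin n × Fin m => θ c.1 * (S.mulVec z) c.2
        - θ c.1 * ((B c.1)⁻¹.mulVec z) c.2) ∈ Set.range ι := by
      rw [hι.2]
      intro j
      have e : (S.mulVec z) j = ∑ i, θ i ^ 2 * ((B i)⁻¹.mulVec z) j := by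
        rw [hSdef, Matrix.sum_mulVec, Finset.sum_apply]
        simp [Matrix.smul_mulVec]
      have e2 : ∀ i, θ i * (θ i * (S.mulVec z) j - θ i * ((B i)⁻¹.mulVec z) j)
          = θ i ^ 2 * (S.mulVec z) j - θ i ^ 2 * ((B i)⁻¹.mulVec z) j := fun i => by ring
      simp only [e2, Finset.sum_sub_distrib, ← Finset.sum_mul, hθ, ← e]
      ring
    have hmeas : Measurable fun h => ENNReal.ofReal (blockGauss B (ι h)) :=
      hG.comp (LinearMap.continuous_of_finiteDimensional ι).measurable
    rw [← lintegral_mul_const _ hmeas, ← lintegral_add_right_eq_self (μ := volume)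
      (fun h => ENNReal.ofReal (blockGauss B (ι h)) * _) k]
    refine lintegral_congr fun h => ?_
    rw [← ENNReal.ofReal_mul (blockGauss_pos B _).le,
      ← blockGauss_add_conjugate hB (hι.2 ▸ Set.mem_range_self _) z]
    congr 2
    ext c
    rw [map_add, hk, Pi.add_apply]
    ring
  have hcomp := hΦ.lintegral_comp hG
  have hK : Measurable fun y : Fin m → ℝ =>
      ∫⁻ h, ENNReal.ofReal (blockGauss B fun c => ι h c + θ c.1 * y c.2) :=
    (hG.comp hΦ.measurable).lintegral_prod_left'
  have hfubini := lintegral_prod_symm' (μ := volume) (ν := volume) _ (hG.comp hΦ.measurable)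
  simp only [Function.comp_def] at hfubini
  rw [← hcomp, Measure.volume_eq_prod, hfubini, ← det_mul_lintegral_comp_mulVec hS.det_pos.ne' hK]
  simp only [hslice]
  rw [lintegral_const_mul _ (measurable_ofReal_exp_neg_quadratic S), ← det_mul_gaussLintegral_sq hS,
    abs_of_pos hS.det_pos, gaussLintegral]
  ring

/-- Permutation of the blocks of `(ℝ^m)^n`. -/
def blockPerm (m : ℕ) {n : ℕ} (σ : Equiv.Perm (Fin n)) :
    (Fin n × Fin m → ℝ) →ₗ[ℝ] (Fin n × Fin m → ℝ) :=
  LinearMap.funLeft ℝ ℝ fun c => (σ c.1, c.2)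

theorem measurable_blockPerm (m : ℕ) {n : ℕ} (σ : Equiv.Perm (Fin n)) :
    Measurable (blockPerm m σ) :=
  (LinearMap.continuous_of_finiteDimensional _).measurable

theorem measurePreserving_blockPerm (m : ℕ) {n : ℕ} (σ : Equiv.Perm (Fin n)) :
    MeasurePreserving (blockPerm m σ) := by
  refine measurePreserving_of_sum_sq_eq rfl _ fun x => ?_
  rw [Fintype.sum_prod_type, Fintype.sum_prod_type]
  exact Equiv.sum_comp σ fun i => ∑ j, x (i, j) ^ 2

theorem blockGauss_blockPerm {m n : ℕ} (B : Fin n → Matrix (Fin m) (Fin m) ℝ)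
    (σ : Equiv.Perm (Fin n)) (x : Fin n × Fin m → ℝ) :
    blockGauss B (blockPerm m σ x) = blockGauss (fun i => B (σ.symm i)) x := by
  rw [blockGauss, blockGauss]
  conv_rhs => rw [← Equiv.prod_comp σ]
  simp [blockPerm, LinearMap.funLeft_apply]

theorem gaussLintegral_sum_smul_le {m n : ℕ} (R : Fin n → Matrix (Fin m) (Fin m) ℝ)
    {α β : Fin n → ℝ} {w : Equiv.Perm (Fin n) → ℝ} (hw0 : ∀ σ, 0 ≤ w σ) (hw1 : ∑ σ, w σ = 1)
    (hw : ∀ i, α i = ∑ σ, w σ * β (σ i)) :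
    gaussLintegral (∑ i, α i • R i) ≤
      ∑ σ : Equiv.Perm (Fin n), ENNReal.ofReal (w σ) * gaussLintegral (∑ i, β (σ i) • R i) := by
  have hmeas := fun σ : Equiv.Perm (Fin n) =>
    measurable_ofReal_exp_neg_quadratic (∑ i, β (σ i) • R i)
  simp only [gaussLintegral]
  rw [← Finset.sum_congr rfl fun σ _ => lintegral_const_mul (ENNReal.ofReal (w σ)) (hmeas σ),
    ← lintegral_finsetSum _ fun σ _ => (hmeas σ).const_mul _]
  refine lintegral_mono fun y => ?_
  simp only [fun σ (t : ℝ) => (ENNReal.ofReal_mul (q := t) (hw0 σ)).symm]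
  rw [← ENNReal.ofReal_sum_of_nonneg fun σ _ => mul_nonneg (hw0 σ) (exp_pos _).le]
  refine ENNReal.ofReal_le_ofReal ?_
  have hconv := convexOn_exp.map_sum_le (t := Finset.univ) (w := w)
    (p := fun σ : Equiv.Perm (Fin n) => -(y ⬝ᵥ (∑ i, β (σ i) • R i).mulVec y))
    (fun σ _ => hw0 σ) hw1 fun _ _ => Set.mem_univ _
  refine le_trans (le_of_eq ?_) hconv
  congr 1
  simp only [Matrix.sum_mulVec, dotProduct_sum, Matrix.smul_mulVec, dotProduct_smul, smul_eq_mul,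
    hw, Finset.sum_mul, mul_neg, Finset.mul_sum, Finset.sum_neg_distrib]
  rw [Finset.sum_comm]
  simp only [mul_assoc]

theorem lintegral_blockGauss_le {m n : ℕ} {B : Fin n → Matrix (Fin m) (Fin m) ℝ}
    (hB : ∀ i, (B i).PosDef) {θ φ : Fin n → ℝ} (hθ : ∑ i, θ i ^ 2 = 1) (hφ : ∑ i, φ i ^ 2 = 1)
    {w : Equiv.Perm (Fin n) → ℝ} (hw0 : ∀ σ, 0 ≤ w σ) (hw1 : ∑ σ, w σ = 1)
    (hw : ∀ i, θ i ^ 2 = ∑ σ, w σ * φ (σ i) ^ 2)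
    {ιθ ιφ : (Fin (m * (n - 1)) → ℝ) →ₗ[ℝ] (Fin n × Fin m → ℝ)}
    (hιθ : IsEuclParam m n (m * (n - 1)) ιθ (blockHyp m n θ))
    (hιφ : IsEuclParam m n (m * (n - 1)) ιφ (blockHyp m n φ)) :
    ∫⁻ h, ENNReal.ofReal (blockGauss B (ιθ h)) ≤
      ∑ σ : Equiv.Perm (Fin n), ENNReal.ofReal (w σ) *
        ∫⁻ h, ENNReal.ofReal (blockGauss B (blockPerm m σ (ιφ h))) := by
  have hc0 : gaussLintegral (1 : Matrix (Fin m) (Fin m) ℝ) ^ 2 ≠ 0 :=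
    pow_ne_zero _ (gaussLintegral_ne_zero _)
  have hct : gaussLintegral (1 : Matrix (Fin m) (Fin m) ℝ) ^ 2 ≠ ⊤ :=
    ENNReal.pow_ne_top gaussLintegral_one_ne_top
  have hσ : ∀ σ : Equiv.Perm (Fin n), gaussLintegral (1 : Matrix (Fin m) (Fin m) ℝ) ^ 2 *
      ∫⁻ h, ENNReal.ofReal (blockGauss B (blockPerm m σ (ιφ h))) =
      (∫⁻ x, ENNReal.ofReal (blockGauss B x)) * gaussLintegral (∑ i, φ (σ i) ^ 2 • (B i)⁻¹) := by
    intro σ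
    simp only [blockGauss_blockPerm]
    rw [hιφ.lintegral_blockGauss (fun i => hB _) hφ]
    congr 1
    · simp only [← blockGauss_blockPerm]
      exact (measurePreserving_blockPerm m σ).lintegral_comp
        (continuous_blockGauss B).measurable.ennreal_ofReal
    · refine congrArg gaussLintegral
        ((Equiv.sum_comp σ fun i => φ i ^ 2 • (B (σ.symm i))⁻¹).symm.trans ?_)
      simp only [Equiv.symm_apply_apply]
  rw [← ENNReal.mul_le_mul_iff_right hc0 hct, hιθ.lintegral_blockGauss hB hθ, Finset.mul_sum]
  refine (mul_le_mul_right
    (gaussLintegral_sum_smul_le (β := fun i => φ i ^ 2) (fun i => (B i)⁻¹) hw0 hw1 hw) _).trans (le_of_eq ?_)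
  rw [Finset.mul_sum]
  refine Finset.sum_congr rfl fun σ _ => ?_
  rw [mul_left_comm, ← hσ σ, mul_left_comm]

/-- Gaussian measure (not normalised) on a finite-dimensional space. -/
def gaussWeight (d : ℕ) (ε : ℝ) : Measure (Fin d → ℝ) :=
  volume.withDensity fun h => ENNReal.ofReal (exp (-(ε * ∑ i, h i ^ 2)))

theorem measurable_gaussWeight_density (d : ℕ) (ε : ℝ) :
    Measurable fun h : Fin d → ℝ => ENNReal.ofReal (exp (-(ε * ∑ i, h i ^ 2))) := by
  fun_prop

theorem isFiniteMeasure_gaussWeight (d : ℕ) {ε : ℝ} (hε : 0 < ε) :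
    IsFiniteMeasure (gaussWeight d ε) :=
  isFiniteMeasure_withDensity_ofReal (integrable_exp_neg_mul_sum_sq (Fin d) hε).2

theorem lintegral_gaussWeight (d : ℕ) (ε : ℝ) {g : (Fin d → ℝ) → ℝ≥0∞} (hg : Measurable g) :
    ∫⁻ h, g h ∂gaussWeight d ε =
      ∫⁻ h, ENNReal.ofReal (exp (-(ε * ∑ i, h i ^ 2))) * g h :=
  lintegral_withDensity_eq_lintegral_mul _ (measurable_gaussWeight_density d ε) hg

theorem sum_sq_blockPerm {m n : ℕ} (σ : Equiv.Perm (Fin n)) (x : Fin n × Fin m → ℝ) :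
    ∑ c, blockPerm m σ x c ^ 2 = ∑ c, x c ^ 2 := by
  rw [Fintype.sum_prod_type, Fintype.sum_prod_type]
  exact Equiv.sum_comp σ fun i => ∑ j, x (i, j) ^ 2

theorem exp_mul_blockGauss {m n : ℕ} (A : Fin n → Matrix (Fin m) (Fin m) ℝ) (ε : ℝ)
    (x : Fin n × Fin m → ℝ) :
    exp (-(ε * ∑ c, x c ^ 2)) * blockGauss A x = blockGauss (fun i => A i + ε • 1) x := by
  simp only [blockGauss, ← exp_sum, ← exp_add, Fintype.sum_prod_type, Matrix.add_mulVec,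
    Matrix.smul_mulVec, Matrix.one_mulVec, Pi.add_apply, Pi.smul_apply, smul_eq_mul, mul_add,
    Finset.sum_neg_distrib, Finset.sum_add_distrib, Finset.mul_sum, dotProduct]
  simp only [sq, mul_left_comm ε]
  rw [neg_add_rev]

theorem lintegral_exp_mul_prod_le {m n : ℕ} {f : Fin n → (Fin m → ℝ) → ℝ}
    (hf : ∀ i, IsGaussMix (f i)) {ε : ℝ} (hε : 0 < ε)
    {θ φ : Fin n → ℝ} (hθ : ∑ i, θ i ^ 2 = 1) (hφ : ∑ i, φ i ^ 2 = 1)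
    {w : Equiv.Perm (Fin n) → ℝ} (hw0 : ∀ σ, 0 ≤ w σ) (hw1 : ∑ σ, w σ = 1)
    (hw : ∀ i, θ i ^ 2 = ∑ σ, w σ * φ (σ i) ^ 2)
    {ιθ ιφ : (Fin (m * (n - 1)) → ℝ) →ₗ[ℝ] (Fin n × Fin m → ℝ)}
    (hιθ : IsEuclParam m n (m * (n - 1)) ιθ (blockHyp m n θ))
    (hιφ : IsEuclParam m n (m * (n - 1)) ιφ (blockHyp m n φ)) :
    ∫⁻ h, ENNReal.ofReal (exp (-(ε * ∑ i, h i ^ 2))) *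
        ENNReal.ofReal (∏ i, f i fun j => ιθ h (i, j)) ≤
      ∑ σ : Equiv.Perm (Fin n), ENNReal.ofReal (w σ) *
        ∫⁻ h, ENNReal.ofReal (exp (-(ε * ∑ i, h i ^ 2))) *
          ENNReal.ofReal (∏ i, f i fun j => blockPerm m σ (ιφ h) (i, j)) := by
  have hγ := isFiniteMeasure_gaussWeight (m * (n - 1)) hε
  have hmθ : Measurable ιθ := (LinearMap.continuous_of_finiteDimensional _).measurable
  have hmφ : Measurable ιφ := (LinearMap.continuous_of_finiteDimensional _).measurable
  have hmσ : ∀ σ, Measurable fun h => blockPerm m σ (ιφ h) := fun σ =>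
    (measurable_blockPerm m σ).comp hmφ
  let ν := (gaussWeight _ ε).map ιθ
  let ν' := ∑ σ : Equiv.Perm (Fin n),
    (w σ).toNNReal • (gaussWeight _ ε).map fun h => blockPerm m σ (ιφ h)
  have hν : ∀ g : (Fin n × Fin m → ℝ) → ℝ, Measurable g → ∫⁻ x, ENNReal.ofReal (g x) ∂ν =
      ∫⁻ h, ENNReal.ofReal (exp (-(ε * ∑ i, h i ^ 2))) * ENNReal.ofReal (g (ιθ h)) := by
    intro g hg
    rw [lintegral_map hg.ennreal_ofReal hmθ]
    exact lintegral_gaussWeight _ ε (hg.ennreal_ofReal.comp hmθ)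
  have hν' : ∀ g : (Fin n × Fin m → ℝ) → ℝ, Measurable g → ∫⁻ x, ENNReal.ofReal (g x) ∂ν' =
      ∑ σ : Equiv.Perm (Fin n), ENNReal.ofReal (w σ) *
        ∫⁻ h, ENNReal.ofReal (exp (-(ε * ∑ i, h i ^ 2))) *
          ENNReal.ofReal (g (blockPerm m σ (ιφ h))) := by
    intro g hg
    rw [lintegral_finsetSum_measure]
    refine Finset.sum_congr rfl fun σ _ => ?_
    rw [lintegral_smul_measure, lintegral_map hg.ennreal_ofReal (hmσ σ)]
    exact congrArg (ENNReal.ofReal (w σ) * ·)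
      (lintegral_gaussWeight _ ε (hg.ennreal_ofReal.comp (hmσ σ)))
  have key : ∀ {g : (Fin n × Fin m → ℝ) → ℝ} {C : ℝ}, Measurable g → (∀ x, 0 ≤ g x) →
      (∀ x, g x ≤ C) → (∫ x, g x ∂ν ≤ ∫ x, g x ∂ν' ↔
        ∫⁻ x, ENNReal.ofReal (g x) ∂ν ≤ ∫⁻ x, ENNReal.ofReal (g x) ∂ν') := by
    intro g C hg hg0 hgC
    have hint : ∀ (μ : Measure (Fin n × Fin m → ℝ)) [IsFiniteMeasure μ], Integrable g μ :=
      fun μ _ => Integrable.of_bound hg.aestronglyMeasurable C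
        (ae_of_all _ fun x => by rw [norm_of_nonneg (hg0 x)]; exact hgC x)
    rw [← ofReal_integral_eq_lintegral_ofReal (hint ν) (ae_of_all _ hg0),
      ← ofReal_integral_eq_lintegral_ofReal (hint ν') (ae_of_all _ hg0),
      ENNReal.ofReal_le_ofReal_iff (integral_nonneg hg0)]
  have hgauss : ∀ A : Fin n → Matrix (Fin m) (Fin m) ℝ, (∀ i, (A i).PosSemidef) →
      ∫ x, blockGauss A x ∂ν ≤ ∫ x, blockGauss A x ∂ν' := by
    intro A hA
    have hm := (continuous_blockGauss A).measurable
    rw [key hm (fun x => (blockGauss_pos A x).le) (C := 1), hν _ hm, hν' _ hm]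
    · have hB : ∀ i, (A i + ε • (1 : Matrix (Fin m) (Fin m) ℝ)).PosDef := fun i =>
        Matrix.PosDef.posSemidef_add (hA i) (Matrix.PosDef.one.smul hε)
      have h := lintegral_blockGauss_le hB hθ hφ hw0 hw1 hw hιθ hιφ
      simp only [← exp_mul_blockGauss, sum_sq_blockPerm, hιθ.1, hιφ.1,
        ENNReal.ofReal_mul (exp_pos _).le] at h
      exact h
    · refine fun x => Finset.prod_le_one (fun i _ => (exp_pos _).le) fun i _ => ?_
      have := (hA i).dotProduct_mulVec_nonneg fun j => x (i, j)
      exact exp_le_one_iff.2 (neg_nonpos.2 this)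
  have hmix := IsGaussMix.integral_prod_le hgauss f hf
  have hproj : ∀ i : Fin n, Measurable fun (x : Fin n × Fin m → ℝ) (j : Fin m) => x (i, j) :=
    fun i => by fun_prop
  have hfm : Measurable fun x : Fin n × Fin m → ℝ => ∏ i, f i fun j => x (i, j) :=
    Finset.measurable_fun_prod _ fun i _ => (hf i).measurable.comp (hproj i)
  choose C hC using fun i => (hf i).exists_le
  rw [key hfm (fun x => Finset.prod_nonneg fun i _ => (hf i).nonneg _) (C := ∏ i, C i),
    hν _ hfm, hν' _ hfm] at hmix
  · exact hmix
  · exact fun x => Finset.prod_le_prod (fun i _ => (hf i).nonneg _) fun i _ => hC i _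

theorem lintegral_prod_gaussMix_le {m n : ℕ} {f : (Fin m → ℝ) → ℝ} (hf : IsGaussMix f)
    {θ φ : Fin n → ℝ} (hθ : ∑ i, θ i ^ 2 = 1) (hφ : ∑ i, φ i ^ 2 = 1)
    (hmaj : IsMajorizedBy (fun i => θ i ^ 2) (fun i => φ i ^ 2))
    {ιθ ιφ : (Fin (m * (n - 1)) → ℝ) →ₗ[ℝ] (Fin n × Fin m → ℝ)}
    (hιθ : IsEuclParam m n (m * (n - 1)) ιθ (blockHyp m n θ))
    (hιφ : IsEuclParam m n (m * (n - 1)) ιφ (blockHyp m n φ)) :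
    ∫⁻ h, ENNReal.ofReal (∏ i, f fun j => ιθ h (i, j)) ≤
      ∫⁻ h, ENNReal.ofReal (∏ i, f fun j => ιφ h (i, j)) := by
  obtain ⟨w, hw0, hw1, hw⟩ := hmaj.exists_convex_combination
  have hε : ∀ ε : ℝ, 0 < ε → ∫⁻ h, ENNReal.ofReal (exp (-(ε * ∑ i, h i ^ 2))) *
      ENNReal.ofReal (∏ i, f fun j => ιθ h (i, j)) ≤
      ∫⁻ h, ENNReal.ofReal (∏ i, f fun j => ιφ h (i, j)) := by
    intro ε hε
    refine (lintegral_exp_mul_prod_le (fun _ => hf) hε hθ hφ hw0 hw1 hw hιθ hιφ).trans ?_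
    calc _ ≤ ∑ σ : Equiv.Perm (Fin n), ENNReal.ofReal (w σ) *
          ∫⁻ h, ENNReal.ofReal (∏ i, f fun j => ιφ h (i, j)) := by
          gcongr with σ _ h
          have hprod : ∏ i, f (fun j => blockPerm m σ (ιφ h) (i, j)) =
              ∏ i, f fun j => ιφ h (i, j) :=
            Equiv.prod_comp σ fun i => f fun j => ιφ h (i, j)
          rw [hprod]
          refine mul_le_of_le_one_left' (ENNReal.ofReal_le_one.2 (exp_le_one_iff.2 ?_))
          exact neg_nonpos.2 (mul_nonneg hε.le (Finset.sum_nonneg fun i _ => sq_nonneg _))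
      _ = _ := by
          rw [← Finset.sum_mul, ← ENNReal.ofReal_sum_of_nonneg fun σ _ => hw0 σ, hw1,
            ENNReal.ofReal_one, one_mul]
  have hm : Measurable fun h => ENNReal.ofReal (∏ i, f fun j => ιθ h (i, j)) := by
    have hmθ : Measurable ιθ := (LinearMap.continuous_of_finiteDimensional _).measurable
    exact (Finset.measurable_fun_prod _ fun i _ => hf.measurable.comp (by fun_prop)).ennreal_ofReal
  refine le_of_tendsto' (lintegral_tendsto_of_tendsto_of_monotone
    (f := fun (k : ℕ) (h : Fin (m * (n - 1)) → ℝ) =>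
      ENNReal.ofReal (exp (-(1 / ((k : ℝ) + 1) * ∑ i, h i ^ 2))) *
        ENNReal.ofReal (∏ i, f fun j => ιθ h (i, j)))
    (fun k => ((measurable_gaussWeight_density _ _).mul hm).aemeasurable)
    (ae_of_all _ fun h k l hkl => ?_) (ae_of_all _ fun h => ?_))
    fun k => hε _ Nat.one_div_pos_of_nat
  · have hsum : 0 ≤ ∑ i, h i ^ 2 := Finset.sum_nonneg fun i _ => sq_nonneg _
    dsimp only
    gcongr
  · have hlim : Tendsto (fun k : ℕ => exp (-(1 / ((k : ℝ) + 1) * ∑ i, h i ^ 2))) atTop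
        (nhds 1) := by
      have := (tendsto_one_div_add_atTop_nhds_zero_nat (𝕜 := ℝ)).mul_const (∑ i, h i ^ 2)
      simpa [Function.comp_def] using (continuous_exp.tendsto _).comp this.neg
    have h2 := ENNReal.Tendsto.mul_const (b := ENNReal.ofReal (∏ i, f fun j => ιθ h (i, j)))
      ((ENNReal.continuous_ofReal.tendsto _).comp hlim) (Or.inr ENNReal.ofReal_ne_top)
    simpa using h2

theorem lintegral_exp_neg_of_homogeneous {d : ℕ} {p : ℝ} (hp : 0 < p) {F : (Fin d → ℝ) → ℝ}
    (hF : Measurable F) (hF0 : ∀ x, 0 ≤ F x)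
    (hom : ∀ t : ℝ, 0 < t → ∀ x, F (t • x) = t ^ p * F x) :
    ∫⁻ x, ENNReal.ofReal (exp (-F x)) =
      ENNReal.ofReal (Gamma (d / p + 1)) * volume {x | F x ≤ 1} := by
  have hs : 0 < (d : ℝ) / p + 1 := by positivity
  have hvol : ∀ t : ℝ, 0 < t →
      volume {x | F x ≤ t} = ENNReal.ofReal (t ^ ((d : ℝ) / p)) * volume {x | F x ≤ 1} := by
    intro t ht
    have hset : {x | F x ≤ t} = (fun x => t ^ (-p⁻¹) • x) ⁻¹' {x | F x ≤ 1} := by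
      ext x
      have hpow : (t ^ (-p⁻¹)) ^ p = t⁻¹ := by
        rw [← rpow_mul ht.le, neg_mul, inv_mul_cancel₀ hp.ne', rpow_neg_one]
      simp only [Set.mem_ofPred_eq, Set.mem_preimage]
      rw [hom _ (rpow_pos_of_pos ht _), hpow, inv_mul_le_iff₀ ht, mul_one]
    rw [hset, Measure.addHaar_preimage_smul _ (rpow_pos_of_pos ht _).ne']
    congr 2
    rw [abs_of_pos (by positivity), Module.finrank_fin_fun, ← rpow_natCast, ← rpow_mul ht.le,
      ← rpow_neg ht.le]
    congr 1
    ring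
  have hlayer : ∀ x, ENNReal.ofReal (exp (-F x)) = ∫⁻ t in Set.Ioi (0 : ℝ),
      {q : (Fin d → ℝ) × ℝ | F q.1 ≤ q.2}.indicator
        (fun q => ENNReal.ofReal (exp (-q.2))) (x, t) := by
    intro x
    have h1 : ∫⁻ t in Set.Ioi (F x), ENNReal.ofReal (exp (-t)) =
        ENNReal.ofReal (exp (-F x)) := by
      rw [← integral_exp_neg_Ioi, ofReal_integral_eq_lintegral_ofReal
        (integrableOn_exp_neg_Ioi _) (ae_of_all _ fun t => (exp_pos _).le)]
    have h2 : ∀ t, {q : (Fin d → ℝ) × ℝ | F q.1 ≤ q.2}.indicator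
        (fun q => ENNReal.ofReal (exp (-q.2))) (x, t) =
        (Set.Ici (F x)).indicator (fun t => ENNReal.ofReal (exp (-t))) t := fun t => rfl
    simp only [h2]
    rw [← h1, setLIntegral_congr Ioi_ae_eq_Ici, setLIntegral_congr Ioi_ae_eq_Ici,
      setLIntegral_indicator measurableSet_Ici,
      Set.inter_eq_left.2 (Set.Ici_subset_Ici.2 (hF0 x))]
  have hmeas : Measurable ({q : (Fin d → ℝ) × ℝ | F q.1 ≤ q.2}.indicator
      fun q => ENNReal.ofReal (exp (-q.2))) :=
    Measurable.indicator (by fun_prop)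
      (measurableSet_le (hF.comp measurable_fst) measurable_snd)
  calc ∫⁻ x, ENNReal.ofReal (exp (-F x))
      = ∫⁻ t in Set.Ioi (0 : ℝ), ∫⁻ x, {q : (Fin d → ℝ) × ℝ | F q.1 ≤ q.2}.indicator
          (fun q => ENNReal.ofReal (exp (-q.2))) (x, t) := by
        simp only [hlayer]
        exact lintegral_lintegral_swap hmeas.aemeasurable
    _ = ∫⁻ t in Set.Ioi (0 : ℝ), ENNReal.ofReal (exp (-t) * t ^ ((d : ℝ) / p + 1 - 1)) *
          volume {x | F x ≤ 1} := by
        refine setLIntegral_congr_fun measurableSet_Ioi fun t ht => ?_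
        have h2 : ∀ x, {q : (Fin d → ℝ) × ℝ | F q.1 ≤ q.2}.indicator
            (fun q => ENNReal.ofReal (exp (-q.2))) (x, t) =
            {x | F x ≤ t}.indicator (fun _ => ENNReal.ofReal (exp (-t))) x := fun x => rfl
        simp only [h2]
        rw [lintegral_indicator_const (measurableSet_le hF measurable_const), hvol t ht,
          add_sub_cancel_right, ENNReal.ofReal_mul (exp_pos _).le, mul_assoc]
    _ = _ := by
        rw [lintegral_mul_const _ (by fun_prop), Gamma_eq_integral hs,
          ofReal_integral_eq_lintegral_ofReal (GammaIntegral_convergent hs)]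
        filter_upwards [ae_restrict_mem measurableSet_Ioi] with t ht
        have : 0 < t := ht
        positivity

theorem IsEuclParam.preimage_inter {m n d : ℕ} {ι : (Fin d → ℝ) →ₗ[ℝ] (Fin n × Fin m → ℝ)}
    {H : Set (Fin n × Fin m → ℝ)} (hι : IsEuclParam m n d ι H) (A : Set (Fin n × Fin m → ℝ)) :
    ⇑ι ⁻¹' (A ∩ H) = ⇑ι ⁻¹' A := by
  rw [← hι.2, Set.preimage_inter_range]

theorem lintegral_prod_exp_neg_rpow {m n d : ℕ} {p : ℝ} (hp : 0 < p) {N : (Fin m → ℝ) → ℝ}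
    (hN : IsQuasiNorm m N) (hmeas : Measurable fun x => N x ^ p)
    (ι : (Fin d → ℝ) →ₗ[ℝ] (Fin n × Fin m → ℝ)) :
    ∫⁻ h, ENNReal.ofReal (∏ i, exp (-N (fun j => ι h (i, j)) ^ p)) =
      ENNReal.ofReal (Gamma (d / p + 1)) * volume (⇑ι ⁻¹' lpBall m n p N) := by
  have hι : Measurable ι := (LinearMap.continuous_of_finiteDimensional _).measurable
  have h := lintegral_exp_neg_of_homogeneous (d := d) hp
    (F := fun h => ∑ i, N (fun j => ι h (i, j)) ^ p)
    (Finset.measurable_fun_sum _ fun i _ =>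
      hmeas.comp (g := fun x => N x ^ p) (f := fun h j => ι h (i, j)) (by fun_prop))
    (fun x => Finset.sum_nonneg fun i _ => rpow_nonneg (hN.1 _) _) fun t ht x => by
      rw [Finset.mul_sum]
      refine Finset.sum_congr rfl fun i _ => ?_
      have : (fun j => ι (t • x) (i, j)) = t • fun j => ι x (i, j) := by
        ext j
        simp
      rw [this, hN.2.2.1, abs_of_pos ht, mul_rpow ht.le (hN.1 _)]
  simp only [← exp_sum, Finset.sum_neg_distrib]
  exact h

/-- **Theorem 1 (Schur monotonicity of sections).** Let `p ∈ (0,2]` and let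
`X = (ℝ^m, N)` be a quasi-normed space admitting an isometric embedding into `L_p`. If
`(θ_1²,…,θ_n²)` is majorized by `(φ_1²,…,φ_n²)` for unit vectors `θ, φ` of `ℝ^n`, then
`|B_p^n(X) ∩ H_θ| ≤ |B_p^n(X) ∩ H_φ|`, where the `m(n-1)`-dimensional Lebesgue measures of
the sections are computed via Euclidean isometric parametrizations of `H_θ` and `H_φ`. -/
theorem sections_schur_monotone (m n : ℕ) (p : ℝ) (hp0 : 0 < p) (hp2 : p ≤ 2)
    (N : (Fin m → ℝ) → ℝ) (hN : IsQuasiNorm m N) (hNp : EmbedsIntoLp m p N)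
    (θ φ : Fin n → ℝ) (hθ : ∑ i, θ i ^ 2 = 1) (hφ : ∑ i, φ i ^ 2 = 1)
    (hmaj : IsMajorizedBy (fun i => θ i ^ 2) (fun i => φ i ^ 2))
    (ιθ ιφ : (Fin (m * (n - 1)) → ℝ) →ₗ[ℝ] (Fin n × Fin m → ℝ))
    (hιθ : IsEuclParam m n (m * (n - 1)) ιθ (blockHyp m n θ))
    (hιφ : IsEuclParam m n (m * (n - 1)) ιφ (blockHyp m n φ)) :
    volume (⇑ιθ ⁻¹' (lpBall m n p N ∩ blockHyp m n θ)) ≤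
      volume (⇑ιφ ⁻¹' (lpBall m n p N ∩ blockHyp m n φ)) := by
  have hmix : IsGaussMix fun x => exp (-N x ^ p) := by
    simpa using (hNp.isMixExponent hp0 hp2).2 1 zero_le_one
  have hmeas : Measurable fun x => N x ^ p := by
    simpa [Pi.neg_def] using hmix.measurable.log.neg
  have h := lintegral_prod_gaussMix_le hmix hθ hφ hmaj hιθ hιφ
  rw [lintegral_prod_exp_neg_rpow hp0 hN hmeas, lintegral_prod_exp_neg_rpow hp0 hN hmeas] at h
  rw [hιθ.preimage_inter, hιφ.preimage_inter]
  have hΓ : 0 < Gamma (((m * (n - 1) : ℕ) : ℝ) / p + 1) := Gamma_pos_of_pos (by positivity)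
  exact (ENNReal.mul_le_mul_iff_right (ENNReal.ofReal_pos.2 hΓ).ne' ENNReal.ofReal_ne_top).1 h
end
end

section
/- Let m, n ∈ ℕ, p ∈ (0,2], and let X = (ℝ^m, ‖·‖_X) be an m-dimensional quasi-normed space which admits an isometric embedding into L_p. Then for every unit vector θ in ℝ^n: |B_p^n(X) ∩ H_diag| ≤ |B_p^n(X) ∩ H_θ| ≤ |B_p^{n−1}(X)|, where H_diag = {(x_1,…,x_n) ∈ (ℝ^m)^n : ∑_{i=1}^n x_i = 0} and volumes of sections are (m(n−1))-dimensional Lebesgue measures. -/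
open MeasureTheory Real Filter
open scoped ENNReal

noncomputable section

open scoped Topology Matrix

/-- Nonnegativity and log-convexity on `[0, ∞)`, written as a family of linear inequalities. -/
def WeightedLogConvex (g : ℝ → ℝ) : Prop :=
  (∀ t, 0 ≤ t → 0 ≤ g t) ∧
    ∀ s t a b x y : ℝ, 0 ≤ s → 0 ≤ t → 0 ≤ a → 0 ≤ b → a + b = 1 →
      g (a * s + b * t) * exp (a * x + b * y) ≤ a * (exp x * g s) + b * (exp y * g t)

namespace WeightedLogConvex

lemma const_mul_exp {c : ℝ} (hc : 0 ≤ c) (k : ℝ) :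
    WeightedLogConvex (fun t => c * exp (-(k * t))) := by
  refine ⟨fun t _ => by positivity, fun s t a b x y _ _ ha hb hab => ?_⟩
  have h := convexOn_exp.2 (Set.mem_univ (x - k * s)) (Set.mem_univ (y - k * t)) ha hb hab
  simp only [smul_eq_mul] at h
  have e : c * exp (-(k * (a * s + b * t))) * exp (a * x + b * y)
      = c * exp (a * (x - k * s) + b * (y - k * t)) := by
    rw [mul_assoc, ← exp_add]; ring_nf
  rw [e]
  refine (mul_le_mul_of_nonneg_left h hc).trans_eq ?_
  simp only [sub_eq_add_neg, exp_add]
  ring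

lemma of_tendsto {ι : Type*} {l : Filter ι} [l.NeBot] {g : ι → ℝ → ℝ} {G : ℝ → ℝ}
    (hg : ∀ k, WeightedLogConvex (g k))
    (h : ∀ t, 0 ≤ t → Tendsto (fun k => g k t) l (𝓝 (G t))) : WeightedLogConvex G := by
  refine ⟨fun t ht => ge_of_tendsto' (h t ht) fun k => (hg k).1 t ht,
    fun s t a b x y hs ht ha hb hab => ?_⟩
  refine le_of_tendsto_of_tendsto' ((h _ (by positivity)).mul_const _)
    ((((h s hs).const_mul _).const_mul _).add (((h t ht).const_mul _).const_mul _))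
    fun k => (hg k).2 s t a b x y hs ht ha hb hab

lemma integral {Ω : Type*} [MeasurableSpace Ω] {η : Measure Ω} {g : Ω → ℝ → ℝ}
    (hg : ∀ ω, WeightedLogConvex (g ω)) (hi : ∀ t, 0 ≤ t → Integrable (fun ω => g ω t) η) :
    WeightedLogConvex (fun t => ∫ ω, g ω t ∂η) := by
  refine ⟨fun t ht => integral_nonneg fun ω => (hg ω).1 t ht,
    fun s t a b x y hs ht ha hb hab => ?_⟩
  dsimp only
  rw [← integral_mul_const, ← integral_const_mul, ← integral_const_mul, ← integral_const_mul,
    ← integral_const_mul, ← integral_add]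
  · exact integral_mono ((hi _ (by positivity)).mul_const _)
      ((((hi s hs).const_mul _).const_mul _).add (((hi t ht).const_mul _).const_mul _))
      fun ω => (hg ω).2 s t a b x y hs ht ha hb hab
  · exact ((hi s hs).const_mul _).const_mul _
  · exact ((hi t ht).const_mul _).const_mul _

lemma add {g h : ℝ → ℝ} (hg : WeightedLogConvex g) (hh : WeightedLogConvex h) :
    WeightedLogConvex (fun t => g t + h t) := by
  refine ⟨fun t ht => add_nonneg (hg.1 t ht) (hh.1 t ht),
    fun s t a b x y hs ht ha hb hab => ?_⟩
  have h1 := hg.2 s t a b x y hs ht ha hb hab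
  have h2 := hh.2 s t a b x y hs ht ha hb hab
  dsimp only
  linarith

lemma const {c : ℝ} (hc : 0 ≤ c) : WeightedLogConvex (fun _ => c) := by
  simpa using const_mul_exp hc 0

lemma const_mul {g : ℝ → ℝ} (hg : WeightedLogConvex g) {c : ℝ} (hc : 0 ≤ c) :
    WeightedLogConvex (fun t => c * g t) := by
  refine ⟨fun t ht => mul_nonneg hc (hg.1 t ht), fun s t a b x y hs ht ha hb hab => ?_⟩
  have h1 := mul_le_mul_of_nonneg_left (hg.2 s t a b x y hs ht ha hb hab) hc
  dsimp only
  linarith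

lemma sum {ι : Type*} (s : Finset ι) {g : ι → ℝ → ℝ} (hg : ∀ i ∈ s, WeightedLogConvex (g i)) :
    WeightedLogConvex (fun t => ∑ i ∈ s, g i t) := by
  classical
  induction s using Finset.induction_on with
  | empty => simpa using const le_rfl
  | insert i s hi ih =>
    simp only [Finset.sum_insert hi]
    exact (hg i (Finset.mem_insert_self i s)).add
      (ih fun j hj => hg j (Finset.mem_insert_of_mem hj))

lemma convexOn_log {g : ℝ → ℝ} (hg : WeightedLogConvex g) (hpos : ∀ t, 0 ≤ t → 0 < g t) :
    ConvexOn ℝ (Set.Ici 0) (fun t => log (g t)) := by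
  refine ⟨convex_Ici 0, fun s hs t ht a b ha hb hab => ?_⟩
  have hs : 0 ≤ s := hs
  have ht : 0 ≤ t := ht
  have h := hg.2 s t a b (-log (g s)) (-log (g t)) hs ht ha hb hab
  rw [exp_neg, exp_neg, exp_log (hpos s hs), exp_log (hpos t ht),
    inv_mul_cancel₀ (hpos s hs).ne', inv_mul_cancel₀ (hpos t ht).ne', mul_one, mul_one, hab] at h
  have hu : 0 ≤ a * s + b * t := by positivity
  have h' : g (a * s + b * t) ≤ exp (a * log (g s) + b * log (g t)) := by
    rw [show a * -log (g s) + b * -log (g t) = -(a * log (g s) + b * log (g t)) by ring,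
      exp_neg, ← div_eq_mul_inv, div_le_one (exp_pos _)] at h
    exact h
  simp only [smul_eq_mul]
  rwa [log_le_iff_le_exp (hpos _ hu)]

lemma pow_le_prod_of_pos {g : ℝ → ℝ} (hg : WeightedLogConvex g) (hpos : ∀ t, 0 ≤ t → 0 < g t)
    {n : ℕ} {t : Fin n → ℝ} (ht : ∀ i, 0 ≤ t i) (hsum : ∑ i, t i = 1) :
    g (1 / n) ^ n ≤ ∏ i, g (t i) := by
  have hn : (0 : ℝ) < n := by
    rcases Nat.eq_zero_or_pos n with rfl | h
    · simp at hsum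
    · exact_mod_cast h
  have h := (hg.convexOn_log hpos).map_sum_le (t := Finset.univ) (w := fun _ : Fin n => (1 / n : ℝ))
    (p := t) (fun _ _ => by positivity) (by simp [hn.ne']) (fun i _ => ht i)
  simp only [smul_eq_mul] at h
  rw [← Finset.mul_sum, ← Finset.mul_sum, hsum, mul_one, ← log_prod fun i _ => (hpos _ (ht i)).ne',
    one_div_mul_eq_div, le_div_iff₀ hn, mul_comm, ← log_pow] at h
  exact (log_le_log_iff (pow_pos (hpos _ (by positivity)) _)
    (Finset.prod_pos fun i _ => hpos _ (ht i))).1 h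

lemma prod_le_of_pos {g : ℝ → ℝ} (hg : WeightedLogConvex g) (hpos : ∀ t, 0 ≤ t → 0 < g t)
    {n : ℕ} {t : Fin n → ℝ} (ht : ∀ i, 0 ≤ t i) (hsum : ∑ i, t i = 1) :
    ∏ i, g (t i) ≤ g 0 ^ (n - 1) * g 1 := by
  have hn : 1 ≤ n := by
    rcases Nat.eq_zero_or_pos n with rfl | h
    · simp at hsum
    · exact h
  have h0 := hpos 0 le_rfl
  have h1 := hpos 1 zero_le_one
  have ht1 : ∀ i, t i ≤ 1 := fun i => by
    rw [← hsum]; exact Finset.single_le_sum (fun j _ => ht j) (Finset.mem_univ i)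
  have key : ∀ i, log (g (t i)) ≤ (1 - t i) * log (g 0) + t i * log (g 1) := fun i => by
    have h := (hg.convexOn_log hpos).2 (show (0 : ℝ) ∈ Set.Ici 0 by simp)
      (show (1 : ℝ) ∈ Set.Ici 0 by simp) (sub_nonneg.2 (ht1 i)) (ht i) (by ring)
    simpa using h
  rw [← log_le_log_iff (Finset.prod_pos fun i _ => hpos _ (ht i)) (by positivity),
    log_prod fun i _ => (hpos _ (ht i)).ne', log_mul (by positivity) h1.ne', log_pow]
  refine (Finset.sum_le_sum fun i _ => key i).trans_eq ?_
  rw [Finset.sum_add_distrib, ← Finset.sum_mul, ← Finset.sum_mul, hsum, Finset.sum_sub_distrib,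
    hsum]
  simp [Nat.cast_sub hn]

lemma pow_le_prod {g : ℝ → ℝ} (hg : WeightedLogConvex g)
    {n : ℕ} {t : Fin n → ℝ} (ht : ∀ i, 0 ≤ t i) (hsum : ∑ i, t i = 1) :
    g (1 / n) ^ n ≤ ∏ i, g (t i) := by
  have hc : ∀ f : ℝ → ℝ, Continuous f → Tendsto f (𝓝[>] 0) (𝓝 (f 0)) :=
    fun f hf => hf.continuousAt.mono_left nhdsWithin_le_nhds
  have h1 := hc (fun δ => (g (1 / n) + δ) ^ n) (by fun_prop)
  have h2 := hc (fun δ => ∏ i, (g (t i) + δ)) (by fun_prop)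
  simp only [add_zero] at h1 h2
  refine le_of_tendsto_of_tendsto h1 h2 ?_
  filter_upwards [self_mem_nhdsWithin] with δ hδ
  have hδ : 0 < δ := hδ
  exact (hg.add (const hδ.le)).pow_le_prod_of_pos (fun t ht => by have := hg.1 t ht; positivity)
    ht hsum

lemma prod_le {g : ℝ → ℝ} (hg : WeightedLogConvex g)
    {n : ℕ} {t : Fin n → ℝ} (ht : ∀ i, 0 ≤ t i) (hsum : ∑ i, t i = 1) :
    ∏ i, g (t i) ≤ g 0 ^ (n - 1) * g 1 := by
  have hc : ∀ f : ℝ → ℝ, Continuous f → Tendsto f (𝓝[>] 0) (𝓝 (f 0)) :=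
    fun f hf => hf.continuousAt.mono_left nhdsWithin_le_nhds
  have h1 := hc (fun δ => (g 0 + δ) ^ (n - 1) * (g 1 + δ)) (by fun_prop)
  have h2 := hc (fun δ => ∏ i, (g (t i) + δ)) (by fun_prop)
  simp only [add_zero] at h1 h2
  refine le_of_tendsto_of_tendsto h2 h1 ?_
  filter_upwards [self_mem_nhdsWithin] with δ hδ
  have hδ : 0 < δ := hδ
  exact (hg.add (const hδ.le)).prod_le_of_pos (fun t ht => by have := hg.1 t ht; positivity)
    ht hsum

end WeightedLogConvex

lemma integrable_exp_neg_mul_dotProduct {m : ℕ} {b : ℝ} (hb : 0 < b) :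
    Integrable (fun v : Fin m → ℝ => exp (-(b * (v ⬝ᵥ v)))) := by
  have h := (GaussianFourier.integrable_cexp_neg_mul_sum_add (ι := Fin m) (b := (b : ℂ))
    (by simpa using hb) 0).re
  refine h.congr (ae_of_all _ fun v => ?_)
  have : (-(b : ℂ) * ∑ i, (v i : ℂ) ^ 2 + ∑ i, (0 : Fin m → ℂ) i * (v i : ℂ))
      = ((-(b * (v ⬝ᵥ v)) : ℝ) : ℂ) := by
    simp [dotProduct, sq]
  simp only [this, ← Complex.ofReal_exp]
  rfl

lemma integral_exp_neg_mul_dotProduct_mul_cos {m : ℕ} {b : ℝ} (hb : 0 < b) (w : Fin m → ℝ) :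
    ∫ v : Fin m → ℝ, exp (-(b * (v ⬝ᵥ v))) * cos (v ⬝ᵥ w)
      = (π / b) ^ (m / 2 : ℝ) * exp (-((w ⬝ᵥ w) / (4 * b))) := by
  have hb' : 0 < (b : ℂ).re := by simpa using hb
  have h := GaussianFourier.integral_cexp_neg_mul_sum_add hb' (fun i : Fin m => Complex.I * w i)
  have hi := GaussianFourier.integrable_cexp_neg_mul_sum_add hb'
    (fun i : Fin m => Complex.I * w i)
  have h2 := integral_re hi
  rw [h] at h2
  have e1 : ∀ v : Fin m → ℝ, (-(b : ℂ) * ∑ i, (v i : ℂ) ^ 2 + ∑ i, Complex.I * (w i : ℂ) * (v i : ℂ))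
      = ((-(b * (v ⬝ᵥ v)) : ℝ) : ℂ) + ((v ⬝ᵥ w : ℝ) : ℂ) * Complex.I := fun v => by
    simp only [dotProduct, Complex.ofReal_neg, Complex.ofReal_mul, Complex.ofReal_sum,
      Finset.sum_mul, sq]
    congr 1
    · ring
    · exact Finset.sum_congr rfl fun i _ => by ring
  have e2 : ((π : ℂ) / b) ^ ((Fintype.card (Fin m) : ℂ) / 2)
      * Complex.exp ((∑ i, (Complex.I * (w i : ℂ)) ^ 2) / (4 * b))
      = (((π / b) ^ (m / 2 : ℝ) * exp (-((w ⬝ᵥ w) / (4 * b))) : ℝ) : ℂ) := by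
    have e0 : ∑ i, (Complex.I * (w i : ℂ)) ^ 2 = -((w ⬝ᵥ w : ℝ) : ℂ) := by
      rw [dotProduct, Complex.ofReal_sum, ← Finset.sum_neg_distrib]
      refine Finset.sum_congr rfl fun i _ => ?_
      rw [mul_pow, Complex.I_sq]
      push_cast
      ring
    rw [Complex.ofReal_mul, Complex.ofReal_cpow (by positivity), Complex.ofReal_exp, e0]
    simp [neg_div]
  rw [e2, RCLike.re_eq_complex_re, Complex.ofReal_re] at h2
  rw [← h2]
  refine integral_congr_ae (ae_of_all _ fun v => ?_)
  simp only [e1, Complex.exp_add, ← Complex.ofReal_exp, Complex.re_ofReal_mul,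
    Complex.exp_ofReal_mul_I_re]

/-- The cosine transform of `f` at the frequency `ξ`. -/
def cosTransform {m : ℕ} (f : (Fin m → ℝ) → ℝ) (ξ : Fin m → ℝ) : ℝ :=
  ∫ x, f x * cos (x ⬝ᵥ ξ)

lemma weightedLogConvex_cosTransform_gaussian {m : ℕ} {P : Matrix (Fin m) (Fin m) ℝ}
    (hP : P.PosDef) (ξ : Fin m → ℝ) :
    WeightedLogConvex fun t => cosTransform (fun x => exp (-(x ⬝ᵥ P *ᵥ x))) (√t • ξ) := by
  obtain ⟨B, hB⟩ : ∃ B : Matrix (Fin m) (Fin m) ℝ, P = Bᵀ * B := by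
    open scoped MatrixOrder in
    obtain ⟨B, hB⟩ := CStarAlgebra.nonneg_iff_eq_star_mul_self.mp hP.posSemidef.nonneg
    exact ⟨B, by simpa [Matrix.star_eq_conjTranspose] using hB⟩
  have hdet : B.det ≠ 0 := by
    have := hP.det_pos
    rw [hB, Matrix.det_mul] at this
    exact right_ne_zero_of_mul this.ne'
  have hinv : Bᵀ * (Bᵀ)⁻¹ = 1 := Matrix.mul_nonsing_inv _ (by simpa using hdet)
  set ζ := (Bᵀ)⁻¹ *ᵥ ξ with hζ
  have hquad : ∀ x, x ⬝ᵥ P *ᵥ x = (B *ᵥ x) ⬝ᵥ (B *ᵥ x) := fun x => by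
    rw [hB, ← Matrix.mulVec_mulVec, Matrix.dotProduct_mulVec, Matrix.vecMul_transpose]
  have hlin : ∀ x, x ⬝ᵥ ξ = (B *ᵥ x) ⬝ᵥ ζ := fun x => by
    rw [← Matrix.vecMul_transpose, ← Matrix.dotProduct_mulVec, hζ, Matrix.mulVec_mulVec, hinv,
      Matrix.one_mulVec]
  have hmap := Real.map_matrix_volume_pi_eq_smul_volume_pi hdet
  have key : ∀ t : ℝ, 0 ≤ t → cosTransform (fun x => exp (-(x ⬝ᵥ P *ᵥ x))) (√t • ξ)
      = (|B.det⁻¹| * π ^ (m / 2 : ℝ)) * exp (-(((ζ ⬝ᵥ ζ) / 4) * t)) := fun t ht => by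
    have h1 : cosTransform (fun x => exp (-(x ⬝ᵥ P *ᵥ x))) (√t • ξ)
        = ∫ x, (fun y : Fin m → ℝ => exp (-(1 * (y ⬝ᵥ y))) * cos (y ⬝ᵥ (√t • ζ)))
          (Matrix.toLin' B x) := by
      refine integral_congr_ae (ae_of_all _ fun x => ?_)
      simp only [hquad, dotProduct_smul, hlin, one_mul, Matrix.toLin'_apply]
    rw [h1, ← integral_map (φ := Matrix.toLin' B)
      (f := fun y : Fin m → ℝ => exp (-(1 * (y ⬝ᵥ y))) * cos (y ⬝ᵥ (√t • ζ))), hmap,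
      integral_smul_measure, integral_exp_neg_mul_dotProduct_mul_cos one_pos]
    · rw [ENNReal.toReal_ofReal (abs_nonneg _)]
      simp only [dotProduct_smul, smul_dotProduct, smul_eq_mul, div_one, mul_one]
      rw [← mul_assoc (√t), Real.mul_self_sqrt ht]
      ring_nf
    · exact (Matrix.toLin' B).continuous_of_finiteDimensional.aemeasurable
    · exact Continuous.aestronglyMeasurable (by simp only [dotProduct]; fun_prop)
  have := WeightedLogConvex.const_mul_exp (c := |B.det⁻¹| * π ^ (m / 2 : ℝ)) (by positivity)
    ((ζ ⬝ᵥ ζ) / 4)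
  exact .of_tendsto (l := (⊤ : Filter Unit)) (fun _ => this) fun t ht => by
    rw [key t ht]; exact tendsto_const_nhds

/-- `f` is a mixture, over a finite measure, of functions `exp (-q)` with `q` a positive
semidefinite quadratic form. -/
def IsGaussianMixture {m : ℕ} (f : (Fin m → ℝ) → ℝ) : Prop :=
  ∃ (Ω : Type) (_ : MeasurableSpace Ω) (η : Measure Ω) (M : Ω → Matrix (Fin m) (Fin m) ℝ),
    IsFiniteMeasure η ∧ (∀ i j, AEMeasurable (fun ω => M ω i j) η) ∧
      (∀ ω, (M ω).PosSemidef) ∧ ∀ x, f x = ∫ ω, exp (-(x ⬝ᵥ M ω *ᵥ x)) ∂η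

namespace IsGaussianMixture

lemma pow {m : ℕ} {f : (Fin m → ℝ) → ℝ} (hf : IsGaussianMixture f) (k : ℕ) :
    IsGaussianMixture fun x => f x ^ k := by
  obtain ⟨Ω, _, η, M, _, hM, hpos, hf⟩ := hf
  refine ⟨Fin k → Ω, inferInstance, Measure.pi fun _ => η, fun ω => ∑ l, M (ω l), inferInstance,
    fun i j => ?_, fun ω => Matrix.posSemidef_sum _ fun l _ => hpos _, fun x => ?_⟩
  · simp only [Matrix.sum_apply]
    exact Finset.aemeasurable_fun_sum _ fun l _ =>
      (hM i j).comp_quasiMeasurePreserving (Measure.quasiMeasurePreserving_eval _ l)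
  · have h := integral_fintype_prod_eq_pow (μ := η) (ι := Fin k)
      (fun ω => exp (-(x ⬝ᵥ M ω *ᵥ x)))
    rw [← hf x, Fintype.card_fin] at h
    refine h.symm.trans ?_
    refine integral_congr_ae (ae_of_all _ fun ω => ?_)
    simp only [Matrix.sum_mulVec, dotProduct_sum, ← exp_sum, Finset.sum_neg_distrib]

lemma nonneg {m : ℕ} {f : (Fin m → ℝ) → ℝ} (hf : IsGaussianMixture f) (x : Fin m → ℝ) :
    0 ≤ f x := by
  obtain ⟨Ω, _, η, M, _, hM, hpos, hf⟩ := hf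
  rw [hf]; exact integral_nonneg fun ω => (exp_pos _).le

end IsGaussianMixture

lemma aestronglyMeasurable_gaussian_prod {m : ℕ} {Ω : Type*} [MeasurableSpace Ω]
    {η : Measure Ω} [SFinite η] {M : Ω → Matrix (Fin m) (Fin m) ℝ}
    (hM : ∀ i j, AEMeasurable (fun ω => M ω i j) η) :
    AEStronglyMeasurable (fun z : (Fin m → ℝ) × Ω => exp (-(z.1 ⬝ᵥ M z.2 *ᵥ z.1)))
      (volume.prod η) := by
  refine AEMeasurable.aestronglyMeasurable (AEMeasurable.exp (AEMeasurable.neg ?_))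
  simp only [dotProduct, Matrix.mulVec]
  refine Finset.aemeasurable_fun_sum _ fun i _ => ?_
  have hx : ∀ i, AEMeasurable (fun z : (Fin m → ℝ) × Ω => z.1 i) (volume.prod η) :=
    fun i => ((measurable_pi_apply i).comp measurable_fst).aemeasurable
  exact (hx i).mul (Finset.aemeasurable_fun_sum _ fun j _ => ((hM i j).comp_snd).mul (hx j))

lemma IsGaussianMixture.weightedLogConvex {m : ℕ} {f : (Fin m → ℝ) → ℝ}
    (hf : IsGaussianMixture f) {ε : ℝ} (hε : 0 < ε) (ξ : Fin m → ℝ) :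
    (Integrable fun x => exp (-(ε * (x ⬝ᵥ x))) * f x) ∧
    WeightedLogConvex fun t =>
      cosTransform (fun x => exp (-(ε * (x ⬝ᵥ x))) * f x) (√t • ξ) := by
  obtain ⟨Ω, _, η, M, _, hM, hpos, hf⟩ := hf
  have hmeas := aestronglyMeasurable_gaussian_prod hM
  have hq : ∀ ω (x : Fin m → ℝ), 0 ≤ x ⬝ᵥ M ω *ᵥ x := fun ω x => by
    simpa using (hpos ω).dotProduct_mulVec_nonneg x
  have hbase : Integrable (fun z : (Fin m → ℝ) × Ω =>
      exp (-(ε * (z.1 ⬝ᵥ z.1))) * exp (-(z.1 ⬝ᵥ M z.2 *ᵥ z.1))) (volume.prod η) := by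
    have h1 := (integrable_exp_neg_mul_dotProduct (m := m) hε).comp_fst η
    refine h1.mul_bdd (c := 1) hmeas (ae_of_all _ fun z => ?_)
    rw [norm_eq_abs, abs_exp, exp_le_one_iff, neg_nonpos]
    exact hq _ _
  have hint : ∀ ζ : Fin m → ℝ, Integrable (fun z : (Fin m → ℝ) × Ω =>
      exp (-(ε * (z.1 ⬝ᵥ z.1))) * exp (-(z.1 ⬝ᵥ M z.2 *ᵥ z.1)) * cos (z.1 ⬝ᵥ ζ))
      (volume.prod η) := fun ζ => by
    refine hbase.mul_bdd (c := 1) ?_ (ae_of_all _ fun z => abs_cos_le_one _)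
    have hc : Continuous fun x : Fin m → ℝ => cos (x ⬝ᵥ ζ) := by
      simp only [dotProduct]; fun_prop
    exact (hc.measurable.comp measurable_fst).aestronglyMeasurable
  have hP : ∀ ω, ((ε • (1 : Matrix (Fin m) (Fin m) ℝ)) + M ω).PosDef := fun ω =>
    (Matrix.PosDef.one.smul hε).add_posSemidef (hpos ω)
  have hform : ∀ ω ζ, ∫ x, exp (-(ε * (x ⬝ᵥ x))) * exp (-(x ⬝ᵥ M ω *ᵥ x)) * cos (x ⬝ᵥ ζ)
      = cosTransform (fun x => exp (-(x ⬝ᵥ ((ε • (1 : Matrix (Fin m) (Fin m) ℝ)) + M ω) *ᵥ x)))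
        ζ := fun ω ζ => by
    refine integral_congr_ae (ae_of_all _ fun x => ?_)
    simp only [Matrix.add_mulVec, dotProduct_add, Matrix.smul_mulVec, Matrix.one_mulVec,
      dotProduct_smul, smul_eq_mul, neg_add, exp_add]
  refine ⟨?_, ?_⟩
  · have := hbase.integral_prod_left
    simpa only [integral_const_mul, ← hf] using this
  · have hL := WeightedLogConvex.integral (η := η)
      (fun ω => weightedLogConvex_cosTransform_gaussian (hP ω) ξ) (fun t _ => by
        have := (hint (√t • ξ)).integral_prod_right
        simpa only [hform] using this)
    refine .of_tendsto (l := (⊤ : Filter Unit)) (fun _ => hL) fun t ht => ?_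
    have : cosTransform (fun x => exp (-(ε * (x ⬝ᵥ x))) * f x) (√t • ξ)
        = ∫ ω, cosTransform (fun x =>
          exp (-(x ⬝ᵥ ((ε • (1 : Matrix (Fin m) (Fin m) ℝ)) + M ω) *ᵥ x))) (√t • ξ) ∂η := by
      simp only [← hform]
      rw [← integral_integral_swap (hint _)]
      refine integral_congr_ae (ae_of_all _ fun x => ?_)
      simp only [integral_mul_const, integral_const_mul, ← hf]
    rw [this]
    exact tendsto_const_nhds

/-- After multiplication by any centred Gaussian, `f` is integrable and its cosine transform along
any direction is a log-convex function of the squared frequency. -/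
def HasLogConvexTransform {m : ℕ} (f : (Fin m → ℝ) → ℝ) : Prop :=
  ∀ ε : ℝ, 0 < ε → (Integrable fun x => exp (-(ε * (x ⬝ᵥ x))) * f x) ∧
    ∀ ξ, WeightedLogConvex fun t =>
      cosTransform (fun x => exp (-(ε * (x ⬝ᵥ x))) * f x) (√t • ξ)

lemma MeasureTheory.Integrable.mul_cos_dotProduct {m : ℕ} {f : (Fin m → ℝ) → ℝ} (hf : Integrable f)
    (ξ : Fin m → ℝ) : Integrable fun x => f x * cos (x ⬝ᵥ ξ) :=
  hf.mul_bdd (c := 1) (Continuous.aestronglyMeasurable (by simp only [dotProduct]; fun_prop))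
    (ae_of_all _ fun _ => abs_cos_le_one _)

lemma tendsto_cosTransform {m : ℕ} {ι : Type*} {l : Filter ι} [l.IsCountablyGenerated]
    {F : ι → (Fin m → ℝ) → ℝ} {f g : (Fin m → ℝ) → ℝ} (hg : Integrable g)
    (hF : ∀ k, Integrable (F k)) (hFg : ∀ k x, |F k x| ≤ g x)
    (h : ∀ x, Tendsto (fun k => F k x) l (𝓝 (f x))) (ξ : Fin m → ℝ) :
    Tendsto (fun k => cosTransform (F k) ξ) l (𝓝 (cosTransform f ξ)) := by
  refine tendsto_integral_filter_of_dominated_convergence g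
    (Eventually.of_forall fun k => ((hF k).mul_cos_dotProduct ξ).aestronglyMeasurable)
    (Eventually.of_forall fun k => ae_of_all _ fun x => ?_) hg
    (ae_of_all _ fun x => (h x).mul_const _)
  rw [norm_mul, norm_eq_abs, norm_eq_abs]
  exact (mul_le_of_le_one_right (abs_nonneg _) (abs_cos_le_one _)).trans (hFg k x)

namespace HasLogConvexTransform

lemma of_tendsto {m : ℕ} {F : ℕ → (Fin m → ℝ) → ℝ} {f : (Fin m → ℝ) → ℝ} {C : ℝ}
    (hF : ∀ k, HasLogConvexTransform (F k)) (hC : ∀ k x, |F k x| ≤ C)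
    (h : ∀ x, Tendsto (fun k => F k x) atTop (𝓝 (f x))) : HasLogConvexTransform f := by
  intro ε hε
  have hg : Integrable fun x : Fin m → ℝ => exp (-(ε * (x ⬝ᵥ x))) * C :=
    (integrable_exp_neg_mul_dotProduct hε).mul_const C
  have hlim : ∀ x, Tendsto (fun k => exp (-(ε * (x ⬝ᵥ x))) * F k x) atTop
      (𝓝 (exp (-(ε * (x ⬝ᵥ x))) * f x)) := fun x => (h x).const_mul _
  have hb : ∀ k x, |exp (-(ε * (x ⬝ᵥ x))) * F k x| ≤ exp (-(ε * (x ⬝ᵥ x))) * C := fun k x => by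
    rw [abs_mul, abs_exp]
    exact mul_le_mul_of_nonneg_left (hC k x) (exp_pos _).le
  refine ⟨hg.mono' (aestronglyMeasurable_of_tendsto_ae atTop
    (fun k => (hF k ε hε).1.aestronglyMeasurable) (ae_of_all _ hlim)) (ae_of_all _ fun x =>
      le_of_tendsto' (hlim x).abs fun k => hb k x), fun ξ => ?_⟩
  exact .of_tendsto (fun k => (hF k ε hε).2 ξ) fun t _ =>
    tendsto_cosTransform hg (fun k => (hF k ε hε).1) hb hlim _

lemma sum {m : ℕ} {ι : Type*} (s : Finset ι) {c : ι → ℝ} {f : ι → (Fin m → ℝ) → ℝ}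
    (hc : ∀ i ∈ s, 0 ≤ c i) (hf : ∀ i ∈ s, HasLogConvexTransform (f i)) :
    HasLogConvexTransform fun x => ∑ i ∈ s, c i * f i x := by
  intro ε hε
  have e : ∀ x : Fin m → ℝ, exp (-(ε * (x ⬝ᵥ x))) * ∑ i ∈ s, c i * f i x
      = ∑ i ∈ s, c i * (exp (-(ε * (x ⬝ᵥ x))) * f i x) := fun x => by
    rw [Finset.mul_sum]; exact Finset.sum_congr rfl fun i _ => by ring
  simp only [e]
  refine ⟨integrable_finsetSum _ fun i hi => ((hf i hi ε hε).1.const_mul _), fun ξ => ?_⟩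
  have e2 : ∀ ζ, cosTransform (fun x => ∑ i ∈ s, c i * (exp (-(ε * (x ⬝ᵥ x))) * f i x)) ζ
      = ∑ i ∈ s, c i * cosTransform (fun x => exp (-(ε * (x ⬝ᵥ x))) * f i x) ζ := fun ζ => by
    simp only [cosTransform, Finset.sum_mul, ← integral_const_mul, mul_assoc (c _)]
    exact integral_finsetSum _ fun i hi => ((hf i hi ε hε).1.mul_cos_dotProduct ζ).const_mul _
  simp only [e2]
  exact .sum s fun i hi => ((hf i hi ε hε).2 ξ).const_mul (hc i hi)

lemma exp_neg_integral {m : ℕ} {Ω : Type} [MeasurableSpace Ω] {η : Measure Ω}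
    [IsFiniteMeasure η] {M : Ω → Matrix (Fin m) (Fin m) ℝ}
    (hM : ∀ i j, AEMeasurable (fun ω => M ω i j) η) (hpos : ∀ ω, (M ω).PosSemidef) :
    HasLogConvexTransform fun x => exp (-∫ ω, (1 - exp (-(x ⬝ᵥ M ω *ᵥ x))) ∂η) := by
  set G : (Fin m → ℝ) → ℝ := fun x => ∫ ω, exp (-(x ⬝ᵥ M ω *ᵥ x)) ∂η with hG
  have hmix : IsGaussianMixture G := ⟨Ω, _, η, M, inferInstance, hM, hpos, fun x => rfl⟩
  have hle : ∀ x ω, exp (-(x ⬝ᵥ M ω *ᵥ x)) ≤ 1 := fun x ω => by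
    rw [exp_le_one_iff, neg_nonpos]
    simpa using (hpos ω).dotProduct_mulVec_nonneg x
  have hi : ∀ x, Integrable (fun ω => exp (-(x ⬝ᵥ M ω *ᵥ x))) η := fun x => by
    refine (integrable_const (1 : ℝ)).mono' (AEMeasurable.aestronglyMeasurable
      (AEMeasurable.exp (AEMeasurable.neg ?_))) (ae_of_all _ fun ω => ?_)
    · simp only [dotProduct, Matrix.mulVec]
      exact Finset.aemeasurable_fun_sum _ fun i _ => aemeasurable_const.mul
        (Finset.aemeasurable_fun_sum _ fun j _ => (hM i j).mul aemeasurable_const)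
    · rw [norm_eq_abs, abs_exp]; exact hle x ω
  have hint : ∀ x, ∫ ω, (1 - exp (-(x ⬝ᵥ M ω *ᵥ x))) ∂η = η.real Set.univ - G x := fun x => by
    rw [integral_sub (integrable_const _) (hi x)]; simp [hG]
  have hGle : ∀ x, G x ≤ η.real Set.univ := fun x => by
    have : 0 ≤ ∫ ω, (1 - exp (-(x ⬝ᵥ M ω *ᵥ x))) ∂η :=
      integral_nonneg fun ω => sub_nonneg.2 (hle x ω)
    rw [hint x] at this
    linarith
  have hsum : ∀ x, HasSum (fun j : ℕ => G x ^ j / j.factorial) (exp (G x)) := fun x => by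
    rw [exp_eq_exp_ℝ]; exact NormedSpace.expSeries_div_hasSum_exp (G x)
  refine of_tendsto (C := 1) (F := fun k x => ∑ j ∈ Finset.range k,
    (exp (-η.real Set.univ) / j.factorial) * G x ^ j) (fun k => sum _ (fun j _ => by positivity)
      fun j _ ε hε => ⟨((hmix.pow j).weightedLogConvex hε 0).1, fun ξ =>
        ((hmix.pow j).weightedLogConvex hε ξ).2⟩) (fun k x => ?_) fun x => ?_
  · have h0 : ∀ j, 0 ≤ G x ^ j / j.factorial := fun j => by
      have := hmix.nonneg x; positivity
    have e : ∑ j ∈ Finset.range k, (exp (-η.real Set.univ) / j.factorial) * G x ^ j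
        = exp (-η.real Set.univ) * ∑ j ∈ Finset.range k, G x ^ j / j.factorial := by
      rw [Finset.mul_sum]; exact Finset.sum_congr rfl fun _ _ => by ring
    rw [e, abs_of_nonneg (mul_nonneg (exp_pos _).le (Finset.sum_nonneg fun j _ => h0 j))]
    calc _ ≤ exp (-η.real Set.univ) * exp (G x) :=
          mul_le_mul_of_nonneg_left (sum_le_hasSum _ (fun j _ => h0 j) (hsum x)) (exp_pos _).le
      _ ≤ 1 := by rw [← exp_add, exp_le_one_iff]; linarith [hGle x]
  · have := ((hsum x).tendsto_sum_nat).const_mul (exp (-η.real Set.univ))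
    rw [hint, neg_sub, sub_eq_neg_add, exp_add]
    refine this.congr fun k => ?_
    rw [Finset.mul_sum]; exact Finset.sum_congr rfl fun _ _ => by ring

lemma weightedLogConvex {m : ℕ} {f : (Fin m → ℝ) → ℝ} (hf : HasLogConvexTransform f)
    (hi : Integrable f) (ξ : Fin m → ℝ) :
    WeightedLogConvex fun t => cosTransform f (√t • ξ) := by
  have hpos : ∀ k : ℕ, (0 : ℝ) < 1 / (k + 1) := fun k => by positivity
  refine .of_tendsto (l := atTop) (fun k : ℕ => (hf _ (hpos k)).2 ξ) fun t _ =>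
    tendsto_cosTransform hi.norm (fun k => (hf _ (hpos k)).1) (fun k x => ?_) (fun x => ?_) _
  · rw [abs_mul, abs_exp]
    refine mul_le_of_le_one_left (abs_nonneg _) ?_
    rw [exp_le_one_iff, neg_nonpos]
    exact mul_nonneg (hpos k).le (by simpa using dotProduct_star_self_nonneg x)
  · have h := ((tendsto_one_div_add_atTop_nhds_zero_nat (𝕜 := ℝ)).mul_const (x ⬝ᵥ x)).neg.rexp
    simpa using h.mul_const (f x)

end HasLogConvexTransform

lemma integrableOn_one_sub_exp_mul_rpow {α : ℝ} (h0 : 0 < α) (h1 : α < 1) :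
    IntegrableOn (fun s : ℝ => (1 - exp (-s)) * s ^ (-1 - α)) (Set.Ioi 0) := by
  have hmeas : Measurable fun s : ℝ => (1 - exp (-s)) * s ^ (-1 - α) := by fun_prop
  rw [← Set.Ioc_union_Ioi_eq_Ioi zero_le_one]
  refine IntegrableOn.union ?_ ?_
  · have hi : IntegrableOn (fun s : ℝ => s ^ (-α)) (Set.Ioc 0 1) :=
      (intervalIntegral.intervalIntegrable_rpow' (by linarith)).1
    refine hi.mono' hmeas.aestronglyMeasurable ((ae_restrict_mem measurableSet_Ioc).mono ?_)
    rintro s ⟨hs, -⟩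
    have h2 : 0 ≤ 1 - exp (-s) := by rw [sub_nonneg, exp_le_one_iff]; linarith
    have h3 : 1 - exp (-s) ≤ s := by linarith [add_one_le_exp (-s)]
    rw [norm_eq_abs, abs_of_nonneg (by positivity)]
    refine (mul_le_mul_of_nonneg_right h3 (by positivity)).trans_eq ?_
    rw [← rpow_one_add' hs.le (by linarith)]
    ring_nf
  · refine (integrableOn_Ioi_rpow_of_lt (show -1 - α < -1 by linarith) one_pos).mono'
      hmeas.aestronglyMeasurable ((ae_restrict_mem measurableSet_Ioi).mono fun s hs => ?_)
    have hs : 0 < s := one_pos.trans hs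
    have h2 : 0 ≤ 1 - exp (-s) := by rw [sub_nonneg, exp_le_one_iff]; linarith
    rw [norm_eq_abs, abs_of_nonneg (by positivity)]
    exact mul_le_of_le_one_left (by positivity) (by linarith [exp_pos (-s)])

lemma integral_one_sub_exp_mul_rpow_pos {α : ℝ} (h0 : 0 < α) (h1 : α < 1) :
    0 < ∫ s in Set.Ioi (0 : ℝ), (1 - exp (-s)) * s ^ (-1 - α) := by
  have hp : ∀ s ∈ Set.Ioi (0 : ℝ), 0 < (1 - exp (-s)) * s ^ (-1 - α) := fun s hs => by
    have hs : 0 < s := hs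
    have : 0 < 1 - exp (-s) := by rw [sub_pos, exp_lt_one_iff]; linarith
    positivity
  rw [setIntegral_pos_iff_support_of_nonneg_ae
    ((ae_restrict_mem measurableSet_Ioi).mono fun s hs => (hp s hs).le)
    (integrableOn_one_sub_exp_mul_rpow h0 h1)]
  have hsub : Set.Ioi 0 ⊆ Function.support fun s : ℝ => (1 - exp (-s)) * s ^ (-1 - α) :=
    fun s hs => (hp s hs).ne'
  rw [Set.inter_eq_right.2 hsub]
  simp

lemma one_sub_exp_mul_rpow_eq {α r : ℝ} (hr : 0 < r) {s : ℝ} (hs : 0 < s) :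
    (1 - exp (-(s * r))) * s ^ (-1 - α)
      = r ^ (1 + α) * ((1 - exp (-(r * s))) * (r * s) ^ (-1 - α)) := by
  have : r ^ (1 + α) * r ^ (-1 - α) = 1 := by
    rw [← rpow_add hr]; simp
  rw [mul_rpow hr.le hs.le, mul_comm s r]
  linear_combination -((1 - exp (-(r * s))) * s ^ (-1 - α)) * this

lemma integrableOn_one_sub_exp_mul_mul_rpow {α r : ℝ} (h0 : 0 < α) (h1 : α < 1) (hr : 0 ≤ r) :
    IntegrableOn (fun s : ℝ => (1 - exp (-(s * r))) * s ^ (-1 - α)) (Set.Ioi 0) := by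
  rcases hr.eq_or_lt with rfl | hr
  · simp
  have h := (integrableOn_Ioi_comp_mul_left_iff
    (fun s : ℝ => (1 - exp (-s)) * s ^ (-1 - α)) 0 hr).2
    (by simpa using integrableOn_one_sub_exp_mul_rpow h0 h1)
  exact IntegrableOn.congr_fun (h.const_mul (r ^ (1 + α)))
    (fun s hs => (one_sub_exp_mul_rpow_eq hr hs).symm) measurableSet_Ioi

lemma integral_one_sub_exp_mul_mul_rpow {α r : ℝ} (h0 : 0 < α) (hr : 0 ≤ r) :
    ∫ s in Set.Ioi (0 : ℝ), (1 - exp (-(s * r))) * s ^ (-1 - α)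
      = r ^ α * ∫ s in Set.Ioi (0 : ℝ), (1 - exp (-s)) * s ^ (-1 - α) := by
  rcases hr.eq_or_lt with rfl | hr
  · simp [zero_rpow h0.ne']
  rw [setIntegral_congr_fun measurableSet_Ioi fun s hs => one_sub_exp_mul_rpow_eq hr hs,
    integral_const_mul, integral_comp_mul_left_Ioi (fun s => (1 - exp (-s)) * s ^ (-1 - α)) 0 hr,
    mul_zero, smul_eq_mul, ← mul_assoc, rpow_add hr, rpow_one]
  field_simp

/-- For `0 < α ≤ 1`, the function `r ↦ r ^ α` on `[0, ∞)` is a limit from below of functions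
`r ↦ ∫ (1 - exp (-s r)) dν(s)` with `ν` a finite measure. -/
lemma exists_measure_tendsto_rpow {α : ℝ} (h0 : 0 < α) (h1 : α ≤ 1) :
    ∃ ν : ℕ → Measure ℝ, (∀ k, IsFiniteMeasure (ν k)) ∧ ∀ r, 0 ≤ r →
      (∀ k, ∫ s, (1 - exp (-(|s| * r))) ∂ν k ≤ r ^ α) ∧
      Tendsto (fun k => ∫ s, (1 - exp (-(|s| * r))) ∂ν k) atTop (𝓝 (r ^ α)) := by
  rcases h1.eq_or_lt with rfl | h1
  · refine ⟨fun k => (ENNReal.ofReal (k + 1)) • Measure.dirac (1 / ((k : ℝ) + 1)),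
      fun k => Measure.smul_finite _ ENNReal.ofReal_ne_top, fun r hr => ?_⟩
    have hk : ∀ k : ℕ, (0 : ℝ) < k + 1 := fun k => by positivity
    have e : ∀ k : ℕ, ∫ s, (1 - exp (-(|s| * r)))
        ∂((ENNReal.ofReal (k + 1)) • Measure.dirac (1 / ((k : ℝ) + 1)))
        = (k + 1) * (1 - exp (-(1 / (k + 1) * r))) := fun k => by
      rw [integral_smul_measure, integral_dirac, ENNReal.toReal_ofReal (hk k).le, smul_eq_mul,
        abs_of_pos (one_div_pos.2 (hk k))]
    simp only [e, rpow_one]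
    have hle : ∀ k : ℕ, ((k : ℝ) + 1) * (1 - exp (-(1 / (k + 1) * r))) ≤ r := fun k => by
      have h := add_one_le_exp (-(1 / ((k : ℝ) + 1) * r))
      calc _ ≤ ((k : ℝ) + 1) * (1 / (k + 1) * r) :=
            mul_le_mul_of_nonneg_left (by linarith) (hk k).le
        _ = r := by field_simp
    refine ⟨hle, ?_⟩
    have hlim : Tendsto (fun k : ℕ => r / (1 + 1 / ((k : ℝ) + 1) * r)) atTop (𝓝 r) := by
      have h := ((tendsto_one_div_add_atTop_nhds_zero_nat (𝕜 := ℝ)).mul_const r).const_add 1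
      rw [zero_mul, add_zero] at h
      have h' := (tendsto_const_nhds (x := r)).div h one_ne_zero
      rw [div_one] at h'
      exact h'
    refine tendsto_of_tendsto_of_tendsto_of_le_of_le hlim tendsto_const_nhds (fun k => ?_) hle
    have hx : 0 ≤ 1 / ((k : ℝ) + 1) * r := by positivity
    set x := 1 / ((k : ℝ) + 1) * r with hx'
    have h2 : exp (-x) ≤ 1 / (1 + x) := by
      rw [exp_neg, ← one_div]
      exact one_div_le_one_div_of_le (by positivity) (by linarith [add_one_le_exp x])
    calc r / (1 + x) = ((k : ℝ) + 1) * (1 - 1 / (1 + x)) := by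
          have : ((k : ℝ) + 1) * x = r := by rw [hx']; field_simp
          rw [← this]; field_simp; ring
      _ ≤ _ := mul_le_mul_of_nonneg_left (by linarith) (hk k).le
  · set C := ∫ s in Set.Ioi (0 : ℝ), (1 - exp (-s)) * s ^ (-1 - α) with hC
    have hCpos : 0 < C := integral_one_sub_exp_mul_rpow_pos h0 h1
    have hk : ∀ k : ℕ, (0 : ℝ) < 1 / (k + 1) := fun k => by positivity
    refine ⟨fun k => (volume.restrict (Set.Ioi (1 / (k + 1) : ℝ))).withDensity
      fun s => ENNReal.ofReal (C⁻¹ * s ^ (-1 - α)), fun k => ?_, fun r hr => ?_⟩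
    · exact isFiniteMeasure_withDensity_ofReal
        ((integrableOn_Ioi_rpow_of_lt (by linarith) (hk k)).const_mul _).2
    have e : ∀ k : ℕ, ∫ s, (1 - exp (-(|s| * r)))
        ∂((volume.restrict (Set.Ioi (1 / (k + 1) : ℝ))).withDensity
          fun s => ENNReal.ofReal (C⁻¹ * s ^ (-1 - α)))
        = C⁻¹ * ∫ s in Set.Ioi (1 / (k + 1) : ℝ), (1 - exp (-(s * r))) * s ^ (-1 - α) := fun k => by
      rw [integral_withDensity_eq_integral_toReal_smul (by fun_prop)
        (ae_of_all _ fun _ => ENNReal.ofReal_lt_top), ← integral_const_mul]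
      refine setIntegral_congr_fun measurableSet_Ioi fun s hs => ?_
      have hs : 0 < s := (hk k).trans hs
      simp only [smul_eq_mul]
      rw [ENNReal.toReal_ofReal (by positivity), abs_of_pos hs]
      ring
    simp only [e]
    have hi := integrableOn_one_sub_exp_mul_mul_rpow h0 h1 hr
    have hI := integral_one_sub_exp_mul_mul_rpow h0 hr
    have hr' : r ^ α = C⁻¹ * ∫ s in Set.Ioi (0 : ℝ), (1 - exp (-(s * r))) * s ^ (-1 - α) := by
      rw [hI, ← hC]; field_simp
    rw [hr']
    refine ⟨fun k => mul_le_mul_of_nonneg_left (setIntegral_mono_set hi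
      ((ae_restrict_mem measurableSet_Ioi).mono fun s hs => ?_)
      (Set.Ioi_subset_Ioi (hk k).le).eventuallyLE) (by positivity), Tendsto.const_mul _ ?_⟩
    · have hs : 0 < s := hs
      have : 0 ≤ 1 - exp (-(s * r)) := by
        rw [sub_nonneg, exp_le_one_iff, neg_nonpos]; positivity
      simp only [Pi.zero_apply]
      positivity
    · have hU : ⋃ k : ℕ, Set.Ioi (1 / (k + 1) : ℝ) = Set.Ioi 0 := by
        ext s
        simp only [Set.mem_iUnion, Set.mem_Ioi]
        exact ⟨fun ⟨k, h⟩ => (hk k).trans h, fun h => exists_nat_one_div_lt h⟩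
      rw [← hU] at hi ⊢
      refine tendsto_setIntegral_of_monotone (fun k => measurableSet_Ioi) (fun j k hjk => ?_) hi
      exact Set.Ioi_subset_Ioi (one_div_le_one_div_of_le (by positivity) (by gcongr))

lemma apply_eq_dotProduct_single {Ω : Type} {m : ℕ} (T : (Fin m → ℝ) →ₗ[ℝ] (Ω → ℝ)) (x : Fin m → ℝ) (ω : Ω) :
    T x ω = (fun i => T (Pi.single i 1) ω) ⬝ᵥ x := by
  conv_lhs => rw [← Finset.univ_sum_single x]
  simp only [map_sum, Finset.sum_apply, dotProduct]
  refine Finset.sum_congr rfl fun i _ => ?_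
  rw [show Pi.single i (x i) = x i • (Pi.single i 1 : Fin m → ℝ) by
    rw [← Pi.single_smul, smul_eq_mul, mul_one], map_smul, Pi.smul_apply, smul_eq_mul, mul_comm]

section Embedding

variable {Ω : Type} [MeasurableSpace Ω] {μ : Measure Ω} {m : ℕ} {p : ℝ}
  {T : (Fin m → ℝ) →ₗ[ℝ] (Ω → ℝ)}

lemma aemeasurable_mul_of_integrable_rpow (hp0 : 0 < p)
    (hT : ∀ x, Integrable (fun ω => |T x ω| ^ p) μ) (x y : Fin m → ℝ) :
    AEMeasurable (fun ω => T x ω * T y ω) μ := by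
  have hsq : ∀ z, AEMeasurable (fun ω => T z ω ^ 2) μ := fun z => by
    refine ((hT z).aemeasurable.pow_const (2 / p)).congr (ae_of_all _ fun ω => ?_)
    simp only
    rw [← rpow_mul (abs_nonneg _), mul_div_cancel₀ _ hp0.ne', rpow_two, sq_abs]
  refine (((hsq (x + y)).sub (hsq (x - y))).div_const 4).congr (ae_of_all _ fun ω => ?_)
  simp only [Pi.sub_apply, map_add, map_sub, Pi.add_apply]
  ring

lemma hasLogConvexTransform_exp_neg_integral_rpow (hp0 : 0 < p) (hp2 : p ≤ 2)
    (hT : ∀ x, Integrable (fun ω => |T x ω| ^ p) μ) :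
    HasLogConvexTransform fun x => exp (-∫ ω, |T x ω| ^ p ∂μ) := by
  obtain ⟨ν, hν, hlim⟩ := exists_measure_tendsto_rpow (α := p / 2) (by positivity) (by linarith)
  set w : Ω → ℝ := fun ω => ∑ j, |T (Pi.single j 1) ω| ^ p with hw
  have hwi : Integrable w μ := integrable_finsetSum _ fun j _ => hT _
  set A : ℕ → Set Ω := fun k => {ω | (1 / (k + 1) : ℝ) < w ω} with hA
  have hAm : ∀ k, NullMeasurableSet (A k) μ := fun k =>
    nullMeasurableSet_lt aemeasurable_const hwi.aemeasurable
  have hAf : ∀ k, IsFiniteMeasure (μ.restrict (A k)) := fun k =>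
    isFiniteMeasure_restrict.2 (hwi.measure_gt_lt_top (by positivity)).ne
  set t : Ω → Fin m → ℝ := fun ω i => T (Pi.single i 1) ω with ht
  set M : Ω × ℝ → Matrix (Fin m) (Fin m) ℝ :=
    fun z => |z.2| • Matrix.vecMulVec (t z.1) (star (t z.1)) with hM
  have hMq : ∀ z x, x ⬝ᵥ M z *ᵥ x = |z.2| * (T x z.1) ^ 2 := fun z x => by
    rw [apply_eq_dotProduct_single T x, hM, Matrix.smul_mulVec, Matrix.vecMulVec_mulVec,
      dotProduct_smul, star_trivial, smul_eq_mul, op_smul_eq_smul, dotProduct_smul,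
      dotProduct_comm x, smul_eq_mul, sq]
  have hMpos : ∀ z, (M z).PosSemidef := fun z =>
    (Matrix.posSemidef_vecMulVec_self_star (t z.1)).smul (abs_nonneg _)
  have hMm : ∀ k i j, AEMeasurable (fun z => M z i j) ((μ.restrict (A k)).prod (ν k)) :=
    fun k i j => by
      have h := ((aemeasurable_mul_of_integrable_rpow hp0 hT (Pi.single i 1)
        (Pi.single j 1)).restrict (s := A k)).comp_quasiMeasurePreserving
          (Measure.quasiMeasurePreserving_fst (ν := ν k))
      refine (AEMeasurable.mul (f := fun z : Ω × ℝ => |z.2|)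
        (measurable_snd.abs).aemeasurable h).congr (ae_of_all _ fun z => ?_)
      simp [hM, Matrix.vecMulVec, ht]
  have hTm : ∀ x, AEMeasurable (fun ω => T x ω ^ 2) μ := fun x =>
    (aemeasurable_mul_of_integrable_rpow hp0 hT x x).congr (ae_of_all _ fun ω => (sq _).symm)
  set φ : ℕ → ℝ → ℝ := fun k r => ∫ s, (1 - exp (-(|s| * r))) ∂ν k with hφ
  have hnn : ∀ (s : ℝ) (r : ℝ), 0 ≤ r → 0 ≤ 1 - exp (-(|s| * r)) := fun s r hr => by
    rw [sub_nonneg, exp_le_one_iff, neg_nonpos]; positivity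
  have hint : ∀ k x, Integrable (fun z : Ω × ℝ => 1 - exp (-(|z.2| * T x z.1 ^ 2)))
      ((μ.restrict (A k)).prod (ν k)) := fun k x => by
    have h := (hTm x).restrict (s := A k) |>.comp_quasiMeasurePreserving
          (Measure.quasiMeasurePreserving_fst (ν := ν k))
    have h' := AEMeasurable.mul (f := fun z : Ω × ℝ => |z.2|) (measurable_snd.abs).aemeasurable h
    refine Integrable.of_bound (h'.neg.exp.const_sub 1).aestronglyMeasurable 1
      (ae_of_all _ fun z => ?_)
    have h2 := hnn z.2 _ (sq_nonneg (T x z.1))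
    rw [norm_eq_abs, abs_of_nonneg h2]
    linarith [exp_pos (-(|z.2| * T x z.1 ^ 2))]
  have hIk : ∀ k x, ∫ z, (1 - exp (-(x ⬝ᵥ M z *ᵥ x))) ∂((μ.restrict (A k)).prod (ν k))
      = ∫ ω, (A k).indicator (fun ω => φ k (T x ω ^ 2)) ω ∂μ := fun k x => by
    simp only [hMq]
    rw [integral_prod _ (hint k x), integral_indicator₀ (hAm k)]
  refine HasLogConvexTransform.of_tendsto (C := 1)
    (fun k => HasLogConvexTransform.exp_neg_integral (hMm k) hMpos) (fun k x => ?_) (fun x => ?_)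
  · rw [abs_exp, exp_le_one_iff, neg_nonpos]
    refine integral_nonneg fun z => ?_
    rw [hMq]
    exact hnn _ _ (sq_nonneg _)
  · refine (continuous_exp.tendsto _).comp (Tendsto.neg ?_)
    simp only [hIk]
    have hr : ∀ ω, (T x ω ^ 2) ^ (p / 2) = |T x ω| ^ p := fun ω => by
      rw [← sq_abs, ← rpow_two, ← rpow_mul (abs_nonneg _)]
      congr 1; ring
    refine tendsto_integral_of_dominated_convergence (fun ω => |T x ω| ^ p) (fun k => ?_) (hT x)
      (fun k => ae_of_all _ fun ω => ?_) (ae_of_all _ fun ω => ?_)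
    · exact (aestronglyMeasurable_indicator_iff₀ (hAm k)).2
        (hint k x).integral_prod_left.aestronglyMeasurable
    · refine (norm_indicator_le_norm_self _ _).trans ?_
      rw [norm_eq_abs, abs_of_nonneg (integral_nonneg fun s => hnn s _ (sq_nonneg _)), ← hr]
      exact (hlim _ (sq_nonneg _)).1 k
    · by_cases h0 : T x ω = 0
      · have : ∀ k, (A k).indicator (fun ω => φ k (T x ω ^ 2)) ω = 0 := fun k => by
          simp [Set.indicator, hφ, h0]
        simp [this, h0, zero_rpow hp0.ne']
      · have hpos : 0 < w ω := by
          by_contra hcon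
          have hz : ∀ j, T (Pi.single j 1) ω = 0 := fun j => by
            have h1 := Finset.single_le_sum (f := fun j => |T (Pi.single j 1) ω| ^ p)
              (fun j _ => by positivity) (Finset.mem_univ j)
            have h2 : |T (Pi.single j 1) ω| ^ p = 0 :=
              le_antisymm (h1.trans (not_lt.1 hcon)) (by positivity)
            exact abs_eq_zero.1 ((rpow_eq_zero (abs_nonneg _) hp0.ne').1 h2)
          exact h0 (by rw [apply_eq_dotProduct_single]; simp [dotProduct, hz])
        rw [← hr]
        refine (hlim _ (sq_nonneg (T x ω))).2.congr' ?_
        obtain ⟨k₀, hk₀⟩ := exists_nat_one_div_lt hpos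
        filter_upwards [eventually_ge_atTop k₀] with k hk
        rw [Set.indicator_of_mem]
        exact lt_of_le_of_lt (one_div_le_one_div_of_le (by positivity) (by gcongr)) hk₀

lemma continuous_integral_rpow (hp0 : 0 < p) (hT : ∀ x, Integrable (fun ω => |T x ω| ^ p) μ) :
    Continuous fun x => ∫ ω, |T x ω| ^ p ∂μ := by
  have hb : ∀ x ω, |T x ω| ^ p ≤ (‖x‖ * m) ^ p * ∑ j, |T (Pi.single j 1) ω| ^ p := fun x ω => by
    have hs : ∀ j, |T (Pi.single j 1) ω| ^ p ≤ ∑ j, |T (Pi.single j 1) ω| ^ p := fun j =>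
      Finset.single_le_sum (f := fun j => |T (Pi.single j 1) ω| ^ p)
        (fun j _ => by positivity) (Finset.mem_univ j)
    set S := ∑ j, |T (Pi.single j 1) ω| ^ p with hS
    have hS0 : 0 ≤ S := Finset.sum_nonneg fun j _ => by positivity
    have hj : ∀ j, |T (Pi.single j 1) ω| ≤ S ^ (1 / p) := fun j => by
      have h := rpow_le_rpow (by positivity) (hs j) (by positivity : 0 ≤ 1 / p)
      rwa [← rpow_mul (abs_nonneg _), mul_one_div_cancel hp0.ne', rpow_one] at h
    have h1 : |T x ω| ≤ ‖x‖ * m * S ^ (1 / p) := by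
      rw [apply_eq_dotProduct_single]
      calc _ ≤ ∑ j, |T (Pi.single j 1) ω * x j| := Finset.abs_sum_le_sum_abs _ _
        _ ≤ ∑ j : Fin m, S ^ (1 / p) * ‖x‖ := Finset.sum_le_sum fun j _ => by
            rw [abs_mul]
            exact mul_le_mul (hj j) (norm_le_pi_norm x j) (abs_nonneg _) (by positivity)
        _ = _ := by
            rw [Finset.sum_const, Finset.card_univ, Fintype.card_fin, nsmul_eq_mul]; ring
    refine (rpow_le_rpow (abs_nonneg _) h1 hp0.le).trans_eq ?_
    rw [mul_rpow (by positivity) (by positivity), ← rpow_mul hS0, one_div_mul_cancel hp0.ne',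
      rpow_one]
  refine continuous_iff_continuousAt.2 fun x₀ => continuousAt_of_dominated
    (bound := fun ω => ((‖x₀‖ + 1) * m) ^ p * ∑ j, |T (Pi.single j 1) ω| ^ p)
    (Eventually.of_forall fun x => (hT x).aestronglyMeasurable) ?_
    ((integrable_finsetSum _ fun j _ => hT _).const_mul _) (ae_of_all _ fun ω => ?_)
  · filter_upwards [(continuous_norm.tendsto x₀).eventually_lt_const (lt_add_one _)] with x hx
    refine ae_of_all _ fun ω => ?_
    rw [norm_eq_abs, abs_of_nonneg (by positivity)]
    refine (hb x ω).trans (mul_le_mul_of_nonneg_right ?_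
      (Finset.sum_nonneg fun j _ => by positivity))
    exact rpow_le_rpow (by positivity) (by gcongr) hp0.le
  · have : Continuous fun x => T x ω :=
      LinearMap.continuous_of_finiteDimensional (LinearMap.proj ω ∘ₗ T)
    exact (this.abs.rpow_const fun _ => .inr hp0.le).continuousAt
end Embedding

namespace EmbedsIntoLp
variable {m : ℕ} {p : ℝ} {N : (Fin m → ℝ) → ℝ}

lemma hasLogConvexTransform (h : EmbedsIntoLp m p N) (hp0 : 0 < p) (hp2 : p ≤ 2) :
    HasLogConvexTransform fun x => exp (-(N x ^ p)) := by
  obtain ⟨Ω, _, μ, T, hT, hN⟩ := h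
  have e : ∀ x, N x ^ p = ∫ ω, |T x ω| ^ p ∂μ := fun x => by
    rw [← hN x, ← rpow_mul (integral_nonneg fun ω => by positivity), one_div_mul_cancel hp0.ne',
      rpow_one]
  simp only [e]
  exact hasLogConvexTransform_exp_neg_integral_rpow hp0 hp2 hT

lemma continuous_rpow (h : EmbedsIntoLp m p N) (hp0 : 0 < p) : Continuous fun x => N x ^ p := by
  obtain ⟨Ω, _, μ, T, hT, hN⟩ := h
  have e : ∀ x, N x ^ p = ∫ ω, |T x ω| ^ p ∂μ := fun x => by
    rw [← hN x, ← rpow_mul (integral_nonneg fun ω => by positivity), one_div_mul_cancel hp0.ne',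
      rpow_one]
  simp only [e]
  exact continuous_integral_rpow hp0 hT
end EmbedsIntoLp

/-- A continuous function on a vector space which is even and positively homogeneous of
degree `p`, and positive away from the origin. -/
structure IsPosHomogeneous {E : Type*} [NormedAddCommGroup E] [NormedSpace ℝ E] (p : ℝ)
    (h : E → ℝ) : Prop where
  continuous : Continuous h
  pos : ∀ x, x ≠ 0 → 0 < h x
  smul : ∀ (a : ℝ) x, h (a • x) = |a| ^ p * h x

namespace IsPosHomogeneous

variable {E F : Type*} [NormedAddCommGroup E] [NormedSpace ℝ E] [NormedAddCommGroup F]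
  [NormedSpace ℝ F] {p : ℝ} {h : E → ℝ}

lemma zero (hh : IsPosHomogeneous p h) (hp : 0 < p) : h 0 = 0 := by
  simpa [zero_rpow hp.ne'] using hh.smul 0 0

lemma nonneg (hh : IsPosHomogeneous p h) (hp : 0 < p) (x : E) : 0 ≤ h x := by
  rcases eq_or_ne x 0 with rfl | hx
  · exact (hh.zero hp).ge
  · exact (hh.pos x hx).le

lemma comp_linearMap [FiniteDimensional ℝ F] (hh : IsPosHomogeneous p h) {L : F →ₗ[ℝ] E}
    (hL : Function.Injective L) : IsPosHomogeneous p (h ∘ L) where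
  continuous := hh.continuous.comp L.continuous_of_finiteDimensional
  pos x hx := hh.pos _ ((map_ne_zero_iff L hL).2 hx)
  smul a x := by simp [hh.smul]

lemma exists_mul_rpow_le [FiniteDimensional ℝ E] (hh : IsPosHomogeneous p h) (hp : 0 < p) :
    ∃ c : ℝ, 0 < c ∧ ∀ x, c * ‖x‖ ^ p ≤ h x := by
  rcases subsingleton_or_nontrivial E with hE | hE
  · refine ⟨1, one_pos, fun x => ?_⟩
    rw [Subsingleton.elim x 0, hh.zero hp]
    simp [zero_rpow hp.ne']
  obtain ⟨z, hz, hmin⟩ := (isCompact_sphere (0 : E) 1).exists_isMinOn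
    (NormedSpace.sphere_nonempty.2 zero_le_one) hh.continuous.continuousOn
  refine ⟨h z, hh.pos z (ne_zero_of_mem_unit_sphere ⟨z, hz⟩), fun x => ?_⟩
  rcases eq_or_ne x 0 with rfl | hx
  · rw [hh.zero hp]; simp [zero_rpow hp.ne']
  have hx' : 0 < ‖x‖ := norm_pos_iff.2 hx
  have h1 : h z ≤ h (‖x‖⁻¹ • x) := hmin (by
    rw [mem_sphere_zero_iff_norm, norm_smul, norm_inv, norm_norm, inv_mul_cancel₀ hx'.ne'])
  have h2 : h x = ‖x‖ ^ p * h (‖x‖⁻¹ • x) := by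
    rw [hh.smul, ← mul_assoc, abs_of_pos (by positivity), inv_rpow hx'.le,
      mul_inv_cancel₀ (by positivity), one_mul]
  rw [h2, mul_comm]
  gcongr

variable [FiniteDimensional ℝ E] [MeasurableSpace E] (μ : Measure E)
  [μ.IsAddHaarMeasure]

lemma measure_sublevel_one_lt_top (hh : IsPosHomogeneous p h) (hp : 0 < p) :
    μ {x | h x ≤ 1} < ∞ := by
  obtain ⟨c, hc, hle⟩ := hh.exists_mul_rpow_le hp
  refine (measure_mono (t := Metric.closedBall 0 ((1 / c) ^ (1 / p))) fun x hx => ?_).trans_lt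
    measure_closedBall_lt_top
  have h1 : ‖x‖ ^ p ≤ 1 / c := by
    rw [le_div_iff₀ hc, mul_comm]; exact (hle x).trans hx
  have h2 := rpow_le_rpow (by positivity) h1 (by positivity : 0 ≤ 1 / p)
  rwa [← rpow_mul (norm_nonneg _), mul_one_div_cancel hp.ne', rpow_one,
    ← mem_closedBall_zero_iff] at h2

variable [BorelSpace E]

lemma measure_sublevel (hh : IsPosHomogeneous p h) (hp : 0 < p) {u : ℝ} (hu : 0 < u) :
    μ {x | h x ≤ u} = ENNReal.ofReal (u ^ (Module.finrank ℝ E / p)) * μ {x | h x ≤ 1} := by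
  have hr : 0 < u ^ (1 / p) := by positivity
  have e : {x | h x ≤ u} = (fun x => (u ^ (1 / p))⁻¹ • x) ⁻¹' {x | h x ≤ 1} := by
    ext x
    simp only [Set.mem_ofPred_eq, Set.mem_preimage, hh.smul]
    rw [abs_of_pos (by positivity), inv_rpow hr.le, ← rpow_mul hu.le,
      one_div_mul_cancel hp.ne', rpow_one, inv_mul_le_iff₀ hu, mul_one]
  rw [e, Measure.addHaar_preimage_smul _ (by positivity), inv_pow, inv_inv,
    abs_of_pos (by positivity), ← rpow_natCast, ← rpow_mul hu.le]
  congr 3; ring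

lemma lintegral_exp_neg (hh : IsPosHomogeneous p h) (hp : 0 < p) :
    ∫⁻ x, ENNReal.ofReal (exp (-h x)) ∂μ
      = ENNReal.ofReal (Gamma (Module.finrank ℝ E / p + 1)) * μ {x | h x ≤ 1} := by
  have h1 : ∀ x, ENNReal.ofReal (exp (-h x)) = ∫⁻ u in Set.Ioi (0 : ℝ),
      {z : E × ℝ | h z.1 ≤ z.2}.indicator (fun z => ENNReal.ofReal (exp (-z.2))) (x, u) := by
    intro x
    have h0 := hh.nonneg hp x
    rw [← integral_exp_neg_Ioi, ofReal_integral_eq_lintegral_ofReal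
      (integrableOn_exp_neg_Ioi _) (ae_of_all _ fun _ => (exp_pos _).le)]
    have e : ∀ u, {z : E × ℝ | h z.1 ≤ z.2}.indicator (fun z => ENNReal.ofReal (exp (-z.2))) (x, u)
        = (Set.Ici (h x)).indicator (fun u => ENNReal.ofReal (exp (-u))) u := fun u => by
      simp [Set.indicator]
    simp only [e]
    rw [lintegral_indicator measurableSet_Ici, Measure.restrict_restrict measurableSet_Ici]
    have hae : (Set.Ici (h x) ∩ Set.Ioi 0 : Set ℝ) =ᵐ[volume] (Set.Ici (h x) ∩ Set.Ici 0 : Set ℝ) :=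
      (ae_eq_refl _).inter Ioi_ae_eq_Ici
    rw [Measure.restrict_congr_set hae, Set.inter_eq_left.2 (Set.Ici_subset_Ici.2 h0),
      Measure.restrict_congr_set Ioi_ae_eq_Ici]
  have hms : MeasurableSet {z : E × ℝ | h z.1 ≤ z.2} :=
    measurableSet_le (hh.continuous.measurable.comp measurable_fst) measurable_snd
  have hm : Measurable ({z : E × ℝ | h z.1 ≤ z.2}.indicator
      fun z => ENNReal.ofReal (exp (-z.2))) :=
    Measurable.indicator (by fun_prop) hms
  have h2 : ∀ u ∈ Set.Ioi (0 : ℝ), ∫⁻ x, {z : E × ℝ | h z.1 ≤ z.2}.indicator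
      (fun z => ENNReal.ofReal (exp (-z.2))) (x, u) ∂μ
      = ENNReal.ofReal (exp (-u) * u ^ (Module.finrank ℝ E / p)) * μ {x | h x ≤ 1} := by
    intro u hu
    have e : ∀ x, {z : E × ℝ | h z.1 ≤ z.2}.indicator (fun z => ENNReal.ofReal (exp (-z.2))) (x, u)
        = {x | h x ≤ u}.indicator (fun _ => ENNReal.ofReal (exp (-u))) x := fun x => by
      simp [Set.indicator]
    simp only [e]
    rw [lintegral_indicator_const (measurableSet_le hh.continuous.measurable measurable_const),
      hh.measure_sublevel μ hp hu, ← mul_assoc, ← ENNReal.ofReal_mul (exp_pos _).le]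
  have h3 := setLIntegral_congr_fun (μ := volume) measurableSet_Ioi h2
  simp only [h1]
  rw [lintegral_lintegral_swap (f := fun x u => {z : E × ℝ | h z.1 ≤ z.2}.indicator
    (fun z => ENNReal.ofReal (exp (-z.2))) (x, u)) hm.aemeasurable, h3,
    lintegral_mul_const _ (by fun_prop), Gamma_eq_integral (by positivity),
    ofReal_integral_eq_lintegral_ofReal (GammaIntegral_convergent (by positivity))
    ((ae_restrict_mem measurableSet_Ioi).mono fun u hu => ?_)]
  · simp
  · have hu : 0 < u := hu
    simp only [Pi.zero_apply]; positivity

lemma integrable_exp_neg (hh : IsPosHomogeneous p h) (hp : 0 < p) :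
    Integrable (fun x => exp (-h x)) μ := by
  refine ⟨(hh.continuous.neg.rexp).aestronglyMeasurable, ?_⟩
  rw [hasFiniteIntegral_iff_ofReal (ae_of_all _ fun _ => (exp_pos _).le),
    hh.lintegral_exp_neg μ hp]
  exact ENNReal.mul_lt_top ENNReal.ofReal_lt_top (hh.measure_sublevel_one_lt_top μ hp)

lemma integral_exp_neg (hh : IsPosHomogeneous p h) (hp : 0 < p) :
    ∫ x, exp (-h x) ∂μ
      = Gamma (Module.finrank ℝ E / p + 1) * (μ {x | h x ≤ 1}).toReal := by
  rw [integral_eq_lintegral_of_nonneg_ae (ae_of_all _ fun _ => (exp_pos _).le)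
    (hh.integrable_exp_neg μ hp).aestronglyMeasurable, hh.lintegral_exp_neg μ hp, ENNReal.toReal_mul,
    ENNReal.toReal_ofReal (Gamma_pos_of_pos (by positivity)).le]

lemma measure_le_of_integral_exp_neg_le [FiniteDimensional ℝ F] [MeasurableSpace F] [BorelSpace F]
    {ν : Measure F} [ν.IsAddHaarMeasure] {g : F → ℝ} (hh : IsPosHomogeneous p h)
    (hg : IsPosHomogeneous p g) (hp : 0 < p) (hd : Module.finrank ℝ E = Module.finrank ℝ F)
    (hle : ∫ x, exp (-h x) ∂μ ≤ ∫ x, exp (-g x) ∂ν) :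
    μ {x | h x ≤ 1} ≤ ν {x | g x ≤ 1} := by
  rw [hh.integral_exp_neg μ hp, hg.integral_exp_neg ν hp, hd] at hle
  exact (ENNReal.toReal_le_toReal (hh.measure_sublevel_one_lt_top μ hp).ne
    (hg.measure_sublevel_one_lt_top ν hp).ne).1
    (le_of_mul_le_mul_left hle (Gamma_pos_of_pos (by positivity)))

end IsPosHomogeneous

lemma sq_norm_le_dotProduct_self {ι : Type*} [Fintype ι] (x : ι → ℝ) : ‖x‖ ^ 2 ≤ x ⬝ᵥ x := by
  have h0 : 0 ≤ x ⬝ᵥ x := Finset.sum_nonneg fun i _ => mul_self_nonneg _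
  rw [← le_sqrt (norm_nonneg _) h0]
  refine (pi_norm_le_iff_of_nonneg (sqrt_nonneg _)).2 fun i => ?_
  rw [norm_eq_abs]
  refine abs_le_sqrt ?_
  rw [sq]
  exact Finset.single_le_sum (f := fun i => x i * x i) (fun j _ => mul_self_nonneg _)
    (Finset.mem_univ i)

lemma tendsto_norm_pow_mul_exp_neg_dotProduct (m : ℕ) (C : ℝ) :
    Tendsto (fun x : Fin m → ℝ => ‖x‖ ^ m * (C * exp (-(x ⬝ᵥ x)))) (Bornology.cobounded _)
      (𝓝 0) := by
  have h1 : Tendsto (fun x : Fin m → ℝ => |C| * (‖x‖ ^ m * exp (-‖x‖))) (Bornology.cobounded _)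
      (𝓝 0) := by
    simpa using ((tendsto_pow_mul_exp_neg_atTop_nhds_zero m).comp
      tendsto_norm_cobounded_atTop).const_mul |C|
  refine squeeze_zero_norm' ?_ h1
  filter_upwards [tendsto_norm_cobounded_atTop.eventually_ge_atTop (1 : ℝ)] with x hx
  rw [norm_eq_abs, abs_mul, abs_mul, abs_exp, abs_of_nonneg (by positivity : 0 ≤ ‖x‖ ^ m)]
  have h2 : exp (-(x ⬝ᵥ x)) ≤ exp (-‖x‖) := exp_le_exp.2 (by
    nlinarith [sq_norm_le_dotProduct_self x])
  calc ‖x‖ ^ m * (|C| * exp (-(x ⬝ᵥ x))) ≤ ‖x‖ ^ m * (|C| * exp (-‖x‖)) := by gcongr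
    _ = _ := by ring

lemma integral_gaussian_mul_cosTransform {m : ℕ} {G : (Fin m → ℝ) → ℝ} (hG : Integrable G) {b : ℝ}
    (hb : 0 < b) : ∫ ξ, exp (-(b * (ξ ⬝ᵥ ξ))) * cosTransform G ξ
      = ∫ v, ((π / b) ^ (m / 2 : ℝ) * exp (-((v ⬝ᵥ v) / (4 * b)))) * G v := by
  have hc : Continuous fun z : (Fin m → ℝ) × (Fin m → ℝ) => cos (z.2 ⬝ᵥ z.1) := by
    simp only [dotProduct]; fun_prop
  have hi := ((integrable_exp_neg_mul_dotProduct (m := m) hb).mul_prod hG).mul_bdd (c := 1)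
    hc.aestronglyMeasurable (ae_of_all _ fun _ => abs_cos_le_one _)
  simp only [cosTransform, ← integral_const_mul]
  rw [integral_integral_swap (f := fun ξ v => exp (-(b * (ξ ⬝ᵥ ξ))) * (G v * cos (v ⬝ᵥ ξ)))
    (hi.congr (ae_of_all _ fun z => by simp only [Function.uncurry]; ring))]
  refine integral_congr_ae (ae_of_all _ fun v => ?_)
  simp only
  rw [← integral_exp_neg_mul_dotProduct_mul_cos hb, ← integral_mul_const]
  refine integral_congr_ae (ae_of_all _ fun ξ => ?_)
  simp only [dotProduct_comm v ξ]
  ring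

/-- Fourier inversion at the origin with Gaussian summation. -/
lemma tendsto_integral_gaussian_mul_cosTransform {m : ℕ} {G : (Fin m → ℝ) → ℝ}
    (hG : Integrable G) (hG0 : ContinuousAt G 0) :
    Tendsto (fun c : ℝ => ∫ ξ, exp (-(1 / (4 * c ^ 2) * (ξ ⬝ᵥ ξ))) * cosTransform G ξ) atTop
      (𝓝 ((2 * π) ^ m * G 0)) := by
  have hφ1 : ∫ x : Fin m → ℝ, (π ^ (m / 2 : ℝ))⁻¹ * exp (-(x ⬝ᵥ x)) = 1 := by
    have h := integral_exp_neg_mul_dotProduct_mul_cos (m := m) one_pos 0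
    simp only [one_mul, dotProduct_zero, cos_zero, mul_one, div_one, zero_div, neg_zero,
      exp_zero] at h
    rw [integral_const_mul, h, inv_mul_cancel₀ (by positivity)]
  have h := (tendsto_integral_comp_smul_smul_of_integrable (μ := (volume : Measure (Fin m → ℝ)))
    (φ := fun x => (π ^ (m / 2 : ℝ))⁻¹ * exp (-(x ⬝ᵥ x))) (fun x => by positivity) hφ1
    (by simpa using tendsto_norm_pow_mul_exp_neg_dotProduct m (π ^ (m / 2 : ℝ))⁻¹) hG
    hG0).const_mul ((2 * π) ^ m)
  refine h.congr' ?_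
  filter_upwards [eventually_gt_atTop 0] with c hc
  rw [integral_gaussian_mul_cosTransform hG (by positivity), ← integral_const_mul]
  refine integral_congr_ae (ae_of_all _ fun v => ?_)
  have e1 : (π / (1 / (4 * c ^ 2))) ^ (m / 2 : ℝ) = (2 * π) ^ m * c ^ m * (π ^ (m / 2 : ℝ))⁻¹ := by
    have : π / (1 / (4 * c ^ 2)) = (2 * c) ^ 2 * π := by field_simp; ring
    rw [this, mul_rpow (by positivity) pi_pos.le, ← rpow_natCast (2 * c), ← rpow_mul (by positivity)]
    have h2 : ((2 : ℕ) : ℝ) * (m / 2) = (m : ℕ) := by push_cast; ring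
    have h3 : π ^ m = π ^ (m / 2 : ℝ) * π ^ (m / 2 : ℝ) := by
      rw [← rpow_add pi_pos, add_halves, rpow_natCast]
    rw [h2, rpow_natCast, mul_pow, mul_pow, h3]
    field_simp
  have e2 : (v ⬝ᵥ v) / (4 * (1 / (4 * c ^ 2))) = (c • v) ⬝ᵥ (c • v) := by
    simp only [smul_dotProduct, dotProduct_smul, smul_eq_mul]; field_simp
  simp only [e1, e2, smul_eq_mul, Module.finrank_fin_fun]
  ring

lemma measurePreserving_of_sum_sq_eq_s1 {κ ι : Type*} [Fintype κ] [Fintype ι]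
    {g : (κ → ℝ) →ₗ[ℝ] (ι → ℝ)} (hg : ∀ x, ∑ i, g x i ^ 2 = ∑ i, x i ^ 2)
    (hc : Fintype.card κ = Fintype.card ι) : MeasurePreserving g := by
  let G : EuclideanSpace ℝ κ →ₗᵢ[ℝ] EuclideanSpace ℝ ι :=
    { toLinearMap := (WithLp.linearEquiv 2 ℝ (ι → ℝ)).symm.toLinearMap ∘ₗ g ∘ₗ
        (WithLp.linearEquiv 2 ℝ (κ → ℝ)).toLinearMap
      norm_map' := fun x => by
        rw [EuclideanSpace.norm_eq, EuclideanSpace.norm_eq]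
        congr 1
        simpa using hg (WithLp.ofLp x) }
  have h := (PiLp.volume_preserving_ofLp ι).comp
    (((G.toLinearIsometryEquiv (by simp [hc])).measurePreserving).comp
      (PiLp.volume_preserving_toLp κ))
  exact h

lemma measurePreserving_uncurry (ι κ : Type*) [Fintype ι] [Fintype κ] :
    MeasurePreserving (MeasurableEquiv.curry ι κ ℝ).symm := by
  refine ⟨MeasurableEquiv.measurable _, (Measure.pi_eq fun s hs => ?_).symm⟩
  rw [MeasurableEquiv.map_apply]
  have e : (MeasurableEquiv.curry ι κ ℝ).symm ⁻¹' Set.univ.pi s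
      = Set.univ.pi fun i => Set.univ.pi fun j => s (i, j) := by
    ext x
    simp [Set.mem_pi, MeasurableEquiv.curry, Function.uncurry]
  rw [e, volume_pi_pi]
  simp only [volume_pi_pi]
  rw [Fintype.prod_prod_type]

lemma integral_prod_blocks {n m : ℕ} (F : Fin n → (Fin m → ℝ) → ℂ) :
    ∫ x : Fin n × Fin m → ℝ, ∏ i, F i (fun j => x (i, j)) = ∏ i, ∫ x, F i x := by
  rw [← (measurePreserving_uncurry (Fin n) (Fin m)).integral_comp',
    ← integral_fintype_prod_volume_eq_prod]
  rfl

lemma integral_mul_cexp_dotProduct {m : ℕ} {f : (Fin m → ℝ) → ℝ} (hf : Integrable f)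
    (heven : ∀ x, f (-x) = f x) (ξ : Fin m → ℝ) :
    ∫ x, (f x : ℂ) * Complex.exp ((x ⬝ᵥ ξ : ℝ) * Complex.I) = cosTransform f ξ := by
  have hs : Integrable fun x => f x * sin (x ⬝ᵥ ξ) :=
    hf.mul_bdd (c := 1) (Continuous.aestronglyMeasurable (by simp only [dotProduct]; fun_prop))
      (ae_of_all _ fun _ => abs_sin_le_one _)
  have hs0 : ∫ x, f x * sin (x ⬝ᵥ ξ) = 0 := by
    have h := integral_neg_eq_self (fun x => f x * sin (x ⬝ᵥ ξ)) volume
    simp only [heven, neg_dotProduct, sin_neg, mul_neg, integral_neg] at h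
    linarith
  have e : ∀ x, (f x : ℂ) * Complex.exp ((x ⬝ᵥ ξ : ℝ) * Complex.I)
      = ((f x * cos (x ⬝ᵥ ξ) : ℝ) : ℂ) + ((f x * sin (x ⬝ᵥ ξ) : ℝ) : ℂ) * Complex.I := fun x => by
    rw [Complex.exp_mul_I]; push_cast; ring
  simp only [e]
  rw [integral_add (hf.mul_cos_dotProduct ξ).ofReal (hs.ofReal.mul_const _), integral_mul_const,
    integral_complex_ofReal, integral_complex_ofReal, hs0]
  simp [cosTransform]

lemma integral_prod_mul_cos {n m : ℕ} {f : (Fin m → ℝ) → ℝ} (hf : Integrable f)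
    (hΦ : Integrable fun x : Fin n × Fin m → ℝ => ∏ i, f (fun j => x (i, j)))
    (heven : ∀ x, f (-x) = f x) (ξ : Fin n → Fin m → ℝ) :
    ∫ x : Fin n × Fin m → ℝ, (∏ i, f (fun j => x (i, j))) * cos (∑ i, (fun j => x (i, j)) ⬝ᵥ ξ i)
      = ∏ i, cosTransform f (ξ i) := by
  have h := integral_prod_blocks fun i x => (f x : ℂ) * Complex.exp ((x ⬝ᵥ ξ i : ℝ) * Complex.I)
  simp only [integral_mul_cexp_dotProduct hf heven, Finset.prod_mul_distrib,
    ← Complex.exp_sum, ← Finset.sum_mul, ← Complex.ofReal_sum, ← Complex.ofReal_prod] at h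
  have hi : Integrable fun x : Fin n × Fin m → ℝ =>
      ((∏ i, f (fun j => x (i, j)) : ℝ) : ℂ)
        * Complex.exp ((∑ i, (fun j => x (i, j)) ⬝ᵥ ξ i : ℝ) * Complex.I) :=
    hΦ.ofReal.mul_bdd (c := 1)
      (Continuous.aestronglyMeasurable (by simp only [dotProduct]; fun_prop))
      (ae_of_all _ fun _ => (Complex.norm_exp_ofReal_mul_I _).le)
  have h2 := congrArg Complex.re h
  rw [← Complex.reCLM_apply, ← Complex.reCLM.integral_comp_comm hi, Complex.ofReal_re] at h2
  rw [← h2]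
  refine integral_congr_ae (ae_of_all _ fun x => ?_)
  simp only [Complex.reCLM_apply, Complex.re_ofReal_mul, Complex.exp_ofReal_mul_I_re]

/-- The linear parametrization of `(ℝ^m)^n` by a block hyperplane and its normal directions. -/
def normalParam {m n d : ℕ} (ι : (Fin d → ℝ) →ₗ[ℝ] (Fin n × Fin m → ℝ)) (θ : Fin n → ℝ) :
    (Fin d → ℝ) × (Fin m → ℝ) →ₗ[ℝ] (Fin n × Fin m → ℝ) where
  toFun z c := ι z.1 c + θ c.1 * z.2 c.2
  map_add' x y := by ext c; simp; ring
  map_smul' a x := by ext c; simp; ring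

namespace IsEuclParam
variable {m n d : ℕ} {ι : (Fin d → ℝ) →ₗ[ℝ] (Fin n × Fin m → ℝ)} {θ : Fin n → ℝ}

lemma sum_mul_normalParam (h : IsEuclParam m n d ι (blockHyp m n θ)) (hθ : ∑ i, θ i ^ 2 = 1)
    (z : (Fin d → ℝ) × (Fin m → ℝ)) (j : Fin m) :
    ∑ i, θ i * normalParam ι θ z (i, j) = z.2 j := by
  have h0 : ι z.1 ∈ blockHyp m n θ := h.2 ▸ Set.mem_range_self _
  have h1 : ∀ i, θ i * normalParam ι θ z (i, j) = θ i * ι z.1 (i, j) + θ i ^ 2 * z.2 j := fun i => by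
    simp only [normalParam, LinearMap.coe_mk, AddHom.coe_mk]; ring
  simp only [h1, Finset.sum_add_distrib]
  rw [h0 j, ← Finset.sum_mul, hθ, zero_add, one_mul]

lemma sum_sq_normalParam (h : IsEuclParam m n d ι (blockHyp m n θ)) (hθ : ∑ i, θ i ^ 2 = 1)
    (z : (Fin d → ℝ) × (Fin m → ℝ)) :
    ∑ c, normalParam ι θ z c ^ 2 = ∑ i, z.1 i ^ 2 + ∑ j, z.2 j ^ 2 := by
  have h0 : ι z.1 ∈ blockHyp m n θ := h.2 ▸ Set.mem_range_self _
  have h1 : ∀ c, normalParam ι θ z c ^ 2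
      = ι z.1 c ^ 2 + (2 * (θ c.1 * ι z.1 c) * z.2 c.2 + θ c.1 ^ 2 * z.2 c.2 ^ 2) := fun c => by
    simp only [normalParam, LinearMap.coe_mk, AddHom.coe_mk]; ring
  simp only [h1]
  rw [Finset.sum_add_distrib, h.1, Fintype.sum_prod_type_right]
  congr 1
  refine Finset.sum_congr rfl fun j _ => ?_
  dsimp only
  rw [Finset.sum_add_distrib, ← Finset.sum_mul, ← Finset.mul_sum, h0 j, ← Finset.sum_mul, hθ]
  ring

lemma injective (h : IsEuclParam m n d ι (blockHyp m n θ)) : Function.Injective ι := by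
  refine (injective_iff_map_eq_zero ι).2 fun y hy => ?_
  have h1 := h.1 y
  simp only [hy, Pi.zero_apply, ne_eq, OfNat.ofNat_ne_zero, not_false_eq_true, zero_pow,
    Finset.sum_const_zero] at h1
  ext i
  simpa using (Finset.sum_eq_zero_iff_of_nonneg fun i _ => sq_nonneg (y i)).1 h1.symm i
    (Finset.mem_univ i)

lemma injective_normalParam (h : IsEuclParam m n d ι (blockHyp m n θ)) (hθ : ∑ i, θ i ^ 2 = 1) :
    Function.Injective (normalParam ι θ) := by
  refine (injective_iff_map_eq_zero _).2 fun z hz => ?_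
  have h2 : z.2 = 0 := by
    ext j
    rw [← h.sum_mul_normalParam hθ z j, hz]
    simp
  have h1 : ι z.1 = 0 := by
    rw [← hz]; ext c; simp [normalParam, h2]
  exact Prod.ext ((map_eq_zero_iff ι h.injective).1 h1) h2

lemma measurePreserving_normalParam (h : IsEuclParam m n d ι (blockHyp m n θ))
    (hθ : ∑ i, θ i ^ 2 = 1) (hd : d + m = n * m) : MeasurePreserving (normalParam ι θ) := by
  let S : (Fin d ⊕ Fin m → ℝ) →ₗ[ℝ] (Fin d → ℝ) × (Fin m → ℝ) :=
    (LinearMap.funLeft ℝ ℝ Sum.inl).prod (LinearMap.funLeft ℝ ℝ Sum.inr)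
  have hS : MeasurePreserving (normalParam ι θ ∘ₗ S) := by
    refine measurePreserving_of_sum_sq_eq_s1 (fun x => ?_) (by simp [hd])
    rw [LinearMap.comp_apply, h.sum_sq_normalParam hθ, Fintype.sum_sum_type]
    rfl
  have h2 := hS.comp (volume_measurePreserving_sumPiEquivProdPi_symm
    fun _ : Fin d ⊕ Fin m => ℝ)
  exact h2

end IsEuclParam

lemma cosTransform_zero {m : ℕ} (f : (Fin m → ℝ) → ℝ) : cosTransform f 0 = ∫ x, f x := by
  simp [cosTransform]

lemma cosTransform_abs_smul {m : ℕ} (f : (Fin m → ℝ) → ℝ) (a : ℝ) (ξ : Fin m → ℝ) :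
    cosTransform f (|a| • ξ) = cosTransform f (a • ξ) := by
  rcases abs_choice a with h | h <;> simp [cosTransform, h, dotProduct_smul]

lemma integrable_gaussian_mul_cosTransform {m : ℕ} {G : (Fin m → ℝ) → ℝ} (hG : Integrable G)
    {b : ℝ} (hb : 0 < b) : Integrable fun ξ => exp (-(b * (ξ ⬝ᵥ ξ))) * cosTransform G ξ := by
  have hc : Continuous fun ξ => cosTransform G ξ := by
    refine continuous_of_dominated (bound := fun x => ‖G x‖)
      (fun ξ => (hG.mul_cos_dotProduct ξ).aestronglyMeasurable)
      (fun ξ => ae_of_all _ fun x => ?_) hG.norm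
      (ae_of_all _ fun x => by simp only [dotProduct]; fun_prop)
    rw [norm_mul]
    exact mul_le_of_le_one_right (norm_nonneg _) (abs_cos_le_one _)
  refine (integrable_exp_neg_mul_dotProduct hb).mul_bdd (c := ∫ x, ‖G x‖)
    hc.aestronglyMeasurable (ae_of_all _ fun ξ => ?_)
  refine (norm_integral_le_integral_norm _).trans
    (integral_mono (hG.mul_cos_dotProduct ξ).norm hG.norm fun x => ?_)
  simp only [norm_mul]
  exact mul_le_of_le_one_right (norm_nonneg _) (abs_cos_le_one _)

/-- The sum of copies of a function on `ℝ^m` over the blocks of a vector in `(ℝ^m)^n`. -/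
def blockSum {m : ℕ} (n : ℕ) (h : (Fin m → ℝ) → ℝ) (x : Fin n × Fin m → ℝ) : ℝ :=
  ∑ i, h (fun j => x (i, j))

namespace IsPosHomogeneous
variable {m n d : ℕ} {p : ℝ} {h : (Fin m → ℝ) → ℝ}

lemma blockSum (hh : IsPosHomogeneous p h) (hp : 0 < p) (n : ℕ) :
    IsPosHomogeneous p (blockSum n h) where
  continuous := continuous_finsetSum _ fun i _ => hh.continuous.comp (by fun_prop)
  pos x hx := by
    obtain ⟨⟨i, j⟩, hij⟩ := Function.ne_iff.1 hx
    exact Finset.sum_pos' (fun i _ => hh.nonneg hp _)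
      ⟨i, Finset.mem_univ i, hh.pos _ (Function.ne_iff.2 ⟨j, hij⟩)⟩
  smul a x := by
    simp only [_root_.blockSum, Finset.mul_sum, ← hh.smul]
    rfl

lemma exp_neg_blockSum (x : Fin n × Fin m → ℝ) :
    exp (-_root_.blockSum n h x) = ∏ i, exp (-h (fun j => x (i, j))) := by
  rw [_root_.blockSum, ← Finset.sum_neg_distrib, exp_sum]

lemma integral_exp_neg_blockSum_mul_cos (hh : IsPosHomogeneous p h) (hp : 0 < p)
    (ξ : Fin n → Fin m → ℝ) :
    ∫ x, exp (-_root_.blockSum n h x) * cos (∑ i, (fun j => x (i, j)) ⬝ᵥ ξ i)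
      = ∏ i, cosTransform (fun x => exp (-h x)) (ξ i) := by
  have hi := (hh.blockSum hp n).integrable_exp_neg volume hp
  simp only [exp_neg_blockSum] at hi ⊢
  refine integral_prod_mul_cos (hh.integrable_exp_neg volume hp) hi (fun x => ?_) ξ
  have := hh.smul (-1) x
  simp only [neg_smul, one_smul, abs_neg, abs_one, one_rpow, one_mul] at this
  rw [this]

lemma integral_exp_neg_blockSum (hh : IsPosHomogeneous p h) (hp : 0 < p) :
    ∫ x, exp (-_root_.blockSum n h x) = (∫ x, exp (-h x)) ^ n := by
  simpa [cosTransform_zero] using hh.integral_exp_neg_blockSum_mul_cos hp (n := n) fun _ => 0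

section Fiber
variable {E F : Type*} [NormedAddCommGroup E] [NormedSpace ℝ E] [FiniteDimensional ℝ E]
  [MeasureSpace E] [BorelSpace E] [(volume : Measure E).IsAddHaarMeasure]
  [NormedAddCommGroup F] [NormedSpace ℝ F] [FiniteDimensional ℝ F] {K : E × F → ℝ}

lemma continuous_integral_exp_neg_fiber (hK : IsPosHomogeneous p K) (hp : 0 < p) :
    Continuous fun v => ∫ y, exp (-K (y, v)) := by
  obtain ⟨c, hc, hle⟩ := hK.exists_mul_rpow_le hp
  have hb : IsPosHomogeneous p fun y : E => c * ‖y‖ ^ p :=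
    { continuous := continuous_const.mul (continuous_norm.rpow_const fun _ => .inr hp.le)
      pos := fun y hy => by have := norm_pos_iff.2 hy; positivity
      smul := fun a y => by
        rw [norm_smul, norm_eq_abs, mul_rpow (abs_nonneg _) (norm_nonneg _)]; ring }
  have hcont := hK.continuous
  refine continuous_of_dominated (bound := fun y => exp (-(c * ‖y‖ ^ p)))
    (fun v => Continuous.aestronglyMeasurable (by fun_prop)) (fun v => ae_of_all _ fun y => ?_)
    (hb.integrable_exp_neg volume hp) (ae_of_all _ fun y => by fun_prop)
  rw [norm_eq_abs, abs_exp, exp_le_exp, neg_le_neg_iff]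
  refine le_trans ?_ (hle (y, v))
  have : ‖y‖ ≤ ‖(y, v)‖ := norm_fst_le (y, v)
  gcongr

end Fiber

variable {ι : (Fin d → ℝ) →ₗ[ℝ] (Fin n × Fin m → ℝ)} {θ : Fin n → ℝ}

lemma integrable_exp_neg_normalParam (hh : IsPosHomogeneous p h) (hp : 0 < p)
    (hι : IsEuclParam m n d ι (blockHyp m n θ)) (hθ : ∑ i, θ i ^ 2 = 1) :
    Integrable (fun z => exp (-_root_.blockSum n h (normalParam ι θ z)))
      ((volume : Measure (Fin d → ℝ)).prod (volume : Measure (Fin m → ℝ))) :=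
  have : ((volume : Measure (Fin d → ℝ)).prod (volume : Measure (Fin m → ℝ))).IsAddHaarMeasure :=
    Measure.prod.instIsAddHaarMeasure _ _
  ((hh.blockSum hp n).comp_linearMap (hι.injective_normalParam hθ)).integrable_exp_neg _ hp

lemma integrable_section (hh : IsPosHomogeneous p h) (hp : 0 < p)
    (hι : IsEuclParam m n d ι (blockHyp m n θ)) (hθ : ∑ i, θ i ^ 2 = 1) :
    Integrable fun v : Fin m → ℝ => ∫ y, exp (-_root_.blockSum n h (normalParam ι θ (y, v))) :=
  (hh.integrable_exp_neg_normalParam hp hι hθ).integral_prod_right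

lemma cosTransform_section (hh : IsPosHomogeneous p h) (hp : 0 < p)
    (hι : IsEuclParam m n d ι (blockHyp m n θ)) (hθ : ∑ i, θ i ^ 2 = 1) (hd : d + m = n * m)
    (ξ : Fin m → ℝ) :
    cosTransform (fun v => ∫ y, exp (-_root_.blockSum n h (normalParam ι θ (y, v)))) ξ
      = ∏ i, cosTransform (fun x => exp (-h x)) (θ i • ξ) := by
  have hcont := (hh.blockSum hp n).continuous
  have hcos : Continuous fun z : (Fin d → ℝ) × (Fin m → ℝ) => cos (z.2 ⬝ᵥ ξ) := by
    simp only [dotProduct]; fun_prop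
  have hi := (hh.integrable_exp_neg_normalParam hp hι hθ).mul_bdd (c := 1)
    hcos.aestronglyMeasurable (ae_of_all _ fun _ => abs_cos_le_one _)
  have hmp := hι.measurePreserving_normalParam hθ hd
  rw [← hh.integral_exp_neg_blockSum_mul_cos hp, ← hmp.map_eq, integral_map
    hmp.measurable.aemeasurable (Continuous.aestronglyMeasurable (by
      simp only [dotProduct]; fun_prop))]
  have e : ∀ z : (Fin d → ℝ) × (Fin m → ℝ),
      ∑ i, (fun j => normalParam ι θ z (i, j)) ⬝ᵥ (θ i • ξ) = z.2 ⬝ᵥ ξ := fun z => by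
    simp only [dotProduct_smul, smul_eq_mul]
    simp only [dotProduct, Finset.mul_sum]
    rw [Finset.sum_comm]
    refine Finset.sum_congr rfl fun j _ => ?_
    rw [← hι.sum_mul_normalParam hθ z j, Finset.sum_mul]
    exact Finset.sum_congr rfl fun i _ => by ring
  simp only [e]
  rw [Measure.volume_eq_prod, integral_prod_symm _ hi]
  simp only [cosTransform, ← integral_mul_const]

lemma integrable_gaussian_mul_prod_cosTransform (hh : IsPosHomogeneous p h) (hp : 0 < p)
    (hι : IsEuclParam m n d ι (blockHyp m n θ)) (hθ : ∑ i, θ i ^ 2 = 1) (hd : d + m = n * m)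
    {b : ℝ} (hb : 0 < b) : Integrable fun ξ : Fin m → ℝ =>
      exp (-(b * (ξ ⬝ᵥ ξ))) * ∏ i, cosTransform (fun x => exp (-h x)) (θ i • ξ) := by
  simp only [← hh.cosTransform_section hp hι hθ hd]
  exact integrable_gaussian_mul_cosTransform (hh.integrable_section hp hι hθ) hb

lemma tendsto_integral_gaussian_mul_prod_cosTransform (hh : IsPosHomogeneous p h) (hp : 0 < p)
    (hι : IsEuclParam m n d ι (blockHyp m n θ)) (hθ : ∑ i, θ i ^ 2 = 1) (hd : d + m = n * m) :
    Tendsto (fun c : ℝ => ∫ ξ : Fin m → ℝ, exp (-(1 / (4 * c ^ 2) * (ξ ⬝ᵥ ξ)))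
      * ∏ i, cosTransform (fun x => exp (-h x)) (θ i • ξ)) atTop
      (𝓝 ((2 * π) ^ m * ∫ y, exp (-_root_.blockSum n h (ι y)))) := by
  have hlim := tendsto_integral_gaussian_mul_cosTransform (hh.integrable_section hp hι hθ)
    (((hh.blockSum hp n).comp_linearMap
      (hι.injective_normalParam hθ)).continuous_integral_exp_neg_fiber hp).continuousAt
  simp only [hh.cosTransform_section hp hι hθ hd] at hlim
  have e : ∀ y, normalParam ι θ (y, 0) = ι y := fun y => by ext c; simp [normalParam]
  simpa only [e] using hlim

end IsPosHomogeneous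

lemma IsQuasiNorm.isPosHomogeneous_rpow {m : ℕ} {p : ℝ} {N : (Fin m → ℝ) → ℝ}
    (hN : IsQuasiNorm m N) (hc : Continuous fun x => N x ^ p) :
    IsPosHomogeneous p fun x => N x ^ p where
  continuous := hc
  pos x hx := rpow_pos_of_pos ((hN.1 x).lt_of_ne' fun h => hx ((hN.2.1 x).1 h)) p
  smul a x := by rw [hN.2.2.1, mul_rpow (abs_nonneg _) (hN.1 x)]

namespace WeightedLogConvex
variable {m n : ℕ} {f : (Fin m → ℝ) → ℝ} {θ : Fin n → ℝ}

lemma prod_cosTransform_diag_le (hf : ∀ ξ, WeightedLogConvex fun t => cosTransform f (√t • ξ))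
    (hθ : ∑ i, θ i ^ 2 = 1) (ξ : Fin m → ℝ) :
    ∏ _i : Fin n, cosTransform f ((1 / √n) • ξ) ≤ ∏ i, cosTransform f (θ i • ξ) := by
  have h := (hf ξ).pow_le_prod (t := fun i => θ i ^ 2) (fun i => sq_nonneg _) hθ
  simp only [sqrt_sq_eq_abs, cosTransform_abs_smul] at h
  simpa using h

lemma prod_cosTransform_le (hf : ∀ ξ, WeightedLogConvex fun t => cosTransform f (√t • ξ))
    (hθ : ∑ i, θ i ^ 2 = 1) (ξ : Fin m → ℝ) :
    ∏ i, cosTransform f (θ i • ξ) ≤ (∫ x, f x) ^ (n - 1) * cosTransform f ξ := by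
  have h := (hf ξ).prod_le (t := fun i => θ i ^ 2) (fun i => sq_nonneg _) hθ
  simpa only [sqrt_sq_eq_abs, cosTransform_abs_smul, sqrt_zero, zero_smul, cosTransform_zero,
    sqrt_one, one_smul] using h

end WeightedLogConvex

lemma IsPosHomogeneous.measure_section_le {m n : ℕ} {p : ℝ} {h : (Fin m → ℝ) → ℝ}
    (hh : IsPosHomogeneous p h) (hp : 0 < p)
    (hf : ∀ ξ, WeightedLogConvex fun t => cosTransform (fun x => exp (-h x)) (√t • ξ))
    {θ : Fin n → ℝ} (hθ : ∑ i, θ i ^ 2 = 1)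
    {ιθ ιd : (Fin (m * (n - 1)) → ℝ) →ₗ[ℝ] (Fin n × Fin m → ℝ)}
    (hιθ : IsEuclParam m n (m * (n - 1)) ιθ (blockHyp m n θ))
    (hιd : IsEuclParam m n (m * (n - 1)) ιd (blockHyp m n (fun _ => 1))) :
    volume {y | _root_.blockSum n h (ιd y) ≤ 1} ≤ volume {y | _root_.blockSum n h (ιθ y) ≤ 1} ∧
      volume {y | _root_.blockSum n h (ιθ y) ≤ 1}
        ≤ volume {x | _root_.blockSum (n - 1) h x ≤ 1} := by
  have hn : 0 < n := by
    rcases n.eq_zero_or_pos with rfl | hn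
    · simp at hθ
    · exact hn
  have hd : m * (n - 1) + m = n * m := by
    obtain ⟨k, rfl⟩ := Nat.exists_eq_succ_of_ne_zero hn.ne'
    simp only [Nat.succ_eq_add_one, Nat.add_sub_cancel]
    ring
  have hdiag : ∑ _i : Fin n, (1 / √(n : ℝ)) ^ 2 = 1 := by
    have : (0 : ℝ) < n := by exact_mod_cast hn
    rw [Finset.sum_const, Finset.card_univ, Fintype.card_fin, nsmul_eq_mul, div_pow,
      sq_sqrt this.le]
    field_simp
  have hιd' : IsEuclParam m n (m * (n - 1)) ιd (blockHyp m n fun _ => 1 / √n) := by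
    have hne : 1 / √(n : ℝ) ≠ 0 := by positivity
    refine ⟨hιd.1, hιd.2.trans ?_⟩
    ext x
    simp only [blockHyp, Set.mem_ofPred_eq, ← Finset.mul_sum, one_ne_zero, hne, mul_eq_zero,
      false_or]
  have hi := hh.integrable_exp_neg volume hp
  have hb : ∀ {c : ℝ}, 0 < c → 0 < 1 / (4 * c ^ 2) := fun hc => by positivity
  have hlow := hh.tendsto_integral_gaussian_mul_prod_cosTransform hp hιd' hdiag hd
  have hmid := hh.tendsto_integral_gaussian_mul_prod_cosTransform hp hιθ hθ hd
  have hup := (tendsto_integral_gaussian_mul_cosTransform hi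
    (continuous_exp.comp hh.continuous.neg).continuousAt).const_mul
      ((∫ x, exp (-h x)) ^ (n - 1))
  have h2π : (0 : ℝ) < (2 * π) ^ m := by positivity
  constructor
  · refine ((hh.blockSum hp n).comp_linearMap hιd.injective).measure_le_of_integral_exp_neg_le
      volume ((hh.blockSum hp n).comp_linearMap hιθ.injective) hp rfl
      (le_of_mul_le_mul_left (le_of_tendsto_of_tendsto hlow hmid ?_) h2π)
    filter_upwards [eventually_gt_atTop 0] with c hc
    refine integral_mono
      (hh.integrable_gaussian_mul_prod_cosTransform hp hιd' hdiag hd (hb hc))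
      (hh.integrable_gaussian_mul_prod_cosTransform hp hιθ hθ hd (hb hc)) fun ξ => ?_
    exact mul_le_mul_of_nonneg_left (WeightedLogConvex.prod_cosTransform_diag_le hf hθ ξ)
      (exp_pos _).le
  · refine ((hh.blockSum hp n).comp_linearMap hιθ.injective).measure_le_of_integral_exp_neg_le
      volume (hh.blockSum hp (n - 1)) hp (by simp [mul_comm])
      (le_of_mul_le_mul_left (a := (2 * π) ^ m) ?_ h2π)
    rw [hh.integral_exp_neg_blockSum hp]
    have h0 : exp (-h 0) = 1 := by rw [hh.zero hp, neg_zero, exp_zero]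
    refine (le_of_tendsto_of_tendsto hmid hup ?_).trans_eq (by rw [h0]; ring)
    filter_upwards [eventually_gt_atTop 0] with c hc
    rw [← integral_const_mul]
    refine integral_mono
      (hh.integrable_gaussian_mul_prod_cosTransform hp hιθ hθ hd (hb hc))
      ((integrable_gaussian_mul_cosTransform hi (hb hc)).const_mul _) fun ξ => ?_
    simp only
    rw [mul_left_comm]
    exact mul_le_mul_of_nonneg_left (WeightedLogConvex.prod_cosTransform_le hf hθ ξ) (exp_pos _).le

lemma preimage_lpBall_inter {m n d : ℕ} {p : ℝ} {N : (Fin m → ℝ) → ℝ}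
    {ι : (Fin d → ℝ) →ₗ[ℝ] (Fin n × Fin m → ℝ)} {H : Set (Fin n × Fin m → ℝ)}
    (h : IsEuclParam m n d ι H) :
    ⇑ι ⁻¹' (lpBall m n p N ∩ H) = {y | blockSum n (fun x => N x ^ p) (ι y) ≤ 1} := by
  rw [← h.2, Set.preimage_inter_range]
  rfl

/-- **Extremal sections.** Let `p ∈ (0,2]` and let `X = (ℝ^m, N)` be a quasi-normed space
admitting an isometric embedding into `L_p`. Then for every unit vector `θ` of `ℝ^n`,
`|B_p^n(X) ∩ H_diag| ≤ |B_p^n(X) ∩ H_θ| ≤ |B_p^{n-1}(X)|`, where `H_diag = H_{(1,…,1)}`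
(as a set this is `{(x_1,…,x_n) : ∑ x_i = 0}`), and the `m(n-1)`-dimensional Lebesgue
measures of the sections are computed via Euclidean isometric parametrizations. -/
theorem sections_extremal (m n : ℕ) (p : ℝ) (hp0 : 0 < p) (hp2 : p ≤ 2)
    (N : (Fin m → ℝ) → ℝ) (hN : IsQuasiNorm m N) (hNp : EmbedsIntoLp m p N)
    (θ : Fin n → ℝ) (hθ : ∑ i, θ i ^ 2 = 1)
    (ιθ ιd : (Fin (m * (n - 1)) → ℝ) →ₗ[ℝ] (Fin n × Fin m → ℝ))
    (hιθ : IsEuclParam m n (m * (n - 1)) ιθ (blockHyp m n θ))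
    (hιd : IsEuclParam m n (m * (n - 1)) ιd (blockHyp m n (fun _ => 1))) :
    volume (⇑ιd ⁻¹' (lpBall m n p N ∩ blockHyp m n (fun _ => 1))) ≤
        volume (⇑ιθ ⁻¹' (lpBall m n p N ∩ blockHyp m n θ)) ∧
      volume (⇑ιθ ⁻¹' (lpBall m n p N ∩ blockHyp m n θ)) ≤ volume (lpBall m (n - 1) p N) := by
  have hh := hN.isPosHomogeneous_rpow (hNp.continuous_rpow hp0)
  rw [preimage_lpBall_inter hιd, preimage_lpBall_inter hιθ]
  exact hh.measure_section_le hp0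
    ((hNp.hasLogConvexTransform hp0 hp2).weightedLogConvex (hh.integrable_exp_neg volume hp0))
    hθ hιθ hιd
end
end
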